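/- For every constant c > 0 there exist C > 0 and N such that for all n = rm ≥ N with integers r ≥ 3, m ≥ 1 and integer d with 1 ≤ d ≤ m^{r−1} − 1 satisfying Λ ≥ c·r^{16}·m^{2−r}, and for every measurable set Ω̄ ⊆ ℝ^n with U_n(2ρ₀/(3r)) ⊆ Ω̄ ⊆ U_n(4ρ₀), one has ∫_{Ω̄} F(θ)·e^{−θᵗWᵗWθ} dθ = π^{n/2} · det(A + WᵗW)^{−1/2} · exp(−r/(12·Λ·m^{r−2}) + δ) for some complex δ with |δ| ≤ C·n^{−2/5}. -/

import Mathlib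

open MeasureTheory Filter

/-- The edge density `λ = d / m^(r-1)`. -/
noncomputable def lam (r m d : ℕ) : ℝ := (d : ℝ) / (m : ℝ) ^ (r - 1)

/-- `Λ = λ(1−λ)`. -/
noncomputable def Lam (r m d : ℕ) : ℝ := lam r m d * (1 - lam r m d)

/-- For an edge `e ∈ (Fin m)^r` and `θ ∈ ℝ^n` (vertices indexed by `Fin r × Fin m`,
class `t` being `{t} × Fin m`), the sum `Σ_{j∈e} θ_j`. -/
def edgeSum (r m : ℕ) (θ : Fin r × Fin m → ℝ) (e : Fin r → Fin m) : ℝ :=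
  ∑ t : Fin r, θ (t, e t)

/-- The integrand `F(θ) = (∏_e (1 + λ(e^{iΣ_{j∈e}θ_j} − 1))) · e^{−i d Σ_j θ_j}`. -/
noncomputable def Ffun (r m d : ℕ) (θ : Fin r × Fin m → ℝ) : ℂ :=
  (∏ e : Fin r → Fin m,
      (1 + (lam r m d : ℂ) * (Complex.exp (Complex.I * (edgeSum r m θ e : ℂ)) - 1))) *
    Complex.exp (-Complex.I * (d : ℂ) * ((∑ p : Fin r × Fin m, θ p : ℝ) : ℂ))

/-- Vertex `p` is one of the constrained coordinates `2m, 3m, …, rm`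
(the last vertex of each class except the first). -/
def constrained (r m : ℕ) (p : Fin r × Fin m) : Prop := p.1.val ≠ 0 ∧ p.2.val = m - 1

instance (r m : ℕ) : DecidablePred (constrained r m) :=
  fun p => inferInstanceAs (Decidable (p.1.val ≠ 0 ∧ p.2.val = m - 1))

/-- Extension by zero of a vector of free coordinates to all of `ℝ^n`;
(n−r+1)-dimensional integrals over subsets of `𝓑` are realised by pulling back along it. -/
def ext (r m : ℕ) (θ : {p : Fin r × Fin m // ¬ constrained r m p} → ℝ) :
    Fin r × Fin m → ℝ :=
  fun p => if h : constrained r m p then 0 else θ ⟨p, h⟩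

/-- `ρ₀ = r^{5/2} (log n) / (Λ m^{r−1})^{1/2}`, with `n = r·m`. -/
noncomputable def rho0 (r m d : ℕ) : ℝ :=
  (r : ℝ) ^ ((5 : ℝ) / 2) * Real.log ((r : ℝ) * m) /
    Real.sqrt (Lam r m d * (m : ℝ) ^ (r - 1))

/-- `U_n(ρ) = {x ∈ ℝ^n : ‖x‖_∞ ≤ ρ}`. -/
def Uball (r m : ℕ) (ρ : ℝ) : Set (Fin r × Fin m → ℝ) := {θ | ∀ p, |θ p| ≤ ρ}

/-- `𝓑 = {θ ∈ U_n(π) : θ_{2m} = ⋯ = θ_{rm} = 0}`. -/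
def BSet (r m : ℕ) : Set (Fin r × Fin m → ℝ) :=
  {θ | (∀ p, |θ p| ≤ Real.pi) ∧ ∀ p, constrained r m p → θ p = 0}

/-- The circular distance `|x|_{2π} = min_{k∈ℤ} |x − 2πk|`. -/
noncomputable def circ (x : ℝ) : ℝ := ⨅ k : ℤ, |x - 2 * Real.pi * k|

open Matrix

/-- The block-diagonal matrix `B` with `r` diagonal blocks `J_m`. -/
def Bmat (r m : ℕ) : Matrix (Fin r × Fin m) (Fin r × Fin m) ℝ :=
  Matrix.of fun p q => if p.1 = q.1 then 1 else 0

/-- The all-ones matrix `J_n`. -/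
def Jmat (r m : ℕ) : Matrix (Fin r × Fin m) (Fin r × Fin m) ℝ :=
  Matrix.of fun _ _ => 1

/-- `A = (Λ m^{r−1}/2)(I_n − B/m + J_n/m)`. -/
noncomputable def Amat (r m : ℕ) (Λ : ℝ) : Matrix (Fin r × Fin m) (Fin r × Fin m) ℝ :=
  (Λ * (m : ℝ) ^ ((r : ℤ) - 1) / 2) • (1 - (m : ℝ)⁻¹ • Bmat r m + (m : ℝ)⁻¹ • Jmat r m)

/-- `W = (Λ m^{r−3}/(2r))^{1/2} (rB − J_n)`. -/
noncomputable def Wmat (r m : ℕ) (Λ : ℝ) : Matrix (Fin r × Fin m) (Fin r × Fin m) ℝ :=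
  Real.sqrt (Λ * (m : ℝ) ^ ((r : ℤ) - 3) / (2 * r)) • ((r : ℝ) • Bmat r m - Jmat r m)

/-- The quadratic form `θᵗWᵗWθ = ‖Wθ‖₂²`. -/
noncomputable def qW (r m d : ℕ) (θ : Fin r × Fin m → ℝ) : ℝ :=
  ∑ p : Fin r × Fin m, ((Wmat r m (Lam r m d)).mulVec θ p) ^ 2

/-- If `f 0 = 0` and `‖f' x‖ ≤ K |x|^k` for `|x| ≤ 1`, then `‖f x‖ ≤ K |x|^(k+1)` there. -/
lemma norm_le_mul_pow_succ_of_hasDerivAt {f f' : ℝ → ℂ} {K : ℝ} {k : ℕ} (hK : 0 ≤ K)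
    (h0 : f 0 = 0) (hf : ∀ x, |x| ≤ 1 → HasDerivAt f (f' x) x)
    (hb : ∀ x, |x| ≤ 1 → ‖f' x‖ ≤ K * |x| ^ k) (x : ℝ) (hx : |x| ≤ 1) :
    ‖f x‖ ≤ K * |x| ^ (k + 1) := by
  have h := (convex_Icc (-|x|) |x|).norm_image_sub_le_of_norm_hasDerivWithin_le (f := f)
    (f' := f') (C := K * |x| ^ k) (x := 0) (y := x)
    (fun y hy => (hf y ((abs_le.2 hy).trans hx)).hasDerivWithinAt)
    (fun y hy => (hb y ((abs_le.2 hy).trans hx)).trans <| by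
      have := abs_le.2 hy
      gcongr)
    ⟨neg_nonpos.2 (abs_nonneg x), abs_nonneg x⟩ ⟨neg_abs_le x, le_abs_self x⟩
  rw [h0, sub_zero, sub_zero, Real.norm_eq_abs, mul_assoc, ← pow_succ] at h
  exact h

/-- Fourth-order expansion of `log (1 + l (e^{ix} - 1))` with a remainder proportional to
`l (1 - l)`. -/
lemma exists_one_add_mul_exp_sub_one_eq (l : ℝ) (hl0 : 0 ≤ l) (hl1 : l ≤ 1) (x : ℝ)
    (hx : |x| ≤ 1) :
    ∃ ρ : ℂ, ‖ρ‖ ≤ 260 * (l * (1 - l)) * |x| ^ 5 ∧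
      1 + (l : ℂ) * (Complex.exp (Complex.I * (x : ℂ)) - 1) =
        Complex.exp (Complex.I * l * x - ((l * (1 - l) / 2 * x ^ 2 : ℝ) : ℂ)
          - Complex.I * ((l * (1 - l) * ((1 - 2 * l) / 6) * x ^ 3 : ℝ) : ℂ)
          + ((l * (1 - l) * ((1 - 6 * (l * (1 - l))) / 24) * x ^ 4 : ℝ) : ℂ) + ρ) := by
  set L : ℝ := l * (1 - l) with hL
  have hLnn : 0 ≤ L := mul_nonneg hl0 (by linarith)
  have hL4 : L ≤ 1 / 4 := by nlinarith [sq_nonneg (l - 1 / 2)]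
  let D : ℝ → ℂ := fun x => 1 + (l : ℂ) * (Complex.exp (Complex.I * (x : ℂ)) - 1)
  let u : ℝ → ℂ := fun x => (l : ℂ) * Complex.exp (Complex.I * (x : ℂ)) / D x
  let u1 : ℝ → ℂ := fun x => u x * (1 - u x)
  let u2 : ℝ → ℂ := fun x => u1 x * (1 - 2 * u x)
  let u3 : ℝ → ℂ := fun x => u1 x * (1 - 6 * u1 x)
  have hre : ∀ x : ℝ, |x| ≤ 1 → 1 / 2 ≤ (D x).re := by
    intro x hx
    have h1 : (D x).re = 1 + l * (Real.cos x - 1) := by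
      simp [D, Complex.exp_re]
    have h2 := Real.one_sub_sq_div_two_le_cos (x := x)
    have h3 : x ^ 2 ≤ 1 := by rw [← sq_abs]; exact pow_le_one₀ (abs_nonneg x) hx
    have h4 := Real.cos_le_one x
    rw [h1]; nlinarith
  have hDnorm : ∀ x : ℝ, |x| ≤ 1 → 1 / 2 ≤ ‖D x‖ := fun x hx =>
    (hre x hx).trans (Complex.re_le_norm _)
  have hD0 : ∀ x : ℝ, |x| ≤ 1 → D x ≠ 0 := fun x hx h => by
    have := hDnorm x hx
    rw [h, norm_zero] at this
    norm_num at this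
  have hE : ∀ x : ℝ, HasDerivAt (fun x : ℝ => Complex.exp (Complex.I * (x : ℂ)))
      (Complex.exp (Complex.I * (x : ℂ)) * Complex.I) x := by
    intro x
    have := ((Complex.ofRealCLM.hasDerivAt (x := x)).const_mul Complex.I).cexp
    simpa using this
  have hD : ∀ x : ℝ, HasDerivAt D ((l : ℂ) * (Complex.exp (Complex.I * (x : ℂ)) * Complex.I)) x :=
    fun x => (((hE x).sub_const 1).const_mul (l : ℂ)).const_add 1
  have hu : ∀ x : ℝ, |x| ≤ 1 → HasDerivAt u (Complex.I * u1 x) x := by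
    intro x hx
    refine (((hE x).const_mul (l : ℂ)).div (hD x) (hD0 x hx)).congr_deriv ?_
    have := hD0 x hx
    simp only [u1, u]
    field_simp
    try ring
  have hu1 : ∀ x : ℝ, |x| ≤ 1 → HasDerivAt u1 (Complex.I * u2 x) x := by
    intro x hx
    refine ((hu x hx).mul ((hu x hx).const_sub 1)).congr_deriv ?_
    simp only [u2, u1]; ring
  have hu2 : ∀ x : ℝ, |x| ≤ 1 → HasDerivAt u2 (Complex.I * u3 x) x := by
    intro x hx
    refine ((hu1 x hx).mul (((hu x hx).const_mul 2).const_sub 1)).congr_deriv ?_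
    simp only [u3, u2, u1]; ring
  have hu3 : ∀ x : ℝ, |x| ≤ 1 → HasDerivAt u3 (Complex.I * (u2 x * (1 - 12 * u1 x))) x := by
    intro x hx
    refine ((hu1 x hx).mul (((hu1 x hx).const_mul 6).const_sub 1)).congr_deriv ?_
    ring
  have hun : ∀ x : ℝ, |x| ≤ 1 → ‖u x‖ ≤ 2 := by
    intro x hx
    have h1 := hDnorm x hx
    simp only [u]
    rw [norm_div, norm_mul, mul_comm Complex.I, Complex.norm_exp_ofReal_mul_I, mul_one,
      Complex.norm_real, Real.norm_eq_abs, abs_of_nonneg hl0, div_le_iff₀ (by linarith)]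
    linarith
  have hu1n : ∀ x : ℝ, |x| ≤ 1 → ‖u1 x‖ ≤ 4 * L := by
    intro x hx
    have h1 := hDnorm x hx
    have h0 := hD0 x hx
    have h2 : u1 x = (L : ℂ) * Complex.exp (Complex.I * (x : ℂ)) / (D x * D x) := by
      have h3 : 1 - u x = (1 - l) / D x := by
        simp only [u]
        field_simp
        simp only [D]; ring
      simp only [u1]
      rw [h3]
      simp only [u, hL]
      push_cast
      field_simp
    rw [h2, norm_div, norm_mul, norm_mul, mul_comm Complex.I, Complex.norm_exp_ofReal_mul_I,
      mul_one, Complex.norm_real, Real.norm_eq_abs, abs_of_nonneg hLnn,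
      div_le_iff₀ (by nlinarith)]
    nlinarith [mul_le_mul h1 h1 (by norm_num) (by linarith)]
  have h5n : ∀ x : ℝ, |x| ≤ 1 → ‖Complex.I * (u2 x * (1 - 12 * u1 x))‖ ≤ 260 * L * |x| ^ 0 := by
    intro x hx
    have h1 := hun x hx
    have h2 := hu1n x hx
    have h3 : ‖1 - 2 * u x‖ ≤ 5 := by
      calc ‖1 - 2 * u x‖ ≤ ‖(1 : ℂ)‖ + ‖2 * u x‖ := norm_sub_le _ _
        _ ≤ 5 := by rw [norm_mul]; simp; linarith
    have h4 : ‖1 - 12 * u1 x‖ ≤ 13 := by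
      calc ‖1 - 12 * u1 x‖ ≤ ‖(1 : ℂ)‖ + ‖12 * u1 x‖ := norm_sub_le _ _
        _ ≤ 13 := by rw [norm_mul]; simp; linarith
    rw [norm_mul, Complex.norm_I, one_mul, norm_mul, pow_zero, mul_one]
    simp only [u2]
    rw [norm_mul]
    calc ‖u1 x‖ * ‖1 - 2 * u x‖ * ‖1 - 12 * u1 x‖ ≤ (4 * L) * 5 * 13 := by gcongr
      _ = 260 * L := by ring
  have hD00 : D 0 = 1 := by simp [D]
  have hu0 : u 0 = l := by simp [u, hD00]
  have hu10 : u1 0 = L := by simp [u1, hu0, hL]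
  have hu20 : u2 0 = L * (1 - 2 * l) := by simp [u2, hu10, hu0]
  have hu30 : u3 0 = L * (1 - 6 * L) := by simp [u3, hu10]
  have hxd : ∀ x : ℝ, HasDerivAt (fun x : ℝ => (x : ℂ)) 1 x := fun x =>
    Complex.ofRealCLM.hasDerivAt
  have hK : 0 ≤ 260 * L := by positivity
  have key3 := norm_le_mul_pow_succ_of_hasDerivAt hK
    (f := fun x => u3 x - L * (1 - 6 * L)) (by simp [hu30])
    (fun x hx => (hu3 x hx).sub_const _) h5n
  have nI : ∀ z : ℂ, ‖Complex.I * z‖ = ‖z‖ := fun z => by simp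
  have key2 := norm_le_mul_pow_succ_of_hasDerivAt hK
    (f := fun x => u2 x - L * (1 - 2 * l) - Complex.I * (L * (1 - 6 * L)) * x)
    (f' := fun x => Complex.I * (u3 x - L * (1 - 6 * L))) (by simp [hu20])
    (fun x hx => (((hu2 x hx).sub_const _).sub ((hxd x).const_mul _)).congr_deriv (by ring))
    (fun x hx => by rw [nI]; exact key3 x hx)
  have key1 := norm_le_mul_pow_succ_of_hasDerivAt hK
    (f := fun x => u1 x - L - Complex.I * (L * (1 - 2 * l)) * x + L * (1 - 6 * L) / 2 * (x : ℂ) ^ 2)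
    (f' := fun x => Complex.I * (u2 x - L * (1 - 2 * l) - Complex.I * (L * (1 - 6 * L)) * x))
    (by simp [hu10])
    (fun x hx => ((((hu1 x hx).sub_const _).sub ((hxd x).const_mul _)).add
      (((hxd x).pow 2).const_mul _)).congr_deriv (by
        push_cast; ring_nf; simp only [Complex.I_sq]; ring))
    (fun x hx => by rw [nI]; exact key2 x hx)
  have key0 := norm_le_mul_pow_succ_of_hasDerivAt hK
    (f := fun x => u x - l - Complex.I * L * x + L * (1 - 2 * l) / 2 * (x : ℂ) ^ 2
      + Complex.I * (L * (1 - 6 * L) / 6) * (x : ℂ) ^ 3)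
    (f' := fun x => Complex.I * (u1 x - L - Complex.I * (L * (1 - 2 * l)) * x
      + L * (1 - 6 * L) / 2 * (x : ℂ) ^ 2))
    (by simp [hu0])
    (fun x hx => (((((hu x hx).sub_const _).sub ((hxd x).const_mul _)).add
      (((hxd x).pow 2).const_mul _)).add (((hxd x).pow 3).const_mul _)).congr_deriv (by
        push_cast; ring_nf; simp only [Complex.I_sq]; ring))
    (fun x hx => by rw [nI]; exact key1 x hx)
  have hlog : ∀ x : ℝ, |x| ≤ 1 → HasDerivAt (fun x => Complex.log (D x)) (Complex.I * u x) x := by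
    intro x hx
    refine ((hD x).clog_real ?_).congr_deriv ?_
    · exact Or.inl (by have := hre x hx; linarith)
    · simp only [u]; ring
  have key := norm_le_mul_pow_succ_of_hasDerivAt hK
    (f := fun x => Complex.log (D x) - Complex.I * l * x + L / 2 * (x : ℂ) ^ 2
      + Complex.I * (L * (1 - 2 * l) / 6) * (x : ℂ) ^ 3 - L * (1 - 6 * L) / 24 * (x : ℂ) ^ 4)
    (f' := fun x => Complex.I * (u x - l - Complex.I * L * x + L * (1 - 2 * l) / 2 * (x : ℂ) ^ 2
      + Complex.I * (L * (1 - 6 * L) / 6) * (x : ℂ) ^ 3))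
    (by simp [hD00])
    (fun x hx => (((((hlog x hx).sub ((hxd x).const_mul _)).add
      (((hxd x).pow 2).const_mul _)).add (((hxd x).pow 3).const_mul _)).sub
      (((hxd x).pow 4).const_mul _)).congr_deriv (by
        push_cast; ring_nf; simp only [Complex.I_sq]; ring))
    (fun x hx => by rw [nI]; exact key0 x hx) x hx
  refine ⟨_, key, ?_⟩
  refine (Complex.exp_log (hD0 x hx)).symm.trans ?_
  congr 1
  push_cast
  ring

lemma sum_fin_succ_fun_eq {r m : ℕ} (η : Fin (r + 1) → Fin m → ℝ) (f : ℝ → ℝ) :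
    ∑ e : Fin (r + 1) → Fin m, f (∑ t, η t (e t)) =
      ∑ j : Fin m, ∑ e : Fin r → Fin m, f (η 0 j + ∑ t, η t.succ (e t)) := by
  rw [← (Fin.consEquiv (fun _ : Fin (r + 1) => Fin m)).sum_comp, Fintype.sum_prod_type]
  simp [Fin.sum_univ_succ, Fin.consEquiv]

/-- Power sums over all transversals of independent centred choices, shifted by `T`. -/
lemma sum_edges_pow {m : ℕ} (hm : m ≠ 0) : ∀ (r : ℕ) (η : Fin r → Fin m → ℝ),
    (∀ t, ∑ j, η t j = 0) → ∀ T : ℝ,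
    (∑ e : Fin r → Fin m, (T + ∑ t, η t (e t)) = (m : ℝ) ^ r * T) ∧
    (∑ e : Fin r → Fin m, (T + ∑ t, η t (e t)) ^ 2 =
      (m : ℝ) ^ r * (T ^ 2 + ∑ t, (∑ j, η t j ^ 2) / m)) ∧
    (∑ e : Fin r → Fin m, (T + ∑ t, η t (e t)) ^ 3 =
      (m : ℝ) ^ r * (T ^ 3 + 3 * T * ∑ t, (∑ j, η t j ^ 2) / m + ∑ t, (∑ j, η t j ^ 3) / m)) ∧
    (∑ e : Fin r → Fin m, (T + ∑ t, η t (e t)) ^ 4 =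
      (m : ℝ) ^ r * (T ^ 4 + 6 * T ^ 2 * ∑ t, (∑ j, η t j ^ 2) / m
        + 4 * T * ∑ t, (∑ j, η t j ^ 3) / m + ∑ t, (∑ j, η t j ^ 4) / m
        + 3 * ((∑ t, (∑ j, η t j ^ 2) / m) ^ 2 - ∑ t, ((∑ j, η t j ^ 2) / m) ^ 2))) := by
  have hm' : (m : ℝ) ≠ 0 := Nat.cast_ne_zero.2 hm
  intro r
  induction r with
  | zero => intro η _ T; simp
  | succ r ih =>
    intro η hη T
    have ih' := fun T => ih (fun t => η t.succ) (fun t => hη t.succ) T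
    have h0 := hη 0
    refine ⟨?_, ?_, ?_, ?_⟩
    · rw [sum_fin_succ_fun_eq η (fun y => T + y)]
      simp_rw [← add_assoc, fun T => (ih' T).1, ← Finset.mul_sum, Finset.sum_add_distrib, h0]
      simp; ring
    · rw [sum_fin_succ_fun_eq η (fun y => (T + y) ^ 2)]
      simp_rw [← add_assoc, fun T => (ih' T).2.1, ← Finset.mul_sum, Fin.sum_univ_succ]
      set Q := ∑ t : Fin r, (∑ j, η t.succ j ^ 2) / m
      have : ∀ j, (T + η 0 j) ^ 2 + Q = (T ^ 2 + Q) + (2 * T) * η 0 j + η 0 j ^ 2 := by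
        intro j; ring
      simp_rw [this, Finset.sum_add_distrib, ← Finset.mul_sum, h0]
      simp; field_simp; ring
    · rw [sum_fin_succ_fun_eq η (fun y => (T + y) ^ 3)]
      simp_rw [← add_assoc, fun T => (ih' T).2.2.1, ← Finset.mul_sum, Fin.sum_univ_succ]
      set Q := ∑ t : Fin r, (∑ j, η t.succ j ^ 2) / m
      set C := ∑ t : Fin r, (∑ j, η t.succ j ^ 3) / m
      have : ∀ j, (T + η 0 j) ^ 3 + 3 * (T + η 0 j) * Q + C = (T ^ 3 + 3 * T * Q + C)
          + (3 * T ^ 2 + 3 * Q) * η 0 j + (3 * T) * η 0 j ^ 2 + η 0 j ^ 3 := by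
        intro j; ring
      simp_rw [this, Finset.sum_add_distrib, ← Finset.mul_sum, h0]
      simp; field_simp; ring
    · rw [sum_fin_succ_fun_eq η (fun y => (T + y) ^ 4)]
      simp_rw [← add_assoc, fun T => (ih' T).2.2.2, ← Finset.mul_sum, Fin.sum_univ_succ]
      set Q := ∑ t : Fin r, (∑ j, η t.succ j ^ 2) / m
      set C := ∑ t : Fin r, (∑ j, η t.succ j ^ 3) / m
      set K := ∑ t : Fin r, (∑ j, η t.succ j ^ 4) / m
      set P := ∑ t : Fin r, ((∑ j, η t.succ j ^ 2) / m) ^ 2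
      have : ∀ j, (T + η 0 j) ^ 4 + 6 * (T + η 0 j) ^ 2 * Q + 4 * (T + η 0 j) * C + K
          + 3 * (Q ^ 2 - P) = (T ^ 4 + 6 * T ^ 2 * Q + 4 * T * C + K + 3 * (Q ^ 2 - P))
          + (4 * T ^ 3 + 12 * T * Q + 4 * C) * η 0 j + (6 * T ^ 2 + 6 * Q) * η 0 j ^ 2
          + (4 * T) * η 0 j ^ 3 + η 0 j ^ 4 := by
        intro j; ring
      simp_rw [this, Finset.sum_add_distrib, ← Finset.mul_sum, h0]
      simp; field_simp; ring

/-- The mean of `h` over the class `t`. -/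
noncomputable def classMean {r m : ℕ} (h : Fin r × Fin m → ℝ) (t : Fin r) : ℝ :=
  (∑ j, h (t, j)) / m

/-- The linear map `I - (1 - r^{-1/2}) B / m`. -/
noncomputable def shrink {r m : ℕ} (h : Fin r × Fin m → ℝ) : Fin r × Fin m → ℝ :=
  fun p => h p - (1 - (√(r : ℝ))⁻¹) * classMean h p.1

/-- The centred variable `h (t, j) - mean of class t`. -/
noncomputable def centred {r m : ℕ} (h : Fin r × Fin m → ℝ) (t : Fin r) (j : Fin m) : ℝ :=
  h (t, j) - classMean h t

/-- The mean edge sum after the map `shrink`. -/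
noncomputable def meanEdge {r m : ℕ} (h : Fin r × Fin m → ℝ) : ℝ :=
  (√(r : ℝ))⁻¹ * ∑ t, classMean h t

section
variable {r m : ℕ}

lemma sum_class_eq (hm : m ≠ 0) (h : Fin r × Fin m → ℝ) (t : Fin r) :
    ∑ j, h (t, j) = m * classMean h t := by
  have : (m : ℝ) ≠ 0 := Nat.cast_ne_zero.2 hm
  rw [classMean]; field_simp

lemma sum_centred (hm : m ≠ 0) (h : Fin r × Fin m → ℝ) (t : Fin r) :
    ∑ j, centred h t j = 0 := by
  simp [centred, Finset.sum_sub_distrib, sum_class_eq hm]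

lemma sum_class_shrink (hm : m ≠ 0) (h : Fin r × Fin m → ℝ) (t : Fin r) :
    ∑ j, shrink h (t, j) = m * ((√(r : ℝ))⁻¹ * classMean h t) := by
  simp [shrink, Finset.sum_sub_distrib, sum_class_eq hm]; ring

lemma edgeSum_shrink (h : Fin r × Fin m → ℝ) (e : Fin r → Fin m) :
    edgeSum r m (shrink h) e = meanEdge h + ∑ t, centred h t (e t) := by
  simp only [edgeSum, meanEdge, Finset.mul_sum, ← Finset.sum_add_distrib, shrink, centred]
  exact Finset.sum_congr rfl fun t _ => by ring

lemma edgeSum_smul (s : ℝ) (h : Fin r × Fin m → ℝ) (e : Fin r → Fin m) :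
    edgeSum r m (s • h) e = s * edgeSum r m h e := by
  simp [edgeSum, Finset.mul_sum]

lemma sum_centred_sq (hm : m ≠ 0) (h : Fin r × Fin m → ℝ) (t : Fin r) :
    ∑ j, centred h t j ^ 2 = ∑ j, h (t, j) ^ 2 - m * classMean h t ^ 2 := by
  have : ∀ j, centred h t j ^ 2 =
      h (t, j) ^ 2 - (2 * classMean h t) * h (t, j) + classMean h t ^ 2 := by
    intro j; simp only [centred]; ring
  simp_rw [this, Finset.sum_add_distrib, Finset.sum_sub_distrib, ← Finset.mul_sum,
    sum_class_eq hm]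
  simp; ring

lemma qW_shrink {d : ℕ} (hr : r ≠ 0) (hm : m ≠ 0) (hΛ : 0 ≤ Lam r m d) (s : ℝ)
    (h : Fin r × Fin m → ℝ) :
    qW r m d (s • shrink h) = Lam r m d * (m : ℝ) ^ r * s ^ 2 / 2 *
      (∑ t, classMean h t ^ 2 - meanEdge h ^ 2) := by
  have hr' : (r : ℝ) ≠ 0 := Nat.cast_ne_zero.2 hr
  have hm' : (m : ℝ) ≠ 0 := Nat.cast_ne_zero.2 hm
  have hrs : (√(r : ℝ)) ^ 2 = r := Real.sq_sqrt (Nat.cast_nonneg r)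
  have hsr : √(r : ℝ) ≠ 0 := by
    rw [Real.sqrt_ne_zero']; exact_mod_cast Nat.pos_of_ne_zero hr
  have hW : ∀ p : Fin r × Fin m, (Wmat r m (Lam r m d)).mulVec (s • shrink h) p =
      √(Lam r m d * (m : ℝ) ^ ((r : ℤ) - 3) / (2 * r)) *
        (s * m * (r * ((√(r : ℝ))⁻¹ * classMean h p.1) - meanEdge h)) := by
    intro p
    have hB : ∑ q : Fin r × Fin m, (if p.1 = q.1 then (1 : ℝ) else 0) * shrink h q
        = m * ((√(r : ℝ))⁻¹ * classMean h p.1) := by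
      rw [Fintype.sum_prod_type]
      simp only [ite_mul, one_mul, zero_mul]
      rw [Finset.sum_eq_single p.1]
      · simpa using sum_class_shrink hm h p.1
      · intro t _ ht; simp [Ne.symm ht]
      · simp
    have hJ : ∑ q : Fin r × Fin m, shrink h q = m * meanEdge h := by
      rw [Fintype.sum_prod_type]
      simp_rw [sum_class_shrink hm, ← Finset.mul_sum]
      rfl
    simp only [Wmat, Matrix.smul_mulVec, Matrix.sub_mulVec, Matrix.mulVec_smul, Pi.smul_apply,
      Pi.sub_apply, smul_eq_mul]
    have h1 : (Bmat r m).mulVec (shrink h) p = m * ((√(r : ℝ))⁻¹ * classMean h p.1) := by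
      rw [← hB]; simp [Matrix.mulVec, dotProduct, Bmat]
    have h2 : (Jmat r m).mulVec (shrink h) p = m * meanEdge h := by
      rw [← hJ]; simp [Matrix.mulVec, dotProduct, Jmat]
    rw [h1, h2]; ring
  have hz : (m : ℝ) ^ ((r : ℤ) - 3) = (m : ℝ) ^ r / (m : ℝ) ^ 3 := by
    rw [zpow_sub₀ hm']; norm_cast
  have hm0 : (0 : ℝ) ≤ m := Nat.cast_nonneg m
  have hc : √(Lam r m d * (m : ℝ) ^ ((r : ℤ) - 3) / (2 * r)) ^ 2 =
      Lam r m d * ((m : ℝ) ^ r / (m : ℝ) ^ 3) / (2 * r) := by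
    rw [Real.sq_sqrt, hz]; positivity
  simp only [qW, hW]
  simp_rw [mul_pow _ _ 2, hc, Fintype.sum_prod_type]
  simp only [Finset.sum_const, Finset.card_univ, Fintype.card_fin, nsmul_eq_mul]
  have hsum : ∑ t, (r * ((√(r : ℝ))⁻¹ * classMean h t) - meanEdge h) ^ 2 =
      r * (∑ t, classMean h t ^ 2 - meanEdge h ^ 2) := by
    have e1 : ∀ t, (r * ((√(r : ℝ))⁻¹ * classMean h t) - meanEdge h) ^ 2 =
        r * classMean h t ^ 2 - (2 * r * (√(r : ℝ))⁻¹ * meanEdge h) * classMean h t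
          + meanEdge h ^ 2 := by
      intro t
      have : (r : ℝ) ^ 2 * (√(r : ℝ))⁻¹ ^ 2 = r := by
        rw [inv_pow, hrs]; field_simp
      linear_combination (classMean h t ^ 2) * this
    have e2 : (√(r : ℝ))⁻¹ * ∑ t, classMean h t = meanEdge h := rfl
    simp_rw [e1, Finset.sum_add_distrib, Finset.sum_sub_distrib, ← Finset.mul_sum]
    simp only [Finset.sum_const, Finset.card_univ, Fintype.card_fin, nsmul_eq_mul]
    linear_combination (-2 * r * meanEdge h) * e2
  simp_rw [← Finset.mul_sum, hsum]
  field_simp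

lemma sum_sq_eq (hm : m ≠ 0) (h : Fin r × Fin m → ℝ) :
    ∑ p, h p ^ 2 = m * (∑ t, classMean h t ^ 2 + ∑ t, (∑ j, centred h t j ^ 2) / m) := by
  have hm' : (m : ℝ) ≠ 0 := Nat.cast_ne_zero.2 hm
  rw [Fintype.sum_prod_type, ← Finset.sum_add_distrib, Finset.mul_sum]
  refine Finset.sum_congr rfl fun t _ => ?_
  rw [sum_centred_sq hm]; field_simp; ring

/-- After the linear change of variables the integrand is a Gaussian density times the exponential
of the cubic and quartic terms and a small remainder. -/
lemma Ffun_mul_exp_shrink {d : ℕ} (hr : r ≠ 0) (hm : m ≠ 0) (hl0 : 0 ≤ lam r m d)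
    (hl1 : lam r m d ≤ 1) (s : ℝ) (hs : s ^ 2 * (Lam r m d * (m : ℝ) ^ (r - 1)) = 1)
    (h : Fin r × Fin m → ℝ) (hh : ∀ e, |s * edgeSum r m (shrink h) e| ≤ 1) :
    ∃ ρ : ℂ, ‖ρ‖ ≤ 260 * Lam r m d * ∑ e, |s * edgeSum r m (shrink h) e| ^ 5 ∧
      Ffun r m d (s • shrink h) * Complex.exp (-((qW r m d (s • shrink h) : ℝ) : ℂ)) =
        ((Real.exp (-(∑ p, h p ^ 2) / 2) : ℝ) : ℂ) * Complex.exp (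
          -Complex.I * (((1 - 2 * lam r m d) / 6 *
            (Lam r m d * ∑ e, (s * edgeSum r m (shrink h) e) ^ 3) : ℝ) : ℂ) +
          (((1 - 6 * Lam r m d) / 24 *
            (Lam r m d * ∑ e, (s * edgeSum r m (shrink h) e) ^ 4) : ℝ) : ℂ) + ρ) := by
  have hm' : (m : ℝ) ≠ 0 := Nat.cast_ne_zero.2 hm
  have hΛ : 0 ≤ Lam r m d := mul_nonneg hl0 (by linarith)
  choose ρ hρ1 hρ2 using fun e => exists_one_add_mul_exp_sub_one_eq (lam r m d) hl0 hl1 _ (hh e)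
  refine ⟨∑ e, ρ e, ?_, ?_⟩
  · refine (norm_sum_le _ _).trans ?_
    rw [Finset.mul_sum]
    exact Finset.sum_le_sum fun e _ => hρ1 e
  obtain ⟨M1, M2, -, -⟩ := sum_edges_pow hm r (centred h) (sum_centred hm h) (meanEdge h)
  have hpow : (m : ℝ) ^ r = m * (m : ℝ) ^ (r - 1) := by
    rw [← pow_succ', Nat.sub_add_cancel (Nat.one_le_iff_ne_zero.2 hr)]
  have hd : (d : ℝ) = lam r m d * (m : ℝ) ^ (r - 1) := by
    rw [lam]; field_simp
  have hJ : ∑ p, (s • shrink h) p = s * (m * meanEdge h) := by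
    simp only [Pi.smul_apply, smul_eq_mul, ← Finset.mul_sum, Fintype.sum_prod_type]
    simp_rw [sum_class_shrink hm, ← Finset.mul_sum]
    rfl
  have hlin : lam r m d * ∑ e, s * edgeSum r m (shrink h) e = d * ∑ p, (s • shrink h) p := by
    rw [hJ, ← Finset.mul_sum]
    simp_rw [edgeSum_shrink, M1, hpow]
    rw [hd]; ring
  have hquad : Lam r m d / 2 * ∑ e, (s * edgeSum r m (shrink h) e) ^ 2
      + qW r m d (s • shrink h) = (∑ p, h p ^ 2) / 2 := by
    simp_rw [mul_pow, ← Finset.mul_sum, edgeSum_shrink, M2, qW_shrink hr hm hΛ,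
      sum_sq_eq hm h, hpow]
    linear_combination (m * (∑ t, classMean h t ^ 2 + ∑ t, (∑ j, centred h t j ^ 2) / m) / 2) * hs
  have hF : Ffun r m d (s • shrink h) = Complex.exp (∑ e, (Complex.I * lam r m d *
      ((s * edgeSum r m (shrink h) e : ℝ) : ℂ)
      - ((lam r m d * (1 - lam r m d) / 2 * (s * edgeSum r m (shrink h) e) ^ 2 : ℝ) : ℂ)
      - Complex.I * ((lam r m d * (1 - lam r m d) * ((1 - 2 * lam r m d) / 6)
        * (s * edgeSum r m (shrink h) e) ^ 3 : ℝ) : ℂ)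
      + ((lam r m d * (1 - lam r m d) * ((1 - 6 * (lam r m d * (1 - lam r m d))) / 24)
        * (s * edgeSum r m (shrink h) e) ^ 4 : ℝ) : ℂ) + ρ e) -
      Complex.I * ((d * ∑ p, (s • shrink h) p : ℝ) : ℂ)) := by
    rw [Ffun, sub_eq_add_neg, Complex.exp_add, Complex.exp_sum]
    congr 1
    · exact Finset.prod_congr rfl fun e _ => by rw [edgeSum_smul, hρ2 e]
    · congr 1; push_cast; ring
  rw [hF, ← hlin, ← Complex.exp_add, Complex.ofReal_exp, ← Complex.exp_add]
  congr 1
  have hL : lam r m d * (1 - lam r m d) = Lam r m d := rfl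
  rw [hL, neg_div, ← hquad]
  simp only [Finset.sum_add_distrib, Finset.sum_sub_distrib, ← Finset.mul_sum, ← Complex.ofReal_sum]
  push_cast
  ring

end

/-- The standard Gaussian measure on `ι → ℝ`. -/
noncomputable def stdGauss (ι : Type*) [Fintype ι] : Measure (ι → ℝ) :=
  Measure.pi fun _ => ProbabilityTheory.gaussianReal 0 1

instance (ι : Type*) [Fintype ι] : IsProbabilityMeasure (stdGauss ι) := by
  unfold stdGauss; infer_instance

lemma prod_gaussianPDFReal {ι : Type*} [Fintype ι] (h : ι → ℝ) :
    ∏ p, ProbabilityTheory.gaussianPDFReal 0 1 (h p) =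
      (√(2 * Real.pi))⁻¹ ^ Fintype.card ι * Real.exp (-(∑ p, h p ^ 2) / 2) := by
  simp only [ProbabilityTheory.gaussianPDFReal, Finset.prod_mul_distrib, ← Real.exp_sum]
  simp [neg_div, Finset.sum_div]

lemma stdGauss_eq_withDensity {ι : Type*} [Fintype ι] :
    stdGauss ι = (volume : Measure (ι → ℝ)).withDensity
      fun h => ENNReal.ofReal (∏ p, ProbabilityTheory.gaussianPDFReal 0 1 (h p)) := by
  refine (Measure.pi_eq fun s hs => ?_)
  have hi : Integrable (fun h : ι → ℝ => ∏ p, ProbabilityTheory.gaussianPDFReal 0 1 (h p))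
      (Measure.pi fun p => (volume : Measure ℝ).restrict (s p)) :=
    Integrable.fintype_prod fun p =>
      (ProbabilityTheory.integrable_gaussianPDFReal 0 1).integrableOn
  rw [withDensity_apply _ (MeasurableSet.univ_pi hs), volume_pi, Measure.restrict_pi_pi,
    ← ofReal_integral_eq_lintegral_ofReal hi
      (ae_of_all _ fun h => Finset.prod_nonneg fun p _ =>
        ProbabilityTheory.gaussianPDFReal_nonneg 0 1 _),
    integral_fintype_prod_eq_prod (fun _ x => ProbabilityTheory.gaussianPDFReal 0 1 x),
    ENNReal.ofReal_prod_of_nonneg fun p _ => integral_nonneg fun x =>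
      ProbabilityTheory.gaussianPDFReal_nonneg 0 1 x]
  exact Finset.prod_congr rfl fun p _ =>
    (ProbabilityTheory.gaussianReal_apply_eq_integral 0 one_ne_zero (s p)).symm

lemma setIntegral_stdGauss {ι : Type*} [Fintype ι] (f : (ι → ℝ) → ℂ) {S : Set (ι → ℝ)}
    (hS : MeasurableSet S) :
    ∫ h in S, ((Real.exp (-(∑ p, h p ^ 2) / 2) : ℝ) : ℂ) * f h =
      (√(2 * Real.pi)) ^ Fintype.card ι * ∫ h in S, f h ∂(stdGauss ι) := by
  have hm : Measurable fun h : ι → ℝ =>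
      (∏ p, ProbabilityTheory.gaussianPDFReal 0 1 (h p)).toNNReal := by
    refine Measurable.real_toNNReal (Finset.measurable_fun_prod _ fun p _ => ?_)
    exact (ProbabilityTheory.measurable_gaussianPDFReal 0 1).comp (measurable_pi_apply p)
  have h1 := setIntegral_withDensity_eq_setIntegral_smul (μ := (volume : Measure (ι → ℝ))) hm f hS
  have h2 : stdGauss ι = (volume : Measure (ι → ℝ)).withDensity
      fun h => ((∏ p, ProbabilityTheory.gaussianPDFReal 0 1 (h p)).toNNReal : ENNReal) :=
    stdGauss_eq_withDensity
  rw [h2, h1, ← integral_const_mul]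
  refine setIntegral_congr_fun hS fun h _ => ?_
  have h3 : √(2 * Real.pi) ≠ 0 := by positivity
  have h4 : (0 : ℝ) ≤ ∏ p, ProbabilityTheory.gaussianPDFReal 0 1 (h p) :=
    Finset.prod_nonneg fun p _ => ProbabilityTheory.gaussianPDFReal_nonneg 0 1 _
  simp only [NNReal.smul_def, Real.coe_toNNReal _ h4, Complex.real_smul]
  rw [prod_gaussianPDFReal]
  have h5 : ((√(2 * Real.pi) : ℝ) : ℂ) ≠ 0 := Complex.ofReal_ne_zero.2 h3
  push_cast
  rw [inv_pow]
  field_simp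

section
variable {r m : ℕ}

/-- The matrix of `s • shrink`. -/
noncomputable def shrinkMat (r m : ℕ) (s : ℝ) : Matrix (Fin r × Fin m) (Fin r × Fin m) ℝ :=
  s • (1 - ((1 - (√(r : ℝ))⁻¹) / m) • Bmat r m)

lemma shrinkMat_mulVec (s : ℝ) (h : Fin r × Fin m → ℝ) :
    (shrinkMat r m s).mulVec h = s • shrink h := by
  ext p
  have hB : (Bmat r m).mulVec h p = ∑ j, h (p.1, j) := by
    simp only [Matrix.mulVec, dotProduct, Bmat, Matrix.of_apply, Fintype.sum_prod_type, ite_mul,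
      one_mul, zero_mul]
    rw [Finset.sum_eq_single p.1]
    · simp
    · intro t _ ht; simp [Ne.symm ht]
    · simp
  simp only [shrinkMat, Matrix.smul_mulVec, Matrix.sub_mulVec, Matrix.one_mulVec, Pi.smul_apply,
    Pi.sub_apply, smul_eq_mul, hB, shrink, classMean]
  ring

lemma Bmat_mul_Bmat : Bmat r m * Bmat r m = (m : ℝ) • Bmat r m := by
  ext p q
  simp only [Matrix.mul_apply, Bmat, Matrix.of_apply, Matrix.smul_apply, smul_eq_mul,
    Fintype.sum_prod_type]
  by_cases hpq : p.1 = q.1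
  · rw [Finset.sum_eq_single p.1]
    · simp [hpq]
    · intro t _ ht; simp [Ne.symm ht]
    · simp
  · rw [if_neg hpq, mul_zero]
    refine Finset.sum_eq_zero fun t _ => Finset.sum_eq_zero fun j _ => ?_
    by_cases h : p.1 = t
    · subst h; simp [hpq]
    · simp [h]

lemma Bmat_mul_Jmat : Bmat r m * Jmat r m = (m : ℝ) • Jmat r m := by
  ext p q
  simp only [Matrix.mul_apply, Bmat, Jmat, Matrix.of_apply, Matrix.smul_apply, smul_eq_mul,
    Fintype.sum_prod_type, mul_one]
  rw [Finset.sum_eq_single p.1]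
  · simp
  · intro t _ ht; simp [Ne.symm ht]
  · simp

lemma Bmat_transpose : (Bmat r m)ᵀ = Bmat r m := by
  ext p q; simp [Bmat, eq_comm]

lemma Jmat_transpose : (Jmat r m)ᵀ = Jmat r m := by
  ext p q; simp [Jmat]

lemma Jmat_mul_Bmat : Jmat r m * Bmat r m = (m : ℝ) • Jmat r m := by
  have := congrArg Matrix.transpose (Bmat_mul_Jmat (r := r) (m := m))
  simpa [Matrix.transpose_mul, Bmat_transpose, Jmat_transpose] using this

lemma Jmat_mul_Jmat : Jmat r m * Jmat r m = ((r : ℝ) * m) • Jmat r m := by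
  ext p q
  simp [Matrix.mul_apply, Jmat]

lemma Amat_add_eq {Λ : ℝ} (hΛ : 0 ≤ Λ) (hr : r ≠ 0) (hm : m ≠ 0) :
    Amat r m Λ + (Wmat r m Λ)ᵀ * Wmat r m Λ =
      (Λ * (m : ℝ) ^ (r - 1) / 2) • (1 + (((r : ℝ) - 1) / m) • Bmat r m) := by
  have hr' : (r : ℝ) ≠ 0 := Nat.cast_ne_zero.2 hr
  have hm' : (m : ℝ) ≠ 0 := Nat.cast_ne_zero.2 hm
  have hm0 : (0 : ℝ) ≤ m := Nat.cast_nonneg m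
  have hz3 : (m : ℝ) ^ ((r : ℤ) - 3) = (m : ℝ) ^ (r - 1) / (m : ℝ) ^ 2 := by
    have : ((r : ℤ) - 3) = ((r - 1 : ℕ) : ℤ) - (2 : ℕ) := by omega
    rw [this, zpow_sub₀ hm']; norm_cast
  have hz1 : (m : ℝ) ^ ((r : ℤ) - 1) = (m : ℝ) ^ (r - 1) := by
    have : ((r : ℤ) - 1) = ((r - 1 : ℕ) : ℤ) := by omega
    rw [this]; norm_cast
  have hc : √(Λ * (m : ℝ) ^ ((r : ℤ) - 3) / (2 * r)) * √(Λ * (m : ℝ) ^ ((r : ℤ) - 3) / (2 * r)) =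
      Λ * ((m : ℝ) ^ (r - 1) / (m : ℝ) ^ 2) / (2 * r) := by
    rw [Real.mul_self_sqrt, hz3]; positivity
  have hWW : (Wmat r m Λ)ᵀ * Wmat r m Λ =
      (Λ * ((m : ℝ) ^ (r - 1) / (m : ℝ) ^ 2) / (2 * r)) •
        (((r : ℝ) ^ 2 * m) • Bmat r m - ((r : ℝ) * m) • Jmat r m) := by
    simp only [Wmat, Matrix.transpose_smul, Matrix.transpose_sub, Bmat_transpose, Jmat_transpose,
      Matrix.smul_mul, Matrix.mul_smul, Matrix.sub_mul, Matrix.mul_sub, Bmat_mul_Bmat,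
      Bmat_mul_Jmat, Jmat_mul_Bmat, Jmat_mul_Jmat, smul_smul]
    rw [← hc]
    module
  rw [hWW, Amat, hz1]
  ext p q
  simp only [Matrix.add_apply, Matrix.sub_apply, Matrix.smul_apply, smul_eq_mul]
  field_simp
  ring

lemma shrinkMat_mul_mul {Λ : ℝ} (hΛ : 0 ≤ Λ) (hr : r ≠ 0) (hm : m ≠ 0) {s : ℝ}
    (hs : s ^ 2 * (Λ * (m : ℝ) ^ (r - 1)) = 1) :
    shrinkMat r m s * (Amat r m Λ + (Wmat r m Λ)ᵀ * Wmat r m Λ) * shrinkMat r m s =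
      (1 / 2 : ℝ) • 1 := by
  have hr' : (r : ℝ) ≠ 0 := Nat.cast_ne_zero.2 hr
  have hm' : (m : ℝ) ≠ 0 := Nat.cast_ne_zero.2 hm
  have hrs : (√(r : ℝ)) ^ 2 = r := Real.sq_sqrt (Nat.cast_nonneg r)
  have hsr : √(r : ℝ) ≠ 0 := by
    rw [Real.sqrt_ne_zero']; exact_mod_cast Nat.pos_of_ne_zero hr
  rw [Amat_add_eq hΛ hr hm, shrinkMat]
  simp only [Matrix.smul_mul, Matrix.mul_smul, Matrix.sub_mul, Matrix.mul_sub, Matrix.mul_add,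
    Matrix.add_mul, Bmat_mul_Bmat, Matrix.one_mul, Matrix.mul_one, smul_smul]
  ext p q
  simp only [Matrix.add_apply, Matrix.sub_apply, Matrix.smul_apply, smul_eq_mul]
  set a := (√(r : ℝ))⁻¹ with ha
  have haa : a ^ 2 * r = 1 := by rw [ha, inv_pow, hrs]; field_simp
  generalize (1 : Matrix (Fin r × Fin m) (Fin r × Fin m) ℝ) p q = i
  generalize Bmat r m p q = b
  field_simp
  linear_combination (m * i) * hs + (s ^ 2 * (Λ * (m : ℝ) ^ (r - 1))) * b * haa

lemma det_shrinkMat_sq {Λ : ℝ} (hΛ : 0 ≤ Λ) (hr : r ≠ 0) (hm : m ≠ 0) {s : ℝ}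
    (hs : s ^ 2 * (Λ * (m : ℝ) ^ (r - 1)) = 1) :
    (shrinkMat r m s).det ^ 2 * (Amat r m Λ + (Wmat r m Λ)ᵀ * Wmat r m Λ).det =
      (1 / 2) ^ (r * m) := by
  have h := congrArg Matrix.det (shrinkMat_mul_mul hΛ hr hm hs)
  rw [Matrix.det_mul, Matrix.det_mul, Matrix.det_smul, Matrix.det_one, mul_one] at h
  simp only [Fintype.card_prod, Fintype.card_fin] at h
  rw [← h]; ring

lemma continuous_shrink : Continuous (shrink : (Fin r × Fin m → ℝ) → _) := by
  unfold shrink classMean; fun_prop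

lemma setIntegral_eq_stdGauss {Λ : ℝ} (hΛ : 0 ≤ Λ) (hr : r ≠ 0) (hm : m ≠ 0) {s : ℝ}
    (hs : s ^ 2 * (Λ * (m : ℝ) ^ (r - 1)) = 1) {G g : (Fin r × Fin m → ℝ) → ℂ}
    (hG : Continuous G) {Ω : Set (Fin r × Fin m → ℝ)} (hΩ : MeasurableSet Ω)
    (hg : ∀ h, s • shrink h ∈ Ω →
      G (s • shrink h) = ((Real.exp (-(∑ p, h p ^ 2) / 2) : ℝ) : ℂ) * g h) :
    ∫ θ in Ω, G θ = ((Real.pi ^ (((r * m : ℕ) : ℝ) / 2) *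
      ((Amat r m Λ + (Wmat r m Λ)ᵀ * Wmat r m Λ).det) ^ (-(1 : ℝ) / 2) : ℝ) : ℂ) *
        ∫ h in {h | s • shrink h ∈ Ω}, g h ∂(stdGauss (Fin r × Fin m)) := by
  set X := Amat r m Λ + (Wmat r m Λ)ᵀ * Wmat r m Λ with hX
  set D := (shrinkMat r m s).det with hD
  have hdet : D ^ 2 * X.det = (1 / 2) ^ (r * m) := det_shrinkMat_sq hΛ hr hm hs
  have hD0 : D ≠ 0 := by
    intro h0
    rw [h0] at hdet
    rw [zero_pow two_ne_zero, zero_mul] at hdet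
    exact absurd hdet.symm (by positivity)
  have hX0 : 0 < X.det := by
    have : (0 : ℝ) < (1 / 2) ^ (r * m) := by positivity
    have h2 : 0 < D ^ 2 := by positivity
    rw [← hdet] at this
    exact pos_of_mul_pos_right this h2.le
  have hmap := Real.map_matrix_volume_pi_eq_smul_volume_pi (M := shrinkMat r m s) hD0
  have hfun : (⇑(Matrix.toLin' (shrinkMat r m s)) : (Fin r × Fin m → ℝ) → _) =
      fun h => s • shrink h := by
    ext1 h; rw [Matrix.toLin'_apply, shrinkMat_mulVec]
  rw [hfun] at hmap
  have hcont : Continuous fun h : Fin r × Fin m → ℝ => s • shrink h := continuous_shrink.const_smul s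
  have h1 : ∫ θ in Ω, G θ ∂(Measure.map (fun h => s • shrink h) volume) =
      ∫ h in {h | s • shrink h ∈ Ω}, G (s • shrink h) :=
    setIntegral_map hΩ hG.aestronglyMeasurable hcont.aemeasurable
  rw [hmap, Measure.restrict_smul, integral_smul_measure, ENNReal.toReal_ofReal (abs_nonneg _)] at h1
  have hmeas : MeasurableSet {h : Fin r × Fin m → ℝ | s • shrink h ∈ Ω} := hcont.measurable hΩ
  have h2 : ∫ h in {h | s • shrink h ∈ Ω}, G (s • shrink h) =
      ∫ h in {h | s • shrink h ∈ Ω}, ((Real.exp (-(∑ p, h p ^ 2) / 2) : ℝ) : ℂ) * g h :=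
    setIntegral_congr_fun hmeas fun h hh => hg h hh
  rw [h2, setIntegral_stdGauss g hmeas] at h1
  have hcoef : Real.pi ^ (((r * m : ℕ) : ℝ) / 2) * X.det ^ (-(1 : ℝ) / 2) =
      |D| * √(2 * Real.pi) ^ (r * m) := by
    have e1 : (0 : ℝ) ≤ Real.pi ^ (((r * m : ℕ) : ℝ) / 2) * X.det ^ (-(1 : ℝ) / 2) := by positivity
    have e2 : (0 : ℝ) ≤ |D| * √(2 * Real.pi) ^ (r * m) := by positivity
    refine (sq_eq_sq₀ e1 e2).1 ?_
    rw [mul_pow, mul_pow, sq_abs, ← pow_mul, mul_comm (r * m) 2, pow_mul, Real.sq_sqrt (by positivity),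
      ← Real.rpow_natCast _ 2, ← Real.rpow_natCast _ 2, ← Real.rpow_mul Real.pi_pos.le,
      ← Real.rpow_mul hX0.le]
    have e3 : X.det ^ (-(1 : ℝ) / 2 * (2 : ℕ)) = X.det⁻¹ := by
      rw [← Real.rpow_neg_one]; norm_num
    have e4 : Real.pi ^ (((r * m : ℕ) : ℝ) / 2 * (2 : ℕ)) = Real.pi ^ (r * m) := by
      rw [← Real.rpow_natCast]; norm_num
    rw [e3, e4, mul_pow]
    have e5 : D ^ 2 = (1 / 2) ^ (r * m) / X.det := by rw [← hdet]; field_simp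
    rw [e5, one_div, inv_pow]
    field_simp
  rw [hcoef]
  have hD' : ((|D| : ℝ) : ℂ) ≠ 0 := by exact_mod_cast abs_ne_zero.2 hD0
  have h3 : ∫ θ in Ω, G θ = ((|D| : ℝ) : ℂ) * (|D|⁻¹ • ∫ θ in Ω, G θ) := by
    rw [Complex.real_smul]; push_cast; field_simp
  rw [h3, ← abs_inv, h1]
  simp only [Fintype.card_prod, Fintype.card_fin]
  push_cast
  ring

end

section
open ProbabilityTheory

lemma gaussianPDFReal_zero_one (x : ℝ) :
    gaussianPDFReal 0 1 x = (√(2 * Real.pi))⁻¹ * Real.exp (-(1 / 2) * x ^ 2) := by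
  simp only [gaussianPDFReal, NNReal.coe_one]
  congr 2
  · simp
  · ring

lemma integrable_gaussianReal_iff {E : Type*} [NormedAddCommGroup E] [NormedSpace ℝ E]
    (f : ℝ → E) : Integrable f (gaussianReal 0 1) ↔
      Integrable fun x => Real.exp (-(1 / 2) * x ^ 2) • f x := by
  rw [gaussianReal_of_var_ne_zero 0 one_ne_zero,
    integrable_withDensity_iff_integrable_smul' (measurable_gaussianPDF 0 1)
      (ae_of_all _ fun _ => gaussianPDF_lt_top)]
  simp only [toReal_gaussianPDF, gaussianPDFReal_zero_one, mul_smul]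
  rw [integrable_fun_smul_iff]
  positivity

lemma integrable_gaussianReal_of_le {E : Type*} [NormedAddCommGroup E] [NormedSpace ℝ E]
    {f : ℝ → E} (hf : Continuous f) (K : ℝ) (h : ∀ x, ‖f x‖ ≤ K * Real.exp (3 / 8 * x ^ 2)) :
    Integrable f (gaussianReal 0 1) := by
  rw [integrable_gaussianReal_iff]
  refine ((integrable_exp_neg_mul_sq (b := 1 / 8) (by norm_num)).const_mul K).mono'
    (by fun_prop) (ae_of_all _ fun x => ?_)
  rw [norm_smul, Real.norm_eq_abs, Real.abs_exp]
  calc _ ≤ Real.exp (-(1 / 2) * x ^ 2) * (K * Real.exp (3 / 8 * x ^ 2)) := by gcongr; exact h x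
    _ = K * (Real.exp (-(1 / 2) * x ^ 2) * Real.exp (3 / 8 * x ^ 2)) := by ring
    _ = _ := by rw [← Real.exp_add]; ring_nf

/-- Polynomial growth is dominated by a Gaussian. -/
lemma abs_pow_le_exp (k : ℕ) (x : ℝ) :
    |x| ^ k ≤ k.factorial * 8 ^ k * Real.exp 2 * Real.exp (x ^ 2 / 128) := by
  have h1 : (|x| / 8) ^ k / k.factorial ≤ Real.exp (|x| / 8) :=
    Real.pow_div_factorial_le_exp _ (by positivity) k
  have h2 : Real.exp (|x| / 8) ≤ Real.exp 2 * Real.exp (x ^ 2 / 128) := by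
    rw [← Real.exp_add]
    apply Real.exp_le_exp.2
    nlinarith [sq_abs x, sq_nonneg (|x| - 8)]
  rw [div_pow, div_div, div_le_iff₀ (by positivity)] at h1
  have h3 : (0:ℝ) ≤ 8 ^ k * k.factorial := by positivity
  nlinarith [mul_le_mul_of_nonneg_right h2 h3]

lemma integrable_pow_mul_exp_gaussianReal (k : ℕ) {a b : ℝ} (hb : b ≤ 1 / 4) :
    Integrable (fun x : ℝ => |x| ^ k * Real.exp (a * |x| + b * x ^ 2)) (gaussianReal 0 1) := by
  refine integrable_gaussianReal_of_le (by fun_prop)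
    (k.factorial * 8 ^ k * Real.exp 2 * Real.exp (4 * a ^ 2)) fun x => ?_
  rw [Real.norm_eq_abs, abs_of_nonneg (by positivity)]
  have h2 : Real.exp (a * |x| + b * x ^ 2) ≤
      Real.exp (4 * a ^ 2) * Real.exp (5 / 16 * x ^ 2) := by
    rw [← Real.exp_add]
    apply Real.exp_le_exp.2
    nlinarith [sq_abs x, sq_nonneg (2 * a - |x| / 4), sq_nonneg x]
  have h3 : Real.exp (x ^ 2 / 128) * Real.exp (5 / 16 * x ^ 2) ≤ Real.exp (3 / 8 * x ^ 2) := by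
    rw [← Real.exp_add]
    apply Real.exp_le_exp.2
    nlinarith [sq_nonneg x]
  calc _ ≤ (k.factorial * 8 ^ k * Real.exp 2 * Real.exp (x ^ 2 / 128)) *
        (Real.exp (4 * a ^ 2) * Real.exp (5 / 16 * x ^ 2)) := by
          gcongr; exact abs_pow_le_exp k x
    _ = k.factorial * 8 ^ k * Real.exp 2 * Real.exp (4 * a ^ 2) *
        (Real.exp (x ^ 2 / 128) * Real.exp (5 / 16 * x ^ 2)) := by ring
    _ ≤ _ := by gcongr

lemma integrable_abs_pow_gaussianReal (k : ℕ) :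
    Integrable (fun x : ℝ => |x| ^ k) (gaussianReal 0 1) := by
  simpa using integrable_pow_mul_exp_gaussianReal k (a := 0) (b := 0) (by norm_num)

lemma integrable_pow_gaussianReal (k : ℕ) :
    Integrable (fun x : ℝ => x ^ k) (gaussianReal 0 1) :=
  (integrable_abs_pow_gaussianReal k).mono' (by fun_prop)
    (ae_of_all _ fun x => by simp)

lemma integral_pow_add_two_gaussianReal (k : ℕ) :
    ∫ x, x ^ (k + 2) ∂(gaussianReal 0 1) = (k + 1) * ∫ x, x ^ k ∂(gaussianReal 0 1) := by
  have key : ∫ x : ℝ, (k + 1) * (Real.exp (-(1 / 2) * x ^ 2) • x ^ k) -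
      Real.exp (-(1 / 2) * x ^ 2) • x ^ (k + 2) = 0 := by
    refine integral_eq_zero_of_hasDerivAt_of_integrable
      (f := fun x : ℝ => Real.exp (-(1 / 2) * x ^ 2) • x ^ (k + 1)) (fun x => ?_)
      ((((integrable_gaussianReal_iff _).1 (integrable_pow_gaussianReal k)).const_mul _).sub
        ((integrable_gaussianReal_iff _).1 (integrable_pow_gaussianReal (k + 2))))
      ((integrable_gaussianReal_iff _).1 (integrable_pow_gaussianReal (k + 1)))
    have h1 : HasDerivAt (fun x : ℝ => Real.exp (-(1 / 2) * x ^ 2))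
        (Real.exp (-(1 / 2) * x ^ 2) * (-(1 / 2) * (2 * x))) x := by
      have := ((hasDerivAt_pow 2 x).const_mul (-(1 / 2 : ℝ))).exp
      simpa using this
    have := h1.mul (hasDerivAt_pow (k + 1) x)
    refine this.congr_deriv ?_
    simp only [smul_eq_mul]; push_cast; ring_nf
  rw [integral_sub (((integrable_gaussianReal_iff _).1 (integrable_pow_gaussianReal k)).const_mul _)
    ((integrable_gaussianReal_iff _).1 (integrable_pow_gaussianReal (k + 2))),
    integral_const_mul] at key
  simp only [integral_gaussianReal_eq_integral_smul (one_ne_zero : (1 : NNReal) ≠ 0),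
    gaussianPDFReal_zero_one, mul_smul, integral_smul]
  simp only [smul_eq_mul] at key ⊢
  linear_combination -(√(2 * Real.pi))⁻¹ * key

lemma integral_pow_gaussianReal_values :
    ∫ x, x ∂(gaussianReal 0 1) = 0 ∧ ∫ x, x ^ 2 ∂(gaussianReal 0 1) = 1 ∧
    ∫ x, x ^ 3 ∂(gaussianReal 0 1) = 0 ∧ ∫ x, x ^ 4 ∂(gaussianReal 0 1) = 3 ∧
    ∫ x, x ^ 6 ∂(gaussianReal 0 1) = 15 := by
  have h0 : ∫ x : ℝ, x ^ 0 ∂(gaussianReal 0 1) = 1 := by simp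
  have h1 : ∫ x : ℝ, x ∂(gaussianReal 0 1) = 0 := integral_id_gaussianReal
  have h2 := integral_pow_add_two_gaussianReal 0
  have h3 := integral_pow_add_two_gaussianReal 1
  have h4 := integral_pow_add_two_gaussianReal 2
  have h6 := integral_pow_add_two_gaussianReal 4
  simp only [pow_one] at h3
  norm_num [h1, h0] at h2 h3 
  norm_num [h2] at h4
  norm_num [h4] at h6
  exact ⟨h1, h2, h3, h4, h6⟩

end

section
open ProbabilityTheory

lemma exp_le_one_add_add_sq_mul_exp_abs (y : ℝ) :
    Real.exp y ≤ 1 + y + y ^ 2 * Real.exp |y| := by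
  have h := Complex.norm_exp_sub_sum_le_norm_mul_exp (y : ℂ) 2
  simp only [Finset.sum_range_succ, Finset.sum_range_zero, ← Complex.ofReal_exp] at h
  norm_num at h
  have h2 : ‖((Real.exp y - (1 + y) : ℝ) : ℂ)‖ ≤ y ^ 2 * Real.exp |y| := by
    push_cast; simpa using h
  rw [Complex.norm_real, Real.norm_eq_abs] at h2
  linarith [le_abs_self (Real.exp y - (1 + y))]

variable {ι : Type*} [Fintype ι] {φ : ℝ → ℝ}

lemma integrable_exp_abs_of_sq (hφ : Continuous φ)
    (hD : Integrable (fun x => φ x ^ 2 * Real.exp |φ x|) (gaussianReal 0 1)) :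
    Integrable (fun x => Real.exp |φ x|) (gaussianReal 0 1) := by
  refine (hD.add (integrable_const (Real.exp 1))).mono' (by fun_prop) (ae_of_all _ fun x => ?_)
  rw [Real.norm_eq_abs, Real.abs_exp, Pi.add_apply]
  rcases le_total |φ x| 1 with h | h
  · have : 0 ≤ φ x ^ 2 * Real.exp |φ x| := by positivity
    have := Real.exp_le_exp.2 h
    linarith
  · have h1 : 1 ≤ φ x ^ 2 := by rw [← sq_abs]; nlinarith
    have := Real.exp_pos |φ x|
    have := Real.exp_pos 1
    nlinarith

lemma integrable_of_sq (hφ : Continuous φ)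
    (hD : Integrable (fun x => φ x ^ 2 * Real.exp |φ x|) (gaussianReal 0 1)) :
    Integrable φ (gaussianReal 0 1) := by
  refine (integrable_exp_abs_of_sq hφ hD).mono' (by fun_prop) (ae_of_all _ fun x => ?_)
  rw [Real.norm_eq_abs]
  linarith [Real.add_one_le_exp |φ x|]

lemma exp_mul_le_exp_abs {a y : ℝ} (ha : |a| ≤ 1) : Real.exp (a * y) ≤ Real.exp |y| := by
  refine Real.exp_le_exp.2 ((le_abs_self _).trans ?_)
  rw [abs_mul]
  nlinarith [abs_nonneg y]

lemma integral_exp_mul_le (hφ : Continuous φ)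
    (hD : Integrable (fun x => φ x ^ 2 * Real.exp |φ x|) (gaussianReal 0 1))
    (h0 : ∫ x, φ x ∂(gaussianReal 0 1) = 0) {a : ℝ} (ha : |a| ≤ 1) :
    Integrable (fun x => Real.exp (a * φ x)) (gaussianReal 0 1) ∧
    ∫ x, Real.exp (a * φ x) ∂(gaussianReal 0 1) ≤
      Real.exp (a ^ 2 * ∫ x, φ x ^ 2 * Real.exp |φ x| ∂(gaussianReal 0 1)) := by
  have hi : Integrable (fun x => Real.exp (a * φ x)) (gaussianReal 0 1) := by
    refine (integrable_exp_abs_of_sq hφ hD).mono' (by fun_prop) (ae_of_all _ fun x => ?_)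
    rw [Real.norm_eq_abs, Real.abs_exp]
    exact exp_mul_le_exp_abs ha
  refine ⟨hi, ?_⟩
  have hφi := integrable_of_sq hφ hD
  calc _ ≤ ∫ x, (1 + a * φ x) + a ^ 2 * (φ x ^ 2 * Real.exp |φ x|) ∂(gaussianReal 0 1) := by
        refine integral_mono hi (((integrable_const _).add (hφi.const_mul a)).add
          (hD.const_mul _)) fun x => ?_
        refine (exp_le_one_add_add_sq_mul_exp_abs _).trans ?_
        have : Real.exp |a * φ x| ≤ Real.exp |φ x| := by
          refine Real.exp_le_exp.2 ?_
          rw [abs_mul]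
          nlinarith [abs_nonneg (φ x)]
        have h2 : 0 ≤ (a * φ x) ^ 2 := by positivity
        have := mul_le_mul_of_nonneg_left this h2
        linarith
    _ = a ^ 2 * (∫ x, φ x ^ 2 * Real.exp |φ x| ∂(gaussianReal 0 1)) + 1 := by
        rw [integral_add (f := fun x => 1 + a * φ x) ((integrable_const _).add (hφi.const_mul a))
            (hD.const_mul _),
          integral_add (f := fun _ => (1 : ℝ)) (integrable_const _) (hφi.const_mul a),
          integral_const_mul,
          integral_const_mul, h0]
        simp; ring
    _ ≤ _ := Real.add_one_le_exp _

/-- Sub-exponential linear statistics of independent Gaussians have bounded exponential moments. -/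
lemma integral_exp_sum_le (hφ : Continuous φ)
    (hD : Integrable (fun x => φ x ^ 2 * Real.exp |φ x|) (gaussianReal 0 1))
    (h0 : ∫ x, φ x ∂(gaussianReal 0 1) = 0) {a : ι → ℝ} (ha : ∑ p, a p ^ 2 ≤ 1) :
    Integrable (fun h : ι → ℝ => Real.exp (∑ p, a p * φ (h p))) (stdGauss ι) ∧
    ∫ h : ι → ℝ, Real.exp (∑ p, a p * φ (h p)) ∂(stdGauss ι) ≤
      Real.exp (∫ x, φ x ^ 2 * Real.exp |φ x| ∂(gaussianReal 0 1)) := by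
  have ha1 : ∀ p, |a p| ≤ 1 := fun p => by
    have := (Finset.single_le_sum (fun q _ => sq_nonneg (a q)) (Finset.mem_univ p)).trans ha
    exact abs_le_one_iff_mul_self_le_one.2 (by simpa [sq] using this)
  have hp := fun p => integral_exp_mul_le hφ hD h0 (ha1 p)
  simp only [Real.exp_sum]
  refine ⟨Integrable.fintype_prod (f := fun p x => Real.exp (a p * φ x)) fun p => (hp p).1, ?_⟩
  rw [stdGauss, integral_fintype_prod_eq_prod (fun p x => Real.exp (a p * φ x))]
  refine (Finset.prod_le_prod (fun p _ => integral_nonneg fun x => (Real.exp_pos _).le)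
    fun p _ => (hp p).2).trans ?_
  rw [← Real.exp_sum, ← Finset.sum_mul]
  refine Real.exp_le_exp.2 ?_
  have : 0 ≤ ∫ x, φ x ^ 2 * Real.exp |φ x| ∂(gaussianReal 0 1) :=
    integral_nonneg fun x => by positivity
  nlinarith

lemma integral_exp_abs_sum_le (hφ : Continuous φ)
    (hD : Integrable (fun x => φ x ^ 2 * Real.exp |φ x|) (gaussianReal 0 1))
    (h0 : ∫ x, φ x ∂(gaussianReal 0 1) = 0) {a : ι → ℝ} (ha : ∑ p, a p ^ 2 ≤ 1) :
    Integrable (fun h : ι → ℝ => Real.exp |∑ p, a p * φ (h p)|) (stdGauss ι) ∧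
    ∫ h : ι → ℝ, Real.exp |∑ p, a p * φ (h p)| ∂(stdGauss ι) ≤
      2 * Real.exp (∫ x, φ x ^ 2 * Real.exp |φ x| ∂(gaussianReal 0 1)) := by
  obtain ⟨i1, b1⟩ := integral_exp_sum_le hφ hD h0 ha
  obtain ⟨i2, b2⟩ := integral_exp_sum_le (a := -a) hφ hD h0 (by simpa using ha)
  have hle : ∀ h : ι → ℝ, Real.exp |∑ p, a p * φ (h p)| ≤
      Real.exp (∑ p, a p * φ (h p)) + Real.exp (∑ p, (-a) p * φ (h p)) := by
    intro h
    have : ∑ p, (-a) p * φ (h p) = -∑ p, a p * φ (h p) := by simp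
    rw [this]
    rcases abs_cases (∑ p, a p * φ (h p)) with ⟨h1, _⟩ | ⟨h1, _⟩ <;> rw [h1] <;>
      linarith [Real.exp_pos (∑ p, a p * φ (h p)), Real.exp_pos (-∑ p, a p * φ (h p))]
  have hi : Integrable (fun h : ι → ℝ => Real.exp |∑ p, a p * φ (h p)|) (stdGauss ι) := by
    refine (i1.add i2).mono' (Continuous.aestronglyMeasurable (by fun_prop)) (ae_of_all _ fun h => ?_)
    rw [Real.norm_eq_abs, Real.abs_exp]
    exact hle h
  refine ⟨hi, (integral_mono hi (i1.add i2) hle).trans ?_⟩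
  rw [integral_add' i1 i2]
  linarith

lemma integral_sum_pow_eight_le (hφ : Continuous φ)
    (hD : Integrable (fun x => φ x ^ 2 * Real.exp |φ x|) (gaussianReal 0 1))
    (h0 : ∫ x, φ x ∂(gaussianReal 0 1) = 0) {a : ι → ℝ} (ha : ∑ p, a p ^ 2 ≤ 1) :
    Integrable (fun h : ι → ℝ => |∑ p, a p * φ (h p)| ^ 8) (stdGauss ι) ∧
    ∫ h : ι → ℝ, |∑ p, a p * φ (h p)| ^ 8 ∂(stdGauss ι) ≤
      (Nat.factorial 8 : ℝ) *
        (2 * Real.exp (∫ x, φ x ^ 2 * Real.exp |φ x| ∂(gaussianReal 0 1))) := by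
  obtain ⟨i1, b1⟩ := integral_exp_abs_sum_le hφ hD h0 ha
  have hle : ∀ h : ι → ℝ, |∑ p, a p * φ (h p)| ^ 8 ≤
      (Nat.factorial 8 : ℝ) * Real.exp |∑ p, a p * φ (h p)| := fun h => by
    have := Real.pow_div_factorial_le_exp _ (abs_nonneg (∑ p, a p * φ (h p))) 8
    rwa [div_le_iff₀' (by positivity)] at this
  have hi : Integrable (fun h : ι → ℝ => |∑ p, a p * φ (h p)| ^ 8) (stdGauss ι) :=
    (i1.const_mul _).mono' (Continuous.aestronglyMeasurable (by fun_prop)) (ae_of_all _ fun h => by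
      rw [Real.norm_eq_abs, abs_of_nonneg (by positivity)]; exact hle h)
  refine ⟨hi, (integral_mono hi (i1.const_mul _) hle).trans ?_⟩
  rw [integral_const_mul]
  gcongr

lemma measureReal_lt_abs_sum_le (hφ : Continuous φ)
    (hD : Integrable (fun x => φ x ^ 2 * Real.exp |φ x|) (gaussianReal 0 1))
    (h0 : ∫ x, φ x ∂(gaussianReal 0 1) = 0) {a : ι → ℝ} (ha : ∑ p, a p ^ 2 ≤ 1) (T : ℝ) :
    (stdGauss ι).real {h | T < |∑ p, a p * φ (h p)|} ≤
      2 * Real.exp (∫ x, φ x ^ 2 * Real.exp |φ x| ∂(gaussianReal 0 1)) * Real.exp (-T) := by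
  obtain ⟨i1, b1⟩ := integral_exp_abs_sum_le hφ hD h0 ha
  have h1 : Real.exp T * (stdGauss ι).real {h | Real.exp T ≤ Real.exp |∑ p, a p * φ (h p)|} ≤
      ∫ h : ι → ℝ, Real.exp |∑ p, a p * φ (h p)| ∂(stdGauss ι) :=
    mul_meas_ge_le_integral_of_nonneg (ae_of_all _ fun h => (Real.exp_pos _).le) i1 _
  simp only [Real.exp_le_exp] at h1
  have h2 : (stdGauss ι).real {h | T < |∑ p, a p * φ (h p)|} ≤
      (stdGauss ι).real {h | T ≤ |∑ p, a p * φ (h p)|} :=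
    measureReal_mono (by
      intro h hh
      simp only [Set.mem_ofPred_eq] at hh ⊢
      exact hh.le)
  rw [Real.exp_neg, ← div_eq_mul_inv, le_div_iff₀' (Real.exp_pos T)]
  have h3 := mul_le_mul_of_nonneg_left h2 (Real.exp_pos T).le
  linarith

/-- The second moment of a linear statistic of independent centred variables. -/
lemma integral_sum_sq_eq (hφ : Continuous φ)
    (h2 : Integrable (fun x => φ x ^ 2) (gaussianReal 0 1))
    (h0 : ∫ x, φ x ∂(gaussianReal 0 1) = 0) :
    Integrable (fun h : ι → ℝ => (∑ p, φ (h p)) ^ 2) (stdGauss ι) ∧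
    ∫ h : ι → ℝ, (∑ p, φ (h p)) ^ 2 ∂(stdGauss ι) =
      Fintype.card ι * ∫ x, φ x ^ 2 ∂(gaussianReal 0 1) := by
  have hL : MemLp φ 2 (gaussianReal 0 1) :=
    (memLp_two_iff_integrable_sq hφ.aestronglyMeasurable).2 h2
  have hLp : ∀ p : ι, MemLp (fun h : ι → ℝ => φ (h p)) 2 (stdGauss ι) := fun p =>
    hL.comp_measurePreserving (measurePreserving_eval _ p)
  have hS : MemLp (∑ p : ι, fun h : ι → ℝ => φ (h p)) 2 (stdGauss ι) :=
    memLp_finsetSum' _ fun p _ => hLp p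
  have hv := variance_sum_pi (ι := ι) (μ := fun _ => gaussianReal 0 1) (X := fun _ => φ)
    fun _ => hL
  have hmean : ∫ h : ι → ℝ, (∑ p : ι, fun h : ι → ℝ => φ (h p)) h ∂(stdGauss ι) = 0 := by
    simp only [Finset.sum_apply]
    rw [integral_finsetSum _ fun p _ => (hLp p).integrable one_le_two]
    refine Finset.sum_eq_zero fun p _ => ?_
    rw [stdGauss, integral_comp_eval (μ := fun _ : ι => gaussianReal 0 1)
      hφ.aestronglyMeasurable, h0]
  refine ⟨by simpa using hS.integrable_sq, ?_⟩
  rw [variance_of_integral_eq_zero hφ.aemeasurable h0] at hv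
  rw [← stdGauss, variance_of_integral_eq_zero hS.aemeasurable hmean] at hv
  simpa using hv

end

/-- The normalised sum of `φ (h p)` over all vertices. -/
noncomputable def linStat {r m : ℕ} (φ : ℝ → ℝ) (h : Fin r × Fin m → ℝ) : ℝ :=
  (√((r : ℝ) * m))⁻¹ * ∑ p, φ (h p)

/-- The normalised sum of `φ (h p)` over the class `t`. -/
noncomputable def classStat {r m : ℕ} (φ : ℝ → ℝ) (h : Fin r × Fin m → ℝ) (t : Fin r) : ℝ :=
  (√(m : ℝ))⁻¹ * ∑ j, φ (h (t, j))

/-- A quantity controlling the fluctuations of the edge moments. -/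
noncomputable def fluct {r m : ℕ} (h : Fin r × Fin m → ℝ) : ℝ :=
  1 + |linStat id h| + |linStat (fun x => x ^ 2 - 1) h| + ∑ t, |classStat id h t| +
    ∑ t, |classStat (fun x => x ^ 2 - 1) h t| + (∑ p, |h p| ^ 3) / ((r : ℝ) * m)

section
variable {r m : ℕ}

lemma fluct_bounds (h : Fin r × Fin m → ℝ) :
    1 ≤ fluct h ∧ |linStat id h| ≤ fluct h ∧ |linStat (fun x => x ^ 2 - 1) h| ≤ fluct h ∧
    ∑ t, |classStat id h t| ≤ fluct h ∧
    ∑ t, |classStat (fun x => x ^ 2 - 1) h t| ≤ fluct h ∧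
    (∑ p, |h p| ^ 3) / ((r : ℝ) * m) ≤ fluct h := by
  have h1 := abs_nonneg (linStat id h)
  have h2 := abs_nonneg (linStat (fun x => x ^ 2 - 1) h)
  have h3 : 0 ≤ ∑ t, |classStat id h t| := Finset.sum_nonneg fun _ _ => abs_nonneg _
  have h4 : 0 ≤ ∑ t, |classStat (fun x => x ^ 2 - 1) h t| :=
    Finset.sum_nonneg fun _ _ => abs_nonneg _
  have h5 : 0 ≤ (∑ p, |h p| ^ 3) / ((r : ℝ) * m) := by positivity
  unfold fluct
  refine ⟨?_, ?_, ?_, ?_, ?_, ?_⟩ <;> linarith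

lemma classMean_eq (h : Fin r × Fin m → ℝ) (t : Fin r) :
    classMean h t = (√(m : ℝ))⁻¹ * classStat id h t := by
  have : ((√(m : ℝ))⁻¹) ^ 2 = (m : ℝ)⁻¹ := by rw [inv_pow, Real.sq_sqrt (Nat.cast_nonneg m)]
  rw [classMean, classStat, ← mul_assoc, ← sq, this, div_eq_inv_mul]; rfl

lemma meanEdge_eq (h : Fin r × Fin m → ℝ) :
    meanEdge h = (√(m : ℝ))⁻¹ * linStat id h := by
  rw [meanEdge, linStat, Real.sqrt_mul (Nat.cast_nonneg r), mul_inv]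
  simp_rw [classMean_eq, classStat, ← Finset.mul_sum, Fintype.sum_prod_type]
  ring

lemma sum_centred_sq_div (hm : m ≠ 0) (h : Fin r × Fin m → ℝ) (t : Fin r) :
    (∑ j, centred h t j ^ 2) / m = 1 + (√(m : ℝ))⁻¹ * classStat (fun x => x ^ 2 - 1) h t -
      classMean h t ^ 2 := by
  have hm' : (m : ℝ) ≠ 0 := Nat.cast_ne_zero.2 hm
  have : ((√(m : ℝ))⁻¹) ^ 2 = (m : ℝ)⁻¹ := by rw [inv_pow, Real.sq_sqrt (Nat.cast_nonneg m)]
  rw [sum_centred_sq hm, classStat, ← mul_assoc, ← sq, this]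
  simp only [Finset.sum_sub_distrib, Finset.sum_const, Finset.card_univ, Fintype.card_fin]
  simp; field_simp; ring

lemma sum_centred_cube (hm : m ≠ 0) (h : Fin r × Fin m → ℝ) (t : Fin r) :
    ∑ j, centred h t j ^ 3 = ∑ j, h (t, j) ^ 3 - 3 * classMean h t * ∑ j, h (t, j) ^ 2 +
      2 * m * classMean h t ^ 3 := by
  have : ∀ j, centred h t j ^ 3 = h (t, j) ^ 3 - (3 * classMean h t) * h (t, j) ^ 2 +
      (3 * classMean h t ^ 2) * h (t, j) - classMean h t ^ 3 := by
    intro j; simp only [centred]; ring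
  simp_rw [this, Finset.sum_sub_distrib, Finset.sum_add_distrib, Finset.sum_sub_distrib,
    ← Finset.mul_sum, sum_class_eq hm]
  simp; ring

lemma sum_centred_four (hm : m ≠ 0) (h : Fin r × Fin m → ℝ) (t : Fin r) :
    ∑ j, centred h t j ^ 4 = ∑ j, h (t, j) ^ 4 - 4 * classMean h t * ∑ j, h (t, j) ^ 3 +
      6 * classMean h t ^ 2 * ∑ j, h (t, j) ^ 2 - 3 * m * classMean h t ^ 4 := by
  have : ∀ j, centred h t j ^ 4 = h (t, j) ^ 4 - (4 * classMean h t) * h (t, j) ^ 3 +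
      (6 * classMean h t ^ 2) * h (t, j) ^ 2 - (4 * classMean h t ^ 3) * h (t, j) +
        classMean h t ^ 4 := by
    intro j; simp only [centred]; ring
  simp_rw [this, Finset.sum_add_distrib, Finset.sum_sub_distrib, Finset.sum_add_distrib,
    Finset.sum_sub_distrib, ← Finset.mul_sum, sum_class_eq hm]
  simp; ring

lemma sum_class_sq (hm : m ≠ 0) (h : Fin r × Fin m → ℝ) (t : Fin r) :
    ∑ j, h (t, j) ^ 2 = m + √(m : ℝ) * classStat (fun x => x ^ 2 - 1) h t := by
  have hm' : √(m : ℝ) ≠ 0 := by positivity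
  rw [classStat, ← mul_assoc, mul_inv_cancel₀ hm']
  simp

lemma abs_le_of_sum {u : Fin r → ℝ} {R : ℝ} (h : ∑ t, |u t| ≤ R) (t : Fin r) : |u t| ≤ R :=
  (Finset.single_le_sum (f := fun t => |u t|) (fun _ _ => abs_nonneg _) (Finset.mem_univ t)).trans h

lemma sum_abs_mul_le {u v : Fin r → ℝ} {R K : ℝ} (h : ∑ t, |u t| ≤ R) (hK : 0 ≤ K)
    (hv : ∀ t, |v t| ≤ K) : |∑ t, u t * v t| ≤ R * K := by
  refine (Finset.abs_sum_le_sum_abs _ _).trans ?_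
  calc _ ≤ ∑ t, |u t| * K := Finset.sum_le_sum fun t _ => by
        rw [abs_mul]; exact mul_le_mul_of_nonneg_left (hv t) (abs_nonneg _)
    _ = (∑ t, |u t|) * K := by rw [Finset.sum_mul]
    _ ≤ _ := mul_le_mul_of_nonneg_right h hK

lemma inv_sqrt_facts (hm : m ≠ 0) : 0 < (√(m : ℝ))⁻¹ ∧ (√(m : ℝ))⁻¹ ≤ 1 ∧
    m * (√(m : ℝ))⁻¹ ^ 2 = 1 ∧ √(m : ℝ) = m * (√(m : ℝ))⁻¹ := by
  have hm1 : (1 : ℝ) ≤ m := Nat.one_le_cast.2 (Nat.one_le_iff_ne_zero.2 hm)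
  have h1 : 0 < √(m : ℝ) := by positivity
  have h2 : √(m : ℝ) * √(m : ℝ) = m := Real.mul_self_sqrt (Nat.cast_nonneg m)
  refine ⟨by positivity, inv_le_one_of_one_le₀ (Real.one_le_sqrt.2 hm1), ?_, ?_⟩
  · rw [inv_pow, sq, h2]; field_simp
  · nth_rewrite 2 [← h2]; field_simp

lemma sum_classStat (φ : ℝ → ℝ) (hr : r ≠ 0) (h : Fin r × Fin m → ℝ) :
    ∑ t, classStat φ h t = √(r : ℝ) * linStat φ h := by
  rw [linStat, Real.sqrt_mul (Nat.cast_nonneg r), mul_inv, Fintype.sum_prod_type]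
  simp only [classStat, ← Finset.mul_sum]
  have : √(r : ℝ) ≠ 0 := by positivity
  field_simp

lemma sum_eq_linStat (φ : ℝ → ℝ) (hr : r ≠ 0) (hm : m ≠ 0) (h : Fin r × Fin m → ℝ) :
    ∑ p, φ (h p) = m * (√(m : ℝ))⁻¹ * √(r : ℝ) * linStat φ h := by
  rw [linStat, Real.sqrt_mul (Nat.cast_nonneg r)]
  have : √(r : ℝ) ≠ 0 := by positivity
  have : √(m : ℝ) ≠ 0 := by positivity
  field_simp
  rw [Real.sq_sqrt (Nat.cast_nonneg m)]

lemma sum_centred_cube_div (hm : m ≠ 0) (h : Fin r × Fin m → ℝ) :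
    ∑ t, (∑ j, centred h t j ^ 3) / m = (∑ p, h p ^ 3) / m -
      3 * (√(m : ℝ))⁻¹ * ∑ t, classStat id h t -
      3 * (√(m : ℝ))⁻¹ ^ 2 * ∑ t, classStat id h t * classStat (fun x => x ^ 2 - 1) h t +
      2 * (√(m : ℝ))⁻¹ ^ 3 * ∑ t, classStat id h t ^ 3 := by
  obtain ⟨-, -, e2, hsm⟩ := inv_sqrt_facts hm
  have hm' : (m : ℝ) ≠ 0 := Nat.cast_ne_zero.2 hm
  rw [Fintype.sum_prod_type, Finset.sum_div, Finset.mul_sum, Finset.mul_sum, Finset.mul_sum,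
    ← Finset.sum_sub_distrib, ← Finset.sum_sub_distrib, ← Finset.sum_add_distrib]
  refine Finset.sum_congr rfl fun t _ => ?_
  rw [sum_centred_cube hm, sum_class_sq hm, classMean_eq]
  nth_rewrite 2 [hsm]
  generalize (√(m : ℝ))⁻¹ = ε at *
  field_simp
  ring

lemma sum_centred_sq_div_eq (hr : r ≠ 0) (hm : m ≠ 0) (h : Fin r × Fin m → ℝ) :
    ∑ t, (∑ j, centred h t j ^ 2) / m =
      r + (√(m : ℝ))⁻¹ * (√(r : ℝ) * linStat (fun x => x ^ 2 - 1) h) -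
        (√(m : ℝ))⁻¹ ^ 2 * ∑ t, classStat id h t ^ 2 := by
  rw [← sum_classStat _ hr]
  simp_rw [sum_centred_sq_div hm, classMean_eq]
  rw [Finset.sum_sub_distrib, Finset.sum_add_distrib]
  simp only [mul_pow, ← Finset.mul_sum, Finset.sum_const, Finset.card_univ, Fintype.card_fin, nsmul_eq_mul, mul_one]

lemma abs_mul_le_mul {a b A B : ℝ} (ha : |a| ≤ A) (hb : |b| ≤ B) : |a * b| ≤ A * B := by
  rw [abs_mul]
  exact mul_le_mul ha hb (abs_nonneg _) ((abs_nonneg _).trans ha)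

lemma abs_pow_le_pow {a A : ℝ} (ha : |a| ≤ A) (k : ℕ) : |a ^ k| ≤ A ^ k := by
  rw [abs_pow]; exact pow_le_pow_left₀ (abs_nonneg _) ha k

lemma abs_cube_expansion_le {m ε q r τ V U2 U3 UV H R : ℝ} (hm : m ≠ 0) (hε0 : 0 < ε) (hε1 : ε ≤ 1)
    (hε2 : m * ε ^ 2 = 1) (hq : q ^ 2 = r) (hq0 : 0 ≤ q) (hqr : q ≤ r) (hr : 1 ≤ r) (hR : 1 ≤ R)
    (hτ : |τ| ≤ R) (hV : |V| ≤ R) (hU2 : |U2| ≤ R * R) (hU3 : |U3| ≤ R * R ^ 2)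
    (hUV : |UV| ≤ R * R) :
    |m * ((ε * τ) ^ 3 + 3 * (ε * τ) * (r + ε * (q * V) - ε ^ 2 * U2) +
      (H / m - 3 * ε * (q * τ) - 3 * ε ^ 2 * UV + 2 * ε ^ 3 * U3)) -
      (H + (3 * q - 3) * (m * ε * q * τ))| ≤ 12 * r * R ^ 4 := by
  have key : m * ((ε * τ) ^ 3 + 3 * (ε * τ) * (r + ε * (q * V) - ε ^ 2 * U2) +
      (H / m - 3 * ε * (q * τ) - 3 * ε ^ 2 * UV + 2 * ε ^ 3 * U3)) -
      (H + (3 * q - 3) * (m * ε * q * τ)) =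
      ε * τ ^ 3 + 3 * q * (τ * V) - 3 * ε * (τ * U2) - 3 * UV + 2 * ε * U3 := by
    have : m * (H / m) = H := by field_simp
    linear_combination this + (ε * τ ^ 3 + 3 * q * (τ * V) - 3 * ε * (τ * U2) - 3 * UV +
      2 * ε * U3) * hε2 - 3 * m * ε * τ * hq
  rw [key]
  have a1 := abs_le.1 (abs_pow_le_pow hτ 3)
  have a2 := abs_le.1 (abs_mul_le_mul hτ hV)
  have a3 := abs_le.1 (abs_mul_le_mul hτ hU2)
  have a4 := abs_le.1 hUV
  have a5 := abs_le.1 hU3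
  have R2 : R * R ≤ R ^ 4 := by nlinarith [mul_pos (by linarith : 0 < R) (by linarith : 0 < R)]
  have R3 : R ^ 3 ≤ R ^ 4 := pow_le_pow_right₀ hR (by norm_num)
  have R4 : 0 ≤ R ^ 4 := by positivity
  have b1 : |ε * τ ^ 3| ≤ 1 * R ^ 4 :=
    abs_mul_le_mul (by rwa [abs_of_pos hε0]) ((abs_pow_le_pow hτ 3).trans R3)
  have b2 : |q * (τ * V)| ≤ r * R ^ 4 :=
    abs_mul_le_mul (by rwa [abs_of_nonneg hq0]) ((abs_mul_le_mul hτ hV).trans R2)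
  have b3 : |ε * (τ * U2)| ≤ 1 * R ^ 4 :=
    abs_mul_le_mul (by rwa [abs_of_pos hε0]) ((abs_mul_le_mul hτ hU2).trans (by linarith))
  have b5 : |ε * U3| ≤ 1 * R ^ 4 :=
    abs_mul_le_mul (by rwa [abs_of_pos hε0]) (hU3.trans (by linarith))
  rw [abs_le] at b1 b2 b3 b5 ⊢
  have : R ^ 4 ≤ r * R ^ 4 := by nlinarith
  constructor <;> linarith

/-- The cubic edge moment is a linear statistic up to lower order terms. -/
lemma abs_edge_cube_sub_le (hr : r ≠ 0) (hm : m ≠ 0) (h : Fin r × Fin m → ℝ) :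
    |m * ((∑ e, edgeSum r m (shrink h) e ^ 3) / (m : ℝ) ^ r) -
      ∑ p, (h p ^ 3 + (3 * √(r : ℝ) - 3) * h p)| ≤ 12 * r * fluct h ^ 4 := by
  obtain ⟨R1, Rτ, RV, Ru, Rv, -⟩ := fluct_bounds h
  have hm' : (m : ℝ) ≠ 0 := Nat.cast_ne_zero.2 hm
  have hr1 : (1 : ℝ) ≤ r := Nat.one_le_cast.2 (Nat.one_le_iff_ne_zero.2 hr)
  obtain ⟨-, -, E3, -⟩ := sum_edges_pow hm r (centred h) (sum_centred hm h) (meanEdge h)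
  obtain ⟨hε0, hε1, hε2, -⟩ := inv_sqrt_facts hm
  have hsr : √(r : ℝ) ^ 2 = r := Real.sq_sqrt (Nat.cast_nonneg r)
  have hsr1 : √(r : ℝ) ≤ r := by nlinarith [Real.one_le_sqrt.2 hr1]
  have hU2 : |∑ t, classStat id h t ^ 2| ≤ fluct h * fluct h := by
    simpa only [sq] using sum_abs_mul_le Ru (by linarith) (abs_le_of_sum Ru)
  have hU3 : |∑ t, classStat id h t ^ 3| ≤ fluct h * fluct h ^ 2 := by
    have := sum_abs_mul_le (v := fun t => classStat id h t ^ 2) (K := fluct h ^ 2) Ru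
      (by positivity)
      (fun t => by rw [abs_pow]; exact pow_le_pow_left₀ (abs_nonneg _) (abs_le_of_sum Ru t) 2)
    simpa only [← pow_succ'] using this
  have hUV : |∑ t, classStat id h t * classStat (fun x => x ^ 2 - 1) h t| ≤ fluct h * fluct h :=
    sum_abs_mul_le Ru (by linarith) (abs_le_of_sum Rv)
  have hh := sum_eq_linStat id hr hm h
  simp only [id] at hh
  simp_rw [edgeSum_shrink, E3]
  rw [mul_div_cancel_left₀ _ (pow_ne_zero _ hm'), Finset.sum_add_distrib, ← Finset.mul_sum, hh,
    sum_centred_cube_div hm, sum_centred_sq_div_eq hr hm, sum_classStat id hr, meanEdge_eq]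
  exact abs_cube_expansion_le hm' hε0 hε1 hε2 hsr (Real.sqrt_nonneg _) hsr1 hr1 R1 Rτ RV hU2 hU3 hUV

lemma abs_four_expansion_le {ε r Θ Q C K q2 κ R : ℝ} (hε0 : 0 < ε) (hε1 : ε ≤ 1) (hr : 1 ≤ r)
    (hR : 1 ≤ R) (hκ : 0 ≤ κ) (hΘ : |Θ| ≤ ε * R) (hQ : |Q - r| ≤ 2 * ε * r * R ^ 2)
    (hC : |C| ≤ 9 * r * R ^ 3) (hK : |K - 3 * r| ≤ ε * r * (19 * R ^ 4 + κ))
    (hq2 : |q2 - r| ≤ 8 * ε * R ^ 4) :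
    |Θ ^ 4 + 6 * Θ ^ 2 * Q + 4 * Θ * C + K + 3 * (Q ^ 2 - q2) - 3 * r ^ 2| ≤
      130 * ε * r ^ 2 * (R ^ 4 + κ) := by
  have hR0 : 0 < R := by linarith
  have hr0 : 0 < r := by linarith
  have R24 : R ^ 2 ≤ R ^ 4 := pow_le_pow_right₀ hR (by norm_num)
  have R2 : 1 ≤ R ^ 2 := one_le_pow₀ hR
  have hQ1 : |Q| ≤ 3 * r * R ^ 2 := by
    have : 2 * ε * r * R ^ 2 ≤ 2 * r * R ^ 2 := by
      have : 0 ≤ r * R ^ 2 := by positivity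
      nlinarith
    have h1 : r ≤ r * R ^ 2 := by nlinarith
    rw [abs_le] at hQ ⊢
    constructor <;> linarith
  have hΘ1 : |Θ| ≤ R := hΘ.trans (by nlinarith)
  have X0 : 0 ≤ ε * r ^ 2 * R ^ 4 := by positivity
  have X1 : ε * r * R ^ 4 ≤ ε * r ^ 2 * R ^ 4 := by
    have : 0 ≤ ε * r * R ^ 4 := by positivity
    nlinarith
  have X2 : ε * R ^ 4 ≤ ε * r * R ^ 4 := by
    have : 0 ≤ ε * R ^ 4 := by positivity
    nlinarith
  have X3 : ε * r * κ ≤ ε * r ^ 2 * κ := by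
    have : 0 ≤ ε * r * κ := by positivity
    nlinarith
  have a1 : |Θ * Θ ^ 3| ≤ ε * R * R ^ 3 := abs_mul_le_mul hΘ (abs_pow_le_pow hΘ1 3)
  have a2 : |(Θ * Θ) * Q| ≤ (ε * R * R) * (3 * r * R ^ 2) :=
    abs_mul_le_mul (abs_mul_le_mul hΘ hΘ1) hQ1
  have a3 : |Θ * C| ≤ ε * R * (9 * r * R ^ 3) := abs_mul_le_mul hΘ hC
  have a4 : |(Q - r) * (Q + r)| ≤ (2 * ε * r * R ^ 2) * (4 * r * R ^ 2) := by
    refine abs_mul_le_mul hQ ((abs_add_le _ _).trans ?_)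
    rw [abs_of_pos hr0]
    nlinarith
  have X4 : ε * r ^ 2 * κ ≥ 0 := by positivity
  ring_nf at a1 a2 a3 a4 hK hq2 X0 X1 X2 X3 X4 ⊢
  rw [abs_le] at *
  constructor <;> linarith

end

section
variable {r m : ℕ}

lemma abs_add_le_add {a b A B : ℝ} (ha : |a| ≤ A) (hb : |b| ≤ B) : |a + b| ≤ A + B :=
  (abs_add_le _ _).trans (add_le_add ha hb)

lemma abs_sub_le_add {a b A B : ℝ} (ha : |a| ≤ A) (hb : |b| ≤ B) : |a - b| ≤ A + B :=
  (abs_sub _ _).trans (add_le_add ha hb)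

lemma abs_sum_classStat_pow_le (h : Fin r × Fin m → ℝ) (k : ℕ) :
    |∑ t, classStat id h t ^ (k + 1)| ≤ fluct h * fluct h ^ k := by
  obtain ⟨R1, -, -, Ru, -⟩ := fluct_bounds h
  have := sum_abs_mul_le (v := fun t => classStat id h t ^ k) (K := fluct h ^ k) Ru
    (by positivity) (fun t => abs_pow_le_pow (abs_le_of_sum Ru t) k)
  simpa only [← pow_succ'] using this

lemma sqrt_natCast_le (hr : r ≠ 0) : |√(r : ℝ)| ≤ r := by
  have hr1 : (1 : ℝ) ≤ r := Nat.one_le_cast.2 (Nat.one_le_iff_ne_zero.2 hr)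
  have hsr : √(r : ℝ) ^ 2 = r := Real.sq_sqrt (Nat.cast_nonneg r)
  rw [abs_of_nonneg (Real.sqrt_nonneg _)]
  nlinarith [Real.one_le_sqrt.2 hr1]

lemma abs_sum_centred_sq_sub_le (hr : r ≠ 0) (hm : m ≠ 0) (h : Fin r × Fin m → ℝ) :
    |∑ t, (∑ j, centred h t j ^ 2) / m - r| ≤ 2 * (√(m : ℝ))⁻¹ * r * fluct h ^ 2 := by
  obtain ⟨R1, -, RV, -⟩ := fluct_bounds h
  obtain ⟨hε0, hε1, -⟩ := inv_sqrt_facts hm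
  have hU := abs_sum_classStat_pow_le h 1
  have hq := sqrt_natCast_le hr
  have hr1 : (1 : ℝ) ≤ r := Nat.one_le_cast.2 (Nat.one_le_iff_ne_zero.2 hr)
  rw [sum_centred_sq_div_eq hr hm]
  generalize ∑ t, classStat id h t ^ (1 + 1) = U at *
  generalize linStat (fun x => x ^ 2 - 1) h = V at *
  generalize fluct h = R at *
  generalize (√(m : ℝ))⁻¹ = ε at *
  generalize √(r : ℝ) = q at *
  have e1 : |ε| ≤ ε := (abs_of_pos hε0).le
  have e2 : |ε ^ 2| ≤ ε * 1 := by rw [abs_of_pos (by positivity), sq]; gcongr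
  have := abs_sub_le_add (abs_mul_le_mul e1 (abs_mul_le_mul hq RV)) (abs_mul_le_mul e2 hU)
  rw [show (r : ℝ) + ε * (q * V) - ε ^ 2 * U - r = ε * (q * V) - ε ^ 2 * U by ring]
  refine this.trans ?_
  have h1 : R ≤ R ^ 2 := by nlinarith
  have h2 : ε * (r * R) ≤ ε * (r * R ^ 2) := by gcongr
  have h3 : ε * 1 * (R * R ^ 1) ≤ ε * r * (R * R ^ 1) := by gcongr
  linarith

lemma abs_sum_cube_div_le (hr : r ≠ 0) (hm : m ≠ 0) (h : Fin r × Fin m → ℝ) :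
    (∑ p, |h p| ^ 3) / m ≤ r * fluct h := by
  obtain ⟨-, -, -, -, -, R3⟩ := fluct_bounds h
  have hm0 : (0 : ℝ) < m := by positivity
  have hr0 : (0 : ℝ) < r := by positivity
  rw [div_le_iff₀ (by positivity)] at R3 ⊢
  linarith

lemma abs_sum_centred_cube_le (hr : r ≠ 0) (hm : m ≠ 0) (h : Fin r × Fin m → ℝ) :
    |∑ t, (∑ j, centred h t j ^ 3) / m| ≤ 9 * r * fluct h ^ 3 := by
  obtain ⟨R1, Rτ, -, Ru, Rv, -⟩ := fluct_bounds h
  obtain ⟨hε0, hε1, -⟩ := inv_sqrt_facts hm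
  have hU := abs_sum_classStat_pow_le h 2
  have hq := sqrt_natCast_le hr
  have hr1 : (1 : ℝ) ≤ r := Nat.one_le_cast.2 (Nat.one_le_iff_ne_zero.2 hr)
  have hUV : |∑ t, classStat id h t * classStat (fun x => x ^ 2 - 1) h t| ≤ fluct h * fluct h :=
    sum_abs_mul_le Ru (by linarith) (abs_le_of_sum Rv)
  have a1 : |(∑ p, h p ^ 3) / m| ≤ r * fluct h := by
    rw [abs_div, Nat.abs_cast]
    refine le_trans ?_ (abs_sum_cube_div_le hr hm h)
    gcongr
    refine (Finset.abs_sum_le_sum_abs _ _).trans (Finset.sum_le_sum fun p _ => ?_)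
    rw [abs_pow]
  rw [sum_centred_cube_div hm, sum_classStat id hr]
  generalize ∑ t, classStat id h t ^ (2 + 1) = U at *
  generalize ∑ t, classStat id h t * classStat (fun x => x ^ 2 - 1) h t = UV at *
  generalize linStat id h = τ at *
  generalize fluct h = R at *
  generalize (√(m : ℝ))⁻¹ = ε at *
  generalize √(r : ℝ) = q at *
  generalize (∑ p, h p ^ 3) / (m : ℝ) = H at *
  have e1 : |3 * ε| ≤ 3 := by rw [abs_of_pos (by positivity)]; linarith
  have e2 : |3 * ε ^ 2| ≤ 3 := by
    rw [abs_of_pos (by positivity)]; linarith [pow_le_one₀ hε0.le hε1 (n := 2)]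
  have e3 : |2 * ε ^ 3| ≤ 2 := by
    rw [abs_of_pos (by positivity)]; linarith [pow_le_one₀ hε0.le hε1 (n := 3)]
  refine (abs_add_le_add (abs_sub_le_add (abs_sub_le_add a1 (abs_mul_le_mul e1
    (abs_mul_le_mul hq Rτ))) (abs_mul_le_mul e2 hUV)) (abs_mul_le_mul e3 hU)).trans ?_
  have h1 : R ≤ R ^ 3 := le_self_pow₀ R1 (by norm_num)
  have h2 : R ^ 2 ≤ R ^ 3 := pow_le_pow_right₀ R1 (by norm_num)
  have h3 : r * R ≤ r * R ^ 3 := by gcongr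
  have h4 : 1 * R ^ 3 ≤ r * R ^ 3 := by gcongr
  nlinarith

lemma sum_centred_four_div_sub (hr : r ≠ 0) (hm : m ≠ 0) (h : Fin r × Fin m → ℝ) :
    ∑ t, (∑ j, centred h t j ^ 4) / m - 3 * r =
      (√(m : ℝ))⁻¹ * (√(r : ℝ) * linStat (fun x => x ^ 4 - 3) h) -
      4 * (√(m : ℝ))⁻¹ * (∑ t, classStat id h t * ((∑ j, h (t, j) ^ 3) / m)) +
      6 * (√(m : ℝ))⁻¹ ^ 2 * (∑ t, classStat id h t *
        (classStat id h t * (1 + (√(m : ℝ))⁻¹ * classStat (fun x => x ^ 2 - 1) h t))) -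
      3 * (√(m : ℝ))⁻¹ ^ 4 * ∑ t, classStat id h t ^ 4 := by
  obtain ⟨hε0, hε1, hε2, hsm⟩ := inv_sqrt_facts hm
  have hm' : (m : ℝ) ≠ 0 := Nat.cast_ne_zero.2 hm
  have k3 : ∑ t, (∑ j, h (t, j) ^ 4) / m - 3 * r =
      (√(m : ℝ))⁻¹ * (√(r : ℝ) * linStat (fun x => x ^ 4 - 3) h) := by
    have k1 := sum_eq_linStat (fun x => x ^ 4 - 3) hr hm h
    simp only [Finset.sum_sub_distrib, Fintype.sum_prod_type] at k1
    rw [← Finset.sum_div]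
    simp only [Finset.sum_const, Finset.card_univ, Fintype.card_fin, nsmul_eq_mul] at k1
    field_simp
    field_simp at k1
    linarith
  rw [← k3]
  have k4 : ∀ t, (∑ j, centred h t j ^ 4) / m = (∑ j, h (t, j) ^ 4) / m -
      4 * (√(m : ℝ))⁻¹ * (classStat id h t * ((∑ j, h (t, j) ^ 3) / m)) +
      6 * (√(m : ℝ))⁻¹ ^ 2 * (classStat id h t *
        (classStat id h t * (1 + (√(m : ℝ))⁻¹ * classStat (fun x => x ^ 2 - 1) h t))) -
      3 * (√(m : ℝ))⁻¹ ^ 4 * classStat id h t ^ 4 := by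
    intro t
    rw [sum_centred_four hm, sum_class_sq hm, classMean_eq]
    nth_rewrite 3 [hsm]
    generalize (√(m : ℝ))⁻¹ = ε at *
    field_simp
  simp_rw [k4]
  simp only [Finset.sum_sub_distrib, Finset.sum_add_distrib, ← Finset.mul_sum]
  ring

lemma abs_sum_centred_four_sub_le (hr : r ≠ 0) (hm : m ≠ 0) (h : Fin r × Fin m → ℝ) :
    |∑ t, (∑ j, centred h t j ^ 4) / m - 3 * r| ≤
      (√(m : ℝ))⁻¹ * r * (19 * fluct h ^ 4 + |linStat (fun x => x ^ 4 - 3) h|) := by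
  obtain ⟨R1, Rτ, -, Ru, Rv, -⟩ := fluct_bounds h
  obtain ⟨hε0, hε1, -⟩ := inv_sqrt_facts hm
  have hU := abs_sum_classStat_pow_le h 3
  have hq := sqrt_natCast_le hr
  have hr1 : (1 : ℝ) ≤ r := Nat.one_le_cast.2 (Nat.one_le_iff_ne_zero.2 hr)
  have hR0 : 0 < fluct h := by linarith
  have hA : |∑ t, classStat id h t * ((∑ j, h (t, j) ^ 3) / m)| ≤ fluct h * (r * fluct h) := by
    refine sum_abs_mul_le Ru (by positivity) fun t => ?_
    refine le_trans ?_ (abs_sum_cube_div_le hr hm h)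
    rw [abs_div, Nat.abs_cast]
    gcongr
    refine (Finset.abs_sum_le_sum_abs _ _).trans ?_
    simp only [abs_pow]
    rw [Fintype.sum_prod_type]
    exact Finset.single_le_sum (f := fun t => ∑ j, |h (t, j)| ^ 3)
      (fun _ _ => Finset.sum_nonneg fun _ _ => by positivity) (Finset.mem_univ t)
  have hB : |∑ t, classStat id h t *
        (classStat id h t * (1 + (√(m : ℝ))⁻¹ * classStat (fun x => x ^ 2 - 1) h t))| ≤
      fluct h * (fluct h * (1 + 1 * fluct h)) := by
    refine sum_abs_mul_le Ru (by positivity) fun t => abs_mul_le_mul (abs_le_of_sum Ru t) ?_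
    exact abs_add_le_add abs_one.le (abs_mul_le_mul (by rwa [abs_of_pos hε0]) (abs_le_of_sum Rv t))
  rw [sum_centred_four_div_sub hr hm]
  generalize ∑ t, classStat id h t ^ (3 + 1) = U at *
  generalize ∑ t, classStat id h t * ((∑ j, h (t, j) ^ 3) / m) = A at *
  generalize ∑ t, classStat id h t *
        (classStat id h t * (1 + (√(m : ℝ))⁻¹ * classStat (fun x => x ^ 2 - 1) h t)) = B at *
  generalize linStat (fun x => x ^ 4 - 3) h = κ at *
  generalize fluct h = R at *
  generalize (√(m : ℝ))⁻¹ = ε at *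
  generalize √(r : ℝ) = q at *
  have e1 : |4 * ε| ≤ 4 * ε := (abs_of_pos (by positivity)).le
  have e2 : |6 * ε ^ 2| ≤ 6 * ε := by
    rw [abs_of_pos (by positivity)]
    have := mul_le_mul_of_nonneg_left hε1 hε0.le
    linarith
  have e3 : |3 * ε ^ 4| ≤ 3 * ε := by
    rw [abs_of_pos (by positivity)]
    linarith [pow_le_of_le_one hε0.le hε1 (n := 4) (by norm_num)]
  refine (abs_sub_le_add (abs_add_le_add (abs_sub_le_add (abs_mul_le_mul (abs_of_pos hε0).le
    (abs_mul_le_mul hq le_rfl)) (abs_mul_le_mul e1 hA)) (abs_mul_le_mul e2 hB))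
    (abs_mul_le_mul e3 hU)).trans ?_
  have h2 : R ^ 2 ≤ R ^ 4 := pow_le_pow_right₀ R1 (by norm_num)
  have h3 : R ^ 3 ≤ R ^ 4 := pow_le_pow_right₀ R1 (by norm_num)
  have h5 : R * (r * R) ≤ r * R ^ 4 := by nlinarith
  have h4 : 1 * R ^ 4 ≤ r * R ^ 4 := by gcongr
  have h6 : R * (R * (1 + 1 * R)) ≤ 2 * (r * R ^ 4) := by nlinarith
  have h7 : R * R ^ 3 ≤ r * R ^ 4 := by nlinarith
  calc _ = ε * (r * |κ| + 4 * (R * (r * R)) + 6 * (R * (R * (1 + 1 * R))) + 3 * (R * R ^ 3)) := by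
        ring
    _ ≤ ε * (r * |κ| + 4 * (r * R ^ 4) + 6 * (2 * (r * R ^ 4)) + 3 * (r * R ^ 4)) := by gcongr
    _ = _ := by ring

lemma abs_sum_sq_centred_sub_le (hm : m ≠ 0) (h : Fin r × Fin m → ℝ) :
    |∑ t, ((∑ j, centred h t j ^ 2) / m) ^ 2 - r| ≤ 8 * (√(m : ℝ))⁻¹ * fluct h ^ 4 := by
  obtain ⟨R1, Rτ, -, Ru, Rv, -⟩ := fluct_bounds h
  obtain ⟨hε0, hε1, -⟩ := inv_sqrt_facts hm
  have hR0 : 0 < fluct h := by linarith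
  set u := classStat id h with hu
  set v := classStat (fun x => x ^ 2 - 1) h with hv
  set ε := (√(m : ℝ))⁻¹ with hεd
  have key : ∑ t, ((∑ j, centred h t j ^ 2) / m) ^ 2 - r =
      ε * ∑ t, (v t - u t * (ε * u t)) * (2 + ε * (v t - u t * (ε * u t))) := by
    have : ∀ t, ((∑ j, centred h t j ^ 2) / m) ^ 2 =
        1 + ε * ((v t - u t * (ε * u t)) * (2 + ε * (v t - u t * (ε * u t)))) := by
      intro t
      rw [sum_centred_sq_div hm, classMean_eq, ← hu, ← hv, ← hεd]
      ring
    simp_rw [this, Finset.sum_add_distrib, ← Finset.mul_sum]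
    simp
  have hw : ∑ t, |v t - u t * (ε * u t)| ≤ fluct h + fluct h * (1 * fluct h) := by
    refine (Finset.sum_le_sum fun t _ => abs_sub (v t) (u t * (ε * u t))).trans ?_
    rw [Finset.sum_add_distrib]
    refine add_le_add Rv ?_
    calc _ ≤ ∑ t, |u t| * (1 * fluct h) := by
          refine Finset.sum_le_sum fun t _ => ?_
          exact abs_mul_le_mul le_rfl (abs_mul_le_mul (by rwa [abs_of_pos hε0]) (abs_le_of_sum Ru t))
      _ = (∑ t, |u t|) * (1 * fluct h) := by rw [Finset.sum_mul]
      _ ≤ _ := by gcongr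
  have hw2 : ∑ t, |v t - u t * (ε * u t)| ≤ 2 * fluct h ^ 2 := by
    refine hw.trans ?_
    nlinarith
  rw [key]
  refine (abs_mul_le_mul (abs_of_pos hε0).le (sum_abs_mul_le hw2 (K := 2 + 1 * (2 * fluct h ^ 2))
    (by positivity) fun t => abs_add_le_add (by norm_num)
      (abs_mul_le_mul (by rwa [abs_of_pos hε0]) (abs_le_of_sum hw2 t)))).trans ?_
  have : 1 ≤ fluct h ^ 2 := one_le_pow₀ R1
  have h8 : 2 * fluct h ^ 2 * (2 + 1 * (2 * fluct h ^ 2)) ≤ 8 * fluct h ^ 4 := by nlinarith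
  calc _ ≤ ε * (8 * fluct h ^ 4) := mul_le_mul_of_nonneg_left h8 hε0.le
    _ = _ := by ring

/-- The quartic edge moment concentrates around `3 r²`. -/
lemma abs_edge_four_sub_le (hr : r ≠ 0) (hm : m ≠ 0) (h : Fin r × Fin m → ℝ) :
    |(∑ e, edgeSum r m (shrink h) e ^ 4) / (m : ℝ) ^ r - 3 * (r : ℝ) ^ 2| ≤
      130 * (√(m : ℝ))⁻¹ * (r : ℝ) ^ 2 * (fluct h ^ 4 + |linStat (fun x => x ^ 4 - 3) h|) := by
  obtain ⟨R1, Rτ, -⟩ := fluct_bounds h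
  have hm' : (m : ℝ) ≠ 0 := Nat.cast_ne_zero.2 hm
  have hr1 : (1 : ℝ) ≤ r := Nat.one_le_cast.2 (Nat.one_le_iff_ne_zero.2 hr)
  obtain ⟨-, -, -, E4⟩ := sum_edges_pow hm r (centred h) (sum_centred hm h) (meanEdge h)
  obtain ⟨hε0, hε1, -⟩ := inv_sqrt_facts hm
  simp_rw [edgeSum_shrink, E4]
  rw [mul_div_cancel_left₀ _ (pow_ne_zero _ hm')]
  refine abs_four_expansion_le hε0 hε1 hr1 R1 (abs_nonneg _) ?_ (abs_sum_centred_sq_sub_le hr hm h)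
    (abs_sum_centred_cube_le hr hm h) (abs_sum_centred_four_sub_le hr hm h)
    (abs_sum_sq_centred_sub_le hm h)
  rw [meanEdge_eq]
  exact abs_mul_le_mul (abs_of_pos hε0).le Rτ

end

section
open ProbabilityTheory

lemma exists_moment_linear : ∃ K : ℝ, 0 < K ∧ ∀ (ι : Type) [Fintype ι] (a : ι → ℝ),
    ∑ p, a p ^ 2 ≤ 1 →
    Integrable (fun h : ι → ℝ => |∑ p, a p * id (h p)| ^ 8) (stdGauss ι) ∧
      ∫ h : ι → ℝ, |∑ p, a p * id (h p)| ^ 8 ∂(stdGauss ι) ≤ K := by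
  have hD : Integrable (fun x => id x ^ 2 * Real.exp |id x|) (gaussianReal 0 1) := by
    have := integrable_pow_mul_exp_gaussianReal 2 (a := 1) (b := 0) (by norm_num)
    simpa using this
  refine ⟨_, ?_, fun ι _ a ha => integral_sum_pow_eight_le continuous_id hD
    integral_pow_gaussianReal_values.1 ha⟩
  positivity

lemma exists_moment_square : ∃ K : ℝ, 0 < K ∧ ∀ (ι : Type) [Fintype ι] (a : ι → ℝ),
    ∑ p, a p ^ 2 ≤ 1 →
    Integrable (fun h : ι → ℝ => |∑ p, a p * (h p ^ 2 - 1)| ^ 8) (stdGauss ι) ∧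
      ∫ h : ι → ℝ, |∑ p, a p * (h p ^ 2 - 1)| ^ 8 ∂(stdGauss ι) ≤ K := by
  have hD : Integrable (fun x : ℝ => ((x ^ 2 - 1) / 4) ^ 2 * Real.exp |(x ^ 2 - 1) / 4|)
      (gaussianReal 0 1) := by
    refine integrable_gaussianReal_of_le (by fun_prop) (10000 * Real.exp (1 / 4)) fun x => ?_
    have h1 : |(x ^ 2 - 1) / 4| ≤ x ^ 2 / 4 + 1 / 4 := by
      rw [abs_le]; constructor <;> nlinarith [sq_nonneg x]
    have h2 : ((x ^ 2 - 1) / 4) ^ 2 ≤ 10000 * Real.exp (x ^ 2 / 8) := by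
      have h3 : (1 + x ^ 2 / 8 / 2) ≤ Real.exp (x ^ 2 / 8 / 2) := by
        linarith [Real.add_one_le_exp (x ^ 2 / 8 / 2)]
      have h4 : (1 + x ^ 2 / 8 / 2) ^ 2 ≤ Real.exp (x ^ 2 / 8) := by
        calc _ ≤ Real.exp (x ^ 2 / 8 / 2) ^ 2 := pow_le_pow_left₀ (by positivity) h3 2
          _ = _ := by rw [← Real.exp_nat_mul]; congr 1; push_cast; ring
      nlinarith [sq_nonneg x, sq_nonneg (x ^ 2)]
    rw [Real.norm_eq_abs, abs_mul, Real.abs_exp, abs_of_nonneg (sq_nonneg _)]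
    calc _ ≤ (10000 * Real.exp (x ^ 2 / 8)) * Real.exp (x ^ 2 / 4 + 1 / 4) := by gcongr
      _ = 10000 * Real.exp (1 / 4) * Real.exp (3 / 8 * x ^ 2) := by
        rw [mul_assoc, mul_assoc, ← Real.exp_add, ← Real.exp_add]; congr 2; ring
  obtain ⟨-, h2, -⟩ := integral_pow_gaussianReal_values
  have h0 : ∫ x : ℝ, (x ^ 2 - 1) / 4 ∂(gaussianReal 0 1) = 0 := by
    rw [integral_div, integral_sub (integrable_pow_gaussianReal 2) (integrable_const 1), h2]
    simp
  refine ⟨4 ^ 8 * ((Nat.factorial 8 : ℝ) * (2 * Real.exp (∫ x : ℝ, ((x ^ 2 - 1) / 4) ^ 2 *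
    Real.exp |(x ^ 2 - 1) / 4| ∂(gaussianReal 0 1)))), by positivity, fun ι _ a ha => ?_⟩
  obtain ⟨i, b⟩ := integral_sum_pow_eight_le (φ := fun x => (x ^ 2 - 1) / 4) (by fun_prop) hD h0 ha
  have he : (fun h : ι → ℝ => |∑ p, a p * (h p ^ 2 - 1)| ^ 8) =
      fun h => 4 ^ 8 * |∑ p, a p * ((h p ^ 2 - 1) / 4)| ^ 8 := by
    ext h
    have : ∑ p, a p * (h p ^ 2 - 1) = 4 * ∑ p, a p * ((h p ^ 2 - 1) / 4) := by
      rw [Finset.mul_sum]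
      exact Finset.sum_congr rfl fun p _ => by ring
    rw [this, abs_mul, mul_pow]
    norm_num
  rw [he]
  refine ⟨i.const_mul _, ?_⟩
  rw [integral_const_mul]
  gcongr

section
variable {r m : ℕ}

lemma linStat_eq (φ : ℝ → ℝ) (h : Fin r × Fin m → ℝ) :
    linStat φ h = ∑ p, (√((r : ℝ) * m))⁻¹ * φ (h p) := by
  rw [linStat, Finset.mul_sum]

lemma classStat_eq (φ : ℝ → ℝ) (h : Fin r × Fin m → ℝ) (t : Fin r) :
    classStat φ h t = ∑ p : Fin r × Fin m, (if p.1 = t then (√(m : ℝ))⁻¹ else 0) * φ (h p) := by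
  rw [classStat, Fintype.sum_prod_type, Finset.sum_eq_single t]
  · simp [Finset.mul_sum]
  · intro s _ hs; simp [hs]
  · simp

lemma sum_linStat_weights_le : ∑ _p : Fin r × Fin m, ((√((r : ℝ) * m))⁻¹) ^ 2 ≤ 1 := by
  rw [inv_pow, Real.sq_sqrt (by positivity)]
  simp only [Finset.sum_const, Finset.card_univ, Fintype.card_prod, Fintype.card_fin, nsmul_eq_mul,
    Nat.cast_mul]
  exact mul_inv_le_one

lemma sum_classStat_weights_le (t : Fin r) :
    ∑ p : Fin r × Fin m, (if p.1 = t then (√(m : ℝ))⁻¹ else 0) ^ 2 ≤ 1 := by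
  rw [Fintype.sum_prod_type, Finset.sum_eq_single t]
  · simp [Real.sq_sqrt]; exact mul_inv_le_one
  · intro s _ hs; simp [hs]
  · simp

lemma integral_eval_stdGauss {ι : Type} [Fintype ι] {f : ℝ → ℝ} (hf : Integrable f (gaussianReal 0 1))
    (p : ι) : Integrable (fun h : ι → ℝ => f (h p)) (stdGauss ι) ∧
      ∫ h : ι → ℝ, f (h p) ∂(stdGauss ι) = ∫ x, f x ∂(gaussianReal 0 1) := by
  have hmp : MeasurePreserving (fun h : ι → ℝ => h p) (stdGauss ι) (gaussianReal 0 1) :=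
    measurePreserving_eval _ p
  refine ⟨hmp.integrable_comp_of_integrable hf, ?_⟩
  rw [← hmp.map_eq] at hf ⊢
  rw [integral_map (measurable_pi_apply p).aemeasurable hf.aestronglyMeasurable]

lemma fluct_pow_eight_le (hr : r ≠ 0) (hm : m ≠ 0) (h : Fin r × Fin m → ℝ) :
    fluct h ^ 8 ≤ 6 ^ 7 * (1 + |linStat id h| ^ 8 + |linStat (fun x => x ^ 2 - 1) h| ^ 8 +
      (r : ℝ) ^ 7 * ∑ t, |classStat id h t| ^ 8 +
      (r : ℝ) ^ 7 * ∑ t, |classStat (fun x => x ^ 2 - 1) h t| ^ 8 +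
      ((r : ℝ) * m)⁻¹ * ∑ p, |h p| ^ 24) := by
  have h1 := abs_nonneg (linStat id h)
  have h2 := abs_nonneg (linStat (fun x => x ^ 2 - 1) h)
  have h3 : 0 ≤ ∑ t, |classStat id h t| := Finset.sum_nonneg fun _ _ => abs_nonneg _
  have h4 : 0 ≤ ∑ t, |classStat (fun x => x ^ 2 - 1) h t| :=
    Finset.sum_nonneg fun _ _ => abs_nonneg _
  have h5 : 0 ≤ (∑ p, |h p| ^ 3) / ((r : ℝ) * m) := by positivity
  have e3 := pow_sum_le_card_mul_sum_pow (s := Finset.univ) (f := fun t => |classStat id h t|)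
    (fun _ _ => abs_nonneg _) 7
  have e4 := pow_sum_le_card_mul_sum_pow (s := Finset.univ)
    (f := fun t => |classStat (fun x => x ^ 2 - 1) h t|) (fun _ _ => abs_nonneg _) 7
  have e5 : ((∑ p, |h p| ^ 3) / ((r : ℝ) * m)) ^ 8 ≤ ((r : ℝ) * m)⁻¹ * ∑ p, |h p| ^ 24 := by
    have := pow_sum_le_card_mul_sum_pow (s := Finset.univ) (f := fun p => |h p| ^ 3)
      (fun _ _ => by positivity) 7
    simp only [← pow_mul, Finset.card_univ, Fintype.card_prod, Fintype.card_fin, Nat.cast_mul]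
      at this
    have hn : (0 : ℝ) < (r : ℝ) * m := by positivity
    rw [div_pow, div_le_iff₀ (by positivity)]
    refine this.trans_eq ?_
    norm_num
    field_simp
  simp only [Finset.card_univ, Fintype.card_fin] at e3 e4
  have e6 := pow_sum_le_card_mul_sum_pow (s := Finset.univ) (f := ![1, |linStat id h|,
    |linStat (fun x => x ^ 2 - 1) h|, ∑ t, |classStat id h t|,
    ∑ t, |classStat (fun x => x ^ 2 - 1) h t|, (∑ p, |h p| ^ 3) / ((r : ℝ) * m)])
    (fun i _ => by fin_cases i <;> simp <;> assumption) 7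
  simp only [Fin.sum_univ_six, Finset.card_univ, Fintype.card_fin] at e6
  simp at e6
  unfold fluct
  norm_num at e3 e4 e6 ⊢
  rw [_root_.mul_inv_rev] at e5
  refine e6.trans ?_
  linarith

/-- The eighth moment of the fluctuations grows at most like `r ^ 8`. -/
lemma exists_moment_fluct : ∃ K : ℝ, 0 < K ∧ ∀ r m : ℕ, r ≠ 0 → m ≠ 0 →
    Integrable (fun h => fluct h ^ 8) (stdGauss (Fin r × Fin m)) ∧
      ∫ h, fluct h ^ 8 ∂(stdGauss (Fin r × Fin m)) ≤ K * (r : ℝ) ^ 8 := by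
  obtain ⟨K1, hK1, H1⟩ := exists_moment_linear
  obtain ⟨K2, hK2, H2⟩ := exists_moment_square
  set K3 := ∫ x : ℝ, |x| ^ 24 ∂(gaussianReal 0 1) with hK3
  have hK30 : 0 ≤ K3 := integral_nonneg fun x => by positivity
  refine ⟨6 ^ 7 * (1 + K1 + K2 + K1 + K2 + K3), by positivity, fun r m hr hm => ?_⟩
  have i1 : Integrable (fun h : Fin r × Fin m → ℝ => |linStat id h| ^ 8) (stdGauss _) ∧
      ∫ h, |linStat id h| ^ 8 ∂(stdGauss (Fin r × Fin m)) ≤ K1 := by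
    simp only [linStat_eq]; exact H1 _ _ sum_linStat_weights_le
  have i2 : Integrable (fun h : Fin r × Fin m → ℝ => |linStat (fun x => x ^ 2 - 1) h| ^ 8)
      (stdGauss _) ∧
      ∫ h, |linStat (fun x => x ^ 2 - 1) h| ^ 8 ∂(stdGauss (Fin r × Fin m)) ≤ K2 := by
    simp only [linStat_eq]; exact H2 _ _ sum_linStat_weights_le
  have i3 : ∀ t, Integrable (fun h : Fin r × Fin m → ℝ => |classStat id h t| ^ 8) (stdGauss _) ∧
      ∫ h, |classStat id h t| ^ 8 ∂(stdGauss (Fin r × Fin m)) ≤ K1 := fun t => by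
    simp only [classStat_eq]; exact H1 _ _ (sum_classStat_weights_le t)
  have i4 : ∀ t, Integrable (fun h : Fin r × Fin m → ℝ => |classStat (fun x => x ^ 2 - 1) h t| ^ 8)
      (stdGauss _) ∧
      ∫ h, |classStat (fun x => x ^ 2 - 1) h t| ^ 8 ∂(stdGauss (Fin r × Fin m)) ≤ K2 := fun t => by
    simp only [classStat_eq]; exact H2 _ _ (sum_classStat_weights_le t)
  have i5 : ∀ p, Integrable (fun h : Fin r × Fin m → ℝ => |h p| ^ 24) (stdGauss _) ∧
      ∫ h, |h p| ^ 24 ∂(stdGauss (Fin r × Fin m)) = K3 := fun p =>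
    integral_eval_stdGauss (integrable_abs_pow_gaussianReal 24) p
  have I3 := (integrable_finsetSum Finset.univ fun t _ => (i3 t).1).const_mul ((r : ℝ) ^ 7)
  have I4 := (integrable_finsetSum Finset.univ fun t _ => (i4 t).1).const_mul ((r : ℝ) ^ 7)
  have I5 := (integrable_finsetSum Finset.univ fun p _ => (i5 p).1).const_mul (((r : ℝ) * m)⁻¹)
  have J0 : Integrable (fun _ : Fin r × Fin m → ℝ => (1 : ℝ)) (stdGauss _) := integrable_const 1
  have J1 := J0.add i1.1
  have J2 := J1.add i2.1
  have J3 := J2.add I3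
  have J4 := J3.add I4
  have J5 := (J4.add I5).const_mul (6 ^ 7)
  have hi : Integrable (fun h => fluct h ^ 8) (stdGauss (Fin r × Fin m)) := by
    refine J5.mono' ?_ (ae_of_all _ fun h => ?_)
    · refine Continuous.aestronglyMeasurable ?_
      unfold fluct linStat classStat
      fun_prop
    · rw [Real.norm_eq_abs, abs_of_nonneg (by positivity)]
      exact fluct_pow_eight_le hr hm h
  refine ⟨hi, (integral_mono hi J5 (fluct_pow_eight_le hr hm)).trans ?_⟩
  rw [integral_const_mul, integral_add' J4 I5, integral_add' J3 I4, integral_add' J2 I3,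
    integral_add' J1 i2.1, integral_add' J0 i1.1, integral_const_mul, integral_const_mul,
    integral_const_mul, integral_finsetSum _ fun t _ => (i3 t).1,
    integral_finsetSum _ fun t _ => (i4 t).1, integral_finsetSum _ fun p _ => (i5 p).1]
  have s3 : ∑ t, ∫ h, |classStat id h t| ^ 8 ∂(stdGauss (Fin r × Fin m)) ≤ r * K1 := by
    refine (Finset.sum_le_sum fun t _ => (i3 t).2).trans ?_
    simp
  have s4 : ∑ t, ∫ h, |classStat (fun x => x ^ 2 - 1) h t| ^ 8 ∂(stdGauss (Fin r × Fin m)) ≤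
      r * K2 := by
    refine (Finset.sum_le_sum fun t _ => (i4 t).2).trans ?_
    simp
  have s5 : ((r : ℝ) * m)⁻¹ * ∑ p, ∫ h, |h p| ^ 24 ∂(stdGauss (Fin r × Fin m)) ≤ K3 := by
    rw [Finset.sum_congr rfl fun p _ => (i5 p).2]
    simp only [Finset.sum_const, Finset.card_univ, Fintype.card_prod, Fintype.card_fin,
      nsmul_eq_mul, Nat.cast_mul]
    have : (r : ℝ) * m ≠ 0 := by positivity
    rw [inv_mul_cancel_left₀ this]
  have hr1 : (1 : ℝ) ≤ (r : ℝ) ^ 8 :=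
    one_le_pow₀ (Nat.one_le_cast.2 (Nat.one_le_iff_ne_zero.2 hr))
  have t3 := mul_le_mul_of_nonneg_left s3 (by positivity : (0 : ℝ) ≤ (r : ℝ) ^ 7)
  have t4 := mul_le_mul_of_nonneg_left s4 (by positivity : (0 : ℝ) ≤ (r : ℝ) ^ 7)
  have u1 : K1 ≤ K1 * (r : ℝ) ^ 8 := le_mul_of_one_le_right hK1.le hr1
  have u2 : K2 ≤ K2 * (r : ℝ) ^ 8 := le_mul_of_one_le_right hK2.le hr1
  have u3 : K3 ≤ K3 * (r : ℝ) ^ 8 := le_mul_of_one_le_right hK30 hr1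
  have hone : ∫ _ : Fin r × Fin m → ℝ, (1 : ℝ) ∂(stdGauss (Fin r × Fin m)) = 1 := by simp
  rw [hone]
  have i1b := i1.2
  have i2b := i2.2
  nlinarith

/-- The second moment of the quartic statistic is bounded. -/
lemma exists_moment_quartic : ∃ K : ℝ, 0 < K ∧ ∀ r m : ℕ, r ≠ 0 → m ≠ 0 →
    Integrable (fun h => linStat (fun x => x ^ 4 - 3) h ^ 2) (stdGauss (Fin r × Fin m)) ∧
      ∫ h, linStat (fun x => x ^ 4 - 3) h ^ 2 ∂(stdGauss (Fin r × Fin m)) ≤ K := by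
  have h2 : Integrable (fun x : ℝ => (x ^ 4 - 3) ^ 2) (gaussianReal 0 1) := by
    have he : (fun x : ℝ => (x ^ 4 - 3) ^ 2) = fun x => x ^ 8 - 6 * x ^ 4 + 9 := by ext x; ring
    rw [he]
    exact ((integrable_pow_gaussianReal 8).sub ((integrable_pow_gaussianReal 4).const_mul 6)).add
      (integrable_const 9)
  obtain ⟨-, -, -, h4, -⟩ := integral_pow_gaussianReal_values
  have h0 : ∫ x : ℝ, x ^ 4 - 3 ∂(gaussianReal 0 1) = 0 := by
    rw [integral_sub (integrable_pow_gaussianReal 4) (integrable_const 3), h4]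
    simp
  set K := ∫ x : ℝ, (x ^ 4 - 3) ^ 2 ∂(gaussianReal 0 1) with hK
  have hK0 : 0 ≤ K := integral_nonneg fun x => sq_nonneg _
  refine ⟨K + 1, by positivity, fun r m hr hm => ?_⟩
  obtain ⟨i, b⟩ := integral_sum_sq_eq (ι := Fin r × Fin m) (φ := fun x => x ^ 4 - 3)
    (by fun_prop) h2 h0
  have he : (fun h : Fin r × Fin m → ℝ => linStat (fun x => x ^ 4 - 3) h ^ 2) =
      fun h => ((r : ℝ) * m)⁻¹ * (∑ p, (h p ^ 4 - 3)) ^ 2 := by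
    ext h
    rw [linStat, mul_pow, inv_pow, Real.sq_sqrt (by positivity)]
  rw [he]
  refine ⟨i.const_mul _, ?_⟩
  rw [integral_const_mul, b]
  have : (r : ℝ) * m ≠ 0 := by positivity
  simp only [Fintype.card_prod, Fintype.card_fin, Nat.cast_mul]
  rw [inv_mul_cancel_left₀ this]
  linarith

end
end

section
open ProbabilityTheory

section
variable {r m : ℕ}

lemma sum_edges_apply (hm : m ≠ 0) (f : Fin r × Fin m → ℝ) :
    ∑ e : Fin r → Fin m, ∑ t, f (t, e t) = (m : ℝ) ^ r * ((∑ p, f p) / m) := by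
  have h := (sum_edges_pow hm r (centred f) (sum_centred hm f) (∑ t, classMean f t)).1
  simp only [centred, Finset.sum_sub_distrib, add_sub_cancel] at h
  rw [h, Fintype.sum_prod_type, Finset.sum_div]
  rfl

lemma sum_edges_four_le (hm : m ≠ 0) (θ : Fin r × Fin m → ℝ) :
    (∑ e, edgeSum r m θ e ^ 4) / (m : ℝ) ^ r ≤ (r : ℝ) ^ 3 / m * ∑ p, θ p ^ 4 := by
  have h1 : ∀ e, edgeSum r m θ e ^ 4 ≤ (r : ℝ) ^ 3 * ∑ t, θ (t, e t) ^ 4 := fun e => by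
    have h2 := pow_sum_le_card_mul_sum_pow (s := Finset.univ) (f := fun t => |θ (t, e t)|)
      (fun _ _ => abs_nonneg _) 3
    simp only [Finset.card_univ, Fintype.card_fin] at h2
    norm_num [Even.pow_abs (by decide : Even 4)] at h2
    refine le_trans ?_ h2
    rw [← Even.pow_abs (by decide : Even 4) (edgeSum r m θ e)]
    exact pow_le_pow_left₀ (abs_nonneg _) (Finset.abs_sum_le_sum_abs _ _) 4
  have hm' : (0 : ℝ) < m := by positivity
  rw [div_le_iff₀ (by positivity)]
  refine (Finset.sum_le_sum fun e _ => h1 e).trans_eq ?_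
  rw [← Finset.mul_sum, sum_edges_apply hm (fun p => θ p ^ 4)]
  field_simp

lemma sqrt_inv_facts (hr : r ≠ 0) : 0 < (√(r : ℝ))⁻¹ ∧ (√(r : ℝ))⁻¹ ≤ 1 := by
  obtain ⟨h1, h2, -⟩ := inv_sqrt_facts hr
  exact ⟨h1, h2⟩

lemma sum_shrink_four_le (hr : r ≠ 0) (hm : m ≠ 0) (h : Fin r × Fin m → ℝ) :
    ∑ p, shrink h p ^ 4 ≤ 16 * ∑ p, h p ^ 4 := by
  obtain ⟨h1, h2⟩ := sqrt_inv_facts hr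
  have hm' : (0 : ℝ) < m := by positivity
  have hp : ∀ p, shrink h p ^ 4 ≤ 8 * (h p ^ 4 + classMean h p.1 ^ 4) := fun p => by
    have h3 : ∀ x y : ℝ, (x - y) ^ 4 ≤ 8 * (x ^ 4 + y ^ 4) := fun x y => by
      nlinarith [sq_nonneg (x + y), sq_nonneg (x ^ 2 - y ^ 2), sq_nonneg ((x + y) ^ 2),
        mul_nonneg (sq_nonneg (x + y)) (sq_nonneg (x - y))]
    have h4 : ((1 - (√(r : ℝ))⁻¹) * classMean h p.1) ^ 4 ≤ classMean h p.1 ^ 4 := by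
      rw [mul_pow]
      exact mul_le_of_le_one_left (by positivity) (pow_le_one₀ (by linarith) (by linarith))
    refine (h3 _ _).trans ?_
    linarith
  have hM : ∀ t, ∑ _j : Fin m, classMean h t ^ 4 ≤ ∑ j, h (t, j) ^ 4 := fun t => by
    have h2 := pow_sum_le_card_mul_sum_pow (s := Finset.univ) (f := fun j => |h (t, j)|)
      (fun _ _ => abs_nonneg _) 3
    simp only [Finset.card_univ, Fintype.card_fin] at h2
    norm_num [Even.pow_abs (by decide : Even 4)] at h2
    have h5 : (∑ j, h (t, j)) ^ 4 ≤ (m : ℝ) ^ 3 * ∑ j, h (t, j) ^ 4 := by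
      refine le_trans ?_ h2
      rw [← Even.pow_abs (by decide : Even 4) (∑ j, h (t, j))]
      exact pow_le_pow_left₀ (abs_nonneg _) (Finset.abs_sum_le_sum_abs _ _) 4
    simp only [Finset.sum_const, Finset.card_univ, Fintype.card_fin, nsmul_eq_mul]
    rw [classMean, div_pow, ← mul_div_assoc, div_le_iff₀ (by positivity)]
    calc _ ≤ (m : ℝ) * ((m : ℝ) ^ 3 * ∑ j, h (t, j) ^ 4) := by gcongr
      _ = _ := by ring
  refine (Finset.sum_le_sum fun p _ => hp p).trans ?_
  rw [← Finset.mul_sum, Finset.sum_add_distrib]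
  have : ∑ p : Fin r × Fin m, classMean h p.1 ^ 4 ≤ ∑ p, h p ^ 4 := by
    rw [Fintype.sum_prod_type, Fintype.sum_prod_type]
    exact Finset.sum_le_sum fun t _ => hM t
  linarith

lemma abs_le_of_abs_shrink_le (hr : r ≠ 0) (hm : m ≠ 0) {h : Fin r × Fin m → ℝ} {B : ℝ}
    (hB : ∀ p, |shrink h p| ≤ B) (p : Fin r × Fin m) : |h p| ≤ √(r : ℝ) * B := by
  have hq : 1 ≤ √(r : ℝ) := Real.one_le_sqrt.2 (Nat.one_le_cast.2 (Nat.one_le_iff_ne_zero.2 hr))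
  have hm' : (0 : ℝ) < m := by positivity
  have h1 : |(∑ j, shrink h (p.1, j)) / m| ≤ B := by
    rw [abs_div, Nat.abs_cast, div_le_iff₀ hm']
    refine (Finset.abs_sum_le_sum_abs _ _).trans ((Finset.sum_le_sum fun j _ => hB _).trans_eq ?_)
    simp [mul_comm]
  have h2 : h p = shrink h p + (√(r : ℝ) - 1) * ((∑ j, shrink h (p.1, j)) / m) := by
    rw [sum_class_shrink hm, shrink]
    field_simp
    ring
  rw [h2]
  refine (abs_add_le_add (hB p) (abs_mul_le_mul (abs_of_nonneg (by linarith)).le h1)).trans_eq ?_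
  ring

end

lemma exp_mul_pow_four_le {κ L x : ℝ} (hκ : 0 ≤ κ) (hL : κ * L ^ 2 ≤ 1 / 8) (hx : |x| ≤ L) :
    Real.exp (2 * κ * x ^ 4) ≤ 1 + 2 * κ * (x ^ 4 * Real.exp (1 / 4 * x ^ 2)) := by
  have h0 : 0 ≤ 2 * κ * x ^ 4 := by positivity
  have h1 : x ^ 2 ≤ L ^ 2 := by rw [← sq_abs]; exact pow_le_pow_left₀ (abs_nonneg _) hx 2
  have h2 : 2 * κ * x ^ 4 ≤ 1 / 4 * x ^ 2 := by
    calc 2 * κ * x ^ 4 = 2 * (κ * x ^ 2) * x ^ 2 := by ring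
      _ ≤ 2 * (κ * L ^ 2) * x ^ 2 := by gcongr
      _ ≤ 1 / 4 * x ^ 2 := mul_le_mul_of_nonneg_right (by linarith) (sq_nonneg x)
  have h3 : Real.exp (2 * κ * x ^ 4) ≤ 1 + 2 * κ * x ^ 4 * Real.exp (2 * κ * x ^ 4) := by
    have := Real.add_one_le_exp (-(2 * κ * x ^ 4))
    have h4 : Real.exp (2 * κ * x ^ 4) * Real.exp (-(2 * κ * x ^ 4)) = 1 := by
      rw [← Real.exp_add]; simp
    nlinarith [Real.exp_pos (2 * κ * x ^ 4)]
  calc _ ≤ 1 + 2 * κ * x ^ 4 * Real.exp (2 * κ * x ^ 4) := h3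
    _ ≤ 1 + 2 * κ * x ^ 4 * Real.exp (1 / 4 * x ^ 2) := by gcongr
    _ = _ := by ring

/-- The product majorant for exponentials of quartic sums of bounded variables. -/
noncomputable def quarticMaj {ι : Type} [Fintype ι] (κ : ℝ) (h : ι → ℝ) : ℝ :=
  ∏ p, (1 + 2 * κ * (h p ^ 4 * Real.exp (1 / 4 * h p ^ 2)))

lemma exp_sum_four_sq_le {ι : Type} [Fintype ι] {κ L : ℝ} (hκ : 0 ≤ κ) (hL : κ * L ^ 2 ≤ 1 / 8)
    {h : ι → ℝ} (hh : ∀ p, |h p| ≤ L) : Real.exp (κ * ∑ p, h p ^ 4) ^ 2 ≤ quarticMaj κ h := by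
  rw [← Real.exp_nat_mul, Finset.mul_sum, Finset.mul_sum, Real.exp_sum]
  refine Finset.prod_le_prod (fun p _ => (Real.exp_pos _).le) fun p _ => ?_
  have := exp_mul_pow_four_le hκ hL (hh p)
  push_cast
  rwa [← mul_assoc]

lemma exists_integral_quarticMaj_le : ∃ K : ℝ, 0 < K ∧ ∀ (ι : Type) [Fintype ι] (κ : ℝ), 0 ≤ κ →
    Integrable (fun h : ι → ℝ => quarticMaj κ h) (stdGauss ι) ∧
      ∫ h : ι → ℝ, quarticMaj κ h ∂(stdGauss ι) ≤ Real.exp (K * (κ * Fintype.card ι)) := by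
  have hi : Integrable (fun x : ℝ => x ^ 4 * Real.exp (1 / 4 * x ^ 2)) (gaussianReal 0 1) := by
    have := integrable_pow_mul_exp_gaussianReal 4 (a := 0) (b := 1 / 4) le_rfl
    simpa [Even.pow_abs (by decide : Even 4)] using this
  set D := ∫ x : ℝ, x ^ 4 * Real.exp (1 / 4 * x ^ 2) ∂(gaussianReal 0 1) with hD
  have hD0 : 0 ≤ D := integral_nonneg fun x => by positivity
  refine ⟨2 * D + 1, by positivity, fun ι _ κ hκ => ?_⟩
  have hi2 : Integrable (fun x : ℝ => 1 + 2 * κ * (x ^ 4 * Real.exp (1 / 4 * x ^ 2)))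
      (gaussianReal 0 1) := (integrable_const 1).add (hi.const_mul _)
  refine ⟨Integrable.fintype_prod
    (f := fun _ x => 1 + 2 * κ * (x ^ 4 * Real.exp (1 / 4 * x ^ 2))) fun _ => hi2, ?_⟩
  simp only [quarticMaj]
  rw [stdGauss, integral_fintype_prod_eq_prod
    (fun (_ : ι) x => 1 + 2 * κ * (x ^ 4 * Real.exp (1 / 4 * x ^ 2))), Finset.prod_const,
    integral_add (integrable_const 1) (hi.const_mul _), integral_const_mul, ← hD]
  simp only [integral_const, probReal_univ, smul_eq_mul, mul_one, Finset.card_univ]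
  calc (1 + 2 * κ * D) ^ Fintype.card ι ≤ Real.exp (2 * κ * D) ^ Fintype.card ι := by
        gcongr
        linarith [Real.add_one_le_exp (2 * κ * D)]
    _ = Real.exp (Fintype.card ι * (2 * κ * D)) := by rw [← Real.exp_nat_mul]
    _ ≤ _ := by
      refine Real.exp_le_exp.2 ?_
      have : 0 ≤ κ * Fintype.card ι := by positivity
      nlinarith

end

section
open ProbabilityTheory

/-- The coefficients of the linear functional `h ↦ shrink h p`. -/
noncomputable def shrinkCoeff {r m : ℕ} (p q : Fin r × Fin m) : ℝ :=
  (if q = p then 1 else 0) - if q.1 = p.1 then (1 - (√(r : ℝ))⁻¹) / m else 0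

section
variable {r m : ℕ}

lemma sum_class_indicator (p : Fin r × Fin m) (f : Fin r × Fin m → ℝ) :
    ∑ q : Fin r × Fin m, (if q.1 = p.1 then f q else 0) = ∑ j, f (p.1, j) := by
  rw [Fintype.sum_prod_type, Finset.sum_eq_single p.1]
  · simp
  · intro s _ hs; simp [hs]
  · simp

lemma shrink_eq_sum (h : Fin r × Fin m → ℝ) (p : Fin r × Fin m) :
    shrink h p = ∑ q, shrinkCoeff p q * id (h q) := by
  simp only [shrinkCoeff, sub_mul, Finset.sum_sub_distrib, ite_mul, zero_mul, one_mul,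
    Finset.sum_ite_eq', Finset.mem_univ, if_true, id]
  rw [sum_class_indicator p fun q => (1 - (√(r : ℝ))⁻¹) / m * h q, ← Finset.mul_sum, shrink,
    classMean]
  ring

lemma sum_shrinkCoeff_sq_le (hr : r ≠ 0) (hm : m ≠ 0) (p : Fin r × Fin m) :
    ∑ q, shrinkCoeff p q ^ 2 ≤ 1 := by
  obtain ⟨h1, h2⟩ := sqrt_inv_facts hr
  have hm' : (0 : ℝ) < m := by positivity
  set c := (1 - (√(r : ℝ))⁻¹) with hc
  have hq : ∀ q, shrinkCoeff p q ^ 2 = (if q = p then 1 - 2 * c / m else 0) +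
      if q.1 = p.1 then (c / m) ^ 2 else 0 := fun q => by
    rw [shrinkCoeff, ← hc]
    by_cases h3 : q = p
    · subst h3; simp; ring
    · by_cases h4 : q.1 = p.1 <;> simp [h3, h4]
  simp_rw [hq, Finset.sum_add_distrib]
  rw [sum_class_indicator p fun _ => (c / m) ^ 2]
  simp only [Finset.sum_ite_eq', Finset.mem_univ, if_true, Finset.sum_const, Finset.card_univ,
    Fintype.card_fin, nsmul_eq_mul]
  have h5 : (m : ℝ) * (c / m) ^ 2 = c ^ 2 / m := by field_simp
  have h6 : c ^ 2 / m ≤ 2 * c / m := by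
    gcongr
    nlinarith
  rw [h5]
  linarith

end

lemma exists_measureReal_shrink_le : ∃ K : ℝ, 0 < K ∧ ∀ r m : ℕ, r ≠ 0 → m ≠ 0 → ∀ T : ℝ,
    (stdGauss (Fin r × Fin m)).real {h | ∃ p, T < |shrink h p|} ≤
      r * m * (K * Real.exp (-T)) := by
  have hD : Integrable (fun x => id x ^ 2 * Real.exp |id x|) (gaussianReal 0 1) := by
    have := integrable_pow_mul_exp_gaussianReal 2 (a := 1) (b := 0) (by norm_num)
    simpa using this
  refine ⟨2 * Real.exp (∫ x, id x ^ 2 * Real.exp |id x| ∂(gaussianReal 0 1)), by positivity,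
    fun r m hr hm T => ?_⟩
  have he : {h : Fin r × Fin m → ℝ | ∃ p, T < |shrink h p|} =
      ⋃ p, {h | T < |∑ q, shrinkCoeff p q * id (h q)|} := by
    ext h; simp only [← shrink_eq_sum, Set.mem_iUnion, Set.mem_ofPred_eq]
  rw [he]
  refine (measureReal_iUnion_fintype_le _).trans ((Finset.sum_le_sum fun p _ =>
    measureReal_lt_abs_sum_le continuous_id hD integral_pow_gaussianReal_values.1
      (sum_shrinkCoeff_sq_le hr hm p) T).trans_eq ?_)
  simp only [Finset.sum_const, Finset.card_univ, Fintype.card_prod, Fintype.card_fin,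
    nsmul_eq_mul, Nat.cast_mul]

end

section
open ProbabilityTheory

lemma norm_pow_sub_pow_le_mul {a b : ℂ} (ha : ‖a‖ ≤ 1) (hb : ‖b‖ ≤ 1) (n : ℕ) :
    ‖a ^ n - b ^ n‖ ≤ n * ‖a - b‖ := by
  induction n with
  | zero => simp
  | succ n ih =>
    have h : a ^ (n + 1) - b ^ (n + 1) = a ^ n * (a - b) + (a ^ n - b ^ n) * b := by ring
    rw [h]
    refine (norm_add_le _ _).trans ?_
    rw [norm_mul, norm_mul, norm_pow]
    have h1 : ‖a‖ ^ n * ‖a - b‖ ≤ 1 * ‖a - b‖ := by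
      gcongr; exact pow_le_one₀ (norm_nonneg _) ha
    have h2 : ‖a ^ n - b ^ n‖ * ‖b‖ ≤ (n * ‖a - b‖) * 1 := by gcongr
    push_cast
    linarith

lemma norm_exp_mul_I_taylor_le (z : ℝ) :
    ‖Complex.exp (z * Complex.I) - (1 + z * Complex.I - (z : ℂ) ^ 2 / 2)‖ ≤ 4 * |z| ^ 3 := by
  rcases le_total |z| 1 with hz | hz
  · have h := Complex.norm_exp_sub_sum_le_norm_mul_exp ((z : ℂ) * Complex.I) 3
    simp only [Finset.sum_range_succ, Finset.sum_range_zero, norm_mul, Complex.norm_real,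
      Complex.norm_I, mul_one, Real.norm_eq_abs] at h
    have h1 : Real.exp |z| ≤ 3 :=
      (Real.exp_le_exp.2 hz).trans (by linarith [Real.exp_one_lt_d9])
    have h2 : |z| ^ 3 * Real.exp |z| ≤ |z| ^ 3 * 4 := by gcongr; linarith
    rw [mul_comm 4]
    refine le_trans (le_of_eq ?_) (h.trans h2)
    congr 1
    simp [mul_pow]
    ring
  · refine (norm_sub_le _ _).trans ?_
    rw [Complex.norm_exp_ofReal_mul_I]
    have h1 : ‖1 + (z : ℂ) * Complex.I - (z : ℂ) ^ 2 / 2‖ ≤ 1 + |z| + |z| ^ 2 / 2 := by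
      refine (norm_sub_le _ _).trans (add_le_add ((norm_add_le _ _).trans ?_) ?_)
      · simp
      · simp
    have h2 : |z| ≤ |z| ^ 3 := le_self_pow₀ hz (by norm_num)
    have h3 : |z| ^ 2 ≤ |z| ^ 3 := pow_le_pow_right₀ hz (by norm_num)
    linarith

lemma abs_exp_neg_sub_le {u : ℝ} (hu : 0 ≤ u) : |Real.exp (-u) - (1 - u)| ≤ u ^ 2 := by
  rw [abs_of_nonneg (by linarith [Real.add_one_le_exp (-u)])]
  have h1 := Real.add_one_le_exp u
  have h2 : Real.exp u * Real.exp (-u) = 1 := by rw [← Real.exp_add]; simp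
  have h3 := Real.exp_pos (-u)
  have h4 : (1 + u) * Real.exp (-u) ≤ 1 := by
    rw [← h2]; gcongr; linarith
  by_contra hc
  push Not at hc
  have h5 : (1 + u) * (1 - u + u ^ 2) < (1 + u) * Real.exp (-u) := by gcongr; linarith
  nlinarith [pow_nonneg hu 3]

lemma norm_integral_exp_sub_le {ψ : ℝ → ℝ} (hψ : Continuous ψ)
    (h1 : Integrable ψ (gaussianReal 0 1)) (h2 : Integrable (fun x => ψ x ^ 2) (gaussianReal 0 1))
    (h3 : Integrable (fun x => |ψ x| ^ 3) (gaussianReal 0 1))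
    (h0 : ∫ x, ψ x ∂(gaussianReal 0 1) = 0) :
    ‖∫ x, Complex.exp ((ψ x : ℝ) * Complex.I) ∂(gaussianReal 0 1) -
      ((Real.exp (-((∫ x, ψ x ^ 2 ∂(gaussianReal 0 1)) / 2)) : ℝ) : ℂ)‖ ≤
    4 * ∫ x, |ψ x| ^ 3 ∂(gaussianReal 0 1) + ((∫ x, ψ x ^ 2 ∂(gaussianReal 0 1)) / 2) ^ 2 := by
  set v := ∫ x, ψ x ^ 2 ∂(gaussianReal 0 1) with hv
  have hv0 : 0 ≤ v := integral_nonneg fun x => sq_nonneg _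
  have i0 : Integrable (fun x => Complex.exp ((ψ x : ℝ) * Complex.I)) (gaussianReal 0 1) := by
    refine (integrable_const (1 : ℝ)).mono' (by fun_prop) (ae_of_all _ fun x => ?_)
    rw [Complex.norm_exp_ofReal_mul_I]
  have i1 : Integrable (fun x => (ψ x : ℂ) * Complex.I) (gaussianReal 0 1) :=
    h1.ofReal.mul_const _
  have i2 : Integrable (fun x => ((ψ x ^ 2 : ℝ) : ℂ) / 2) (gaussianReal 0 1) :=
    h2.ofReal.div_const _
  have i01 : Integrable (fun x => (1 : ℂ) + (ψ x : ℂ) * Complex.I) (gaussianReal 0 1) :=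
    (integrable_const 1).add i1
  have i02 : Integrable (fun x => (1 : ℂ) + (ψ x : ℂ) * Complex.I - ((ψ x ^ 2 : ℝ) : ℂ) / 2)
      (gaussianReal 0 1) := i01.sub i2
  have e : ∫ x, (1 + (ψ x : ℂ) * Complex.I - ((ψ x ^ 2 : ℝ) : ℂ) / 2) ∂(gaussianReal 0 1) =
      ((1 - v / 2 : ℝ) : ℂ) := by
    rw [integral_sub i01 i2, integral_add (integrable_const 1) i1,
      integral_mul_const, integral_div, integral_complex_ofReal, integral_complex_ofReal, h0, ← hv]
    simp
  have a1 : ‖∫ x, Complex.exp ((ψ x : ℝ) * Complex.I) ∂(gaussianReal 0 1) -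
      ((1 - v / 2 : ℝ) : ℂ)‖ ≤ 4 * ∫ x, |ψ x| ^ 3 ∂(gaussianReal 0 1) := by
    rw [← e, ← integral_sub i0 i02, ← integral_const_mul]
    refine norm_integral_le_of_norm_le (h3.const_mul 4) (ae_of_all _ fun x => ?_)
    have := norm_exp_mul_I_taylor_le (ψ x)
    push_cast
    exact this
  have a2 : ‖((1 - v / 2 : ℝ) : ℂ) - ((Real.exp (-(v / 2)) : ℝ) : ℂ)‖ ≤ (v / 2) ^ 2 := by
    rw [← Complex.ofReal_sub, Complex.norm_real, Real.norm_eq_abs, abs_sub_comm]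
    exact abs_exp_neg_sub_le (by positivity)
  exact (norm_sub_le_norm_sub_add_norm_sub _ _ _).trans (add_le_add a1 a2)

/-- Gaussian approximation of the characteristic function of a cubic linear statistic. -/
lemma exists_norm_charFun_cubic_sub_le : ∃ K : ℝ, 0 < K ∧ ∀ (ι : Type) [Fintype ι] (q y : ℝ),
    1 ≤ q →
    ‖∫ h : ι → ℝ, Complex.exp (((y * ∑ p, (h p ^ 3 + (3 * q - 3) * h p) : ℝ) : ℂ) * Complex.I)
        ∂(stdGauss ι) -
      ((Real.exp (-(Fintype.card ι * (y ^ 2 * (6 + 9 * q ^ 2) / 2))) : ℝ) : ℂ)‖ ≤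
    Fintype.card ι * (K * (q * |y|) ^ 3 + (y ^ 2 * (6 + 9 * q ^ 2) / 2) ^ 2) := by
  obtain ⟨g1, g2, g3, g4, g6⟩ := integral_pow_gaussianReal_values
  have j3 : Integrable (fun x : ℝ => (|x| ^ 3 + 3 * |x|) ^ 3) (gaussianReal 0 1) := by
    have he : (fun x : ℝ => (|x| ^ 3 + 3 * |x|) ^ 3) = fun x => |x| ^ 9 + 9 * |x| ^ 7 +
        27 * |x| ^ 5 + 27 * |x| ^ 3 := by ext x; ring
    rw [he]
    exact (((integrable_abs_pow_gaussianReal 9).add ((integrable_abs_pow_gaussianReal 7).const_mul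
      9)).add ((integrable_abs_pow_gaussianReal 5).const_mul 27)).add
      ((integrable_abs_pow_gaussianReal 3).const_mul 27)
  set K := ∫ x : ℝ, (|x| ^ 3 + 3 * |x|) ^ 3 ∂(gaussianReal 0 1) with hK
  have hK0 : 0 ≤ K := integral_nonneg fun x => by positivity
  refine ⟨4 * K + 1, by positivity, fun ι _ q y hq => ?_⟩
  set ψ : ℝ → ℝ := fun x => y * (x ^ 3 + (3 * q - 3) * x) with hψ
  have c : Continuous ψ := by fun_prop
  have i3 := integrable_pow_gaussianReal 3
  have i1 : Integrable (fun x : ℝ => x) (gaussianReal 0 1) := by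
    simpa using integrable_pow_gaussianReal 1
  have h1 : Integrable ψ (gaussianReal 0 1) := (i3.add (i1.const_mul _)).const_mul _
  have h0 : ∫ x, ψ x ∂(gaussianReal 0 1) = 0 := by
    simp only [hψ]
    rw [integral_const_mul, integral_add i3 (i1.const_mul _), integral_const_mul, g1, g3]
    simp
  have e2 : (fun x => ψ x ^ 2) = fun x => y ^ 2 * (x ^ 6 + 2 * (3 * q - 3) * x ^ 4 +
      (3 * q - 3) ^ 2 * x ^ 2) := by ext x; simp only [hψ]; ring
  have k4 := (integrable_pow_gaussianReal 4).const_mul (2 * (3 * q - 3))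
  have k2 := (integrable_pow_gaussianReal 2).const_mul ((3 * q - 3) ^ 2)
  have k6 := integrable_pow_gaussianReal 6
  have k64 : Integrable (fun x : ℝ => x ^ 6 + 2 * (3 * q - 3) * x ^ 4) (gaussianReal 0 1) :=
    k6.add k4
  have h2 : Integrable (fun x => ψ x ^ 2) (gaussianReal 0 1) := by
    rw [e2]; exact ((k6.add k4).add k2).const_mul _
  have v2 : ∫ x, ψ x ^ 2 ∂(gaussianReal 0 1) = y ^ 2 * (6 + 9 * q ^ 2) := by
    rw [e2, integral_const_mul, integral_add k64 k2, integral_add k6 k4,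
      integral_const_mul, integral_const_mul, g2, g4, g6]
    ring
  have hb : ∀ x, |ψ x| ^ 3 ≤ (q * |y|) ^ 3 * (|x| ^ 3 + 3 * |x|) ^ 3 := fun x => by
    rw [← mul_pow]
    refine pow_le_pow_left₀ (abs_nonneg _) ?_ 3
    have h4 : |x ^ 3 + (3 * q - 3) * x| ≤ |x| ^ 3 + (3 * q - 3) * |x| :=
      abs_add_le_add (abs_pow x 3).le (abs_mul_le_mul (abs_of_nonneg (by linarith)).le le_rfl)
    have h5 : |x| ^ 3 + (3 * q - 3) * |x| ≤ q * (|x| ^ 3 + 3 * |x|) := by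
      have : 0 ≤ |x| ^ 3 := by positivity
      nlinarith [abs_nonneg x]
    calc |ψ x| = |y| * |x ^ 3 + (3 * q - 3) * x| := abs_mul _ _
      _ ≤ |y| * (q * (|x| ^ 3 + 3 * |x|)) := by gcongr; exact h4.trans h5
      _ = _ := by ring
  have h3 : Integrable (fun x => |ψ x| ^ 3) (gaussianReal 0 1) :=
    (j3.const_mul _).mono' (by fun_prop) (ae_of_all _ fun x => by
      rw [Real.norm_eq_abs, abs_of_nonneg (by positivity)]; exact hb x)
  have m3 : ∫ x, |ψ x| ^ 3 ∂(gaussianReal 0 1) ≤ (q * |y|) ^ 3 * K := by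
    rw [hK, ← integral_const_mul]
    exact integral_mono h3 (j3.const_mul _) hb
  have key := norm_integral_exp_sub_le c h1 h2 h3 h0
  rw [v2] at key
  have hprod : ∫ h : ι → ℝ, Complex.exp (((y * ∑ p, (h p ^ 3 + (3 * q - 3) * h p) : ℝ) : ℂ) *
      Complex.I) ∂(stdGauss ι) =
      (∫ x, Complex.exp ((ψ x : ℝ) * Complex.I) ∂(gaussianReal 0 1)) ^ Fintype.card ι := by
    rw [stdGauss, ← integral_fintype_prod_eq_pow]
    refine integral_congr_ae (ae_of_all _ fun h => ?_)
    simp only [hψ]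
    rw [Finset.mul_sum, Complex.ofReal_sum, Finset.sum_mul, Complex.exp_sum]
  have hexp : ((Real.exp (-(Fintype.card ι * (y ^ 2 * (6 + 9 * q ^ 2) / 2))) : ℝ) : ℂ) =
      ((Real.exp (-(y ^ 2 * (6 + 9 * q ^ 2) / 2)) : ℝ) : ℂ) ^ Fintype.card ι := by
    rw [← Complex.ofReal_pow, ← Real.exp_nat_mul]
    congr 2; ring
  rw [hprod, hexp]
  refine (norm_pow_sub_pow_le_mul ?_ ?_ _).trans ?_
  · have := norm_integral_le_of_norm_le_const (μ := gaussianReal 0 1) (C := 1)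
      (f := fun x => Complex.exp ((ψ x : ℝ) * Complex.I))
      (ae_of_all _ fun x => (Complex.norm_exp_ofReal_mul_I _).le)
    simpa using this
  · rw [Complex.norm_real, Real.norm_eq_abs, Real.abs_exp]
    exact Real.exp_le_one_iff.2 (by have : 0 ≤ y ^ 2 * (6 + 9 * q ^ 2) / 2 := by positivity
                                    linarith)
  · have : 0 ≤ (q * |y|) ^ 3 := by positivity
    gcongr
    refine key.trans ?_
    nlinarith

end

section
open ProbabilityTheory

lemma norm_exp_sub_exp_le (P Q : ℂ) :
    ‖Complex.exp P - Complex.exp Q‖ ≤ ‖P - Q‖ * (Real.exp P.re + Real.exp Q.re) := by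
  have hc : Convex ℝ {z : ℂ | z.re ≤ max P.re Q.re} := convex_halfSpace_re_le _
  have h := hc.norm_image_sub_le_of_norm_hasDerivWithin_le (f := Complex.exp)
    (f' := Complex.exp) (C := Real.exp P.re + Real.exp Q.re) (x := Q) (y := P)
    (fun z _ => (Complex.hasDerivAt_exp z).hasDerivWithinAt) (fun z hz => ?_)
    (le_max_right P.re Q.re) (le_max_left P.re Q.re)
  · rwa [mul_comm]
  · rw [Complex.norm_exp]
    have hz2 : z.re ≤ max P.re Q.re := hz
    rcases le_max_iff.1 hz2 with h | h
    · linarith [Real.exp_le_exp.2 h, Real.exp_pos Q.re]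
    · linarith [Real.exp_le_exp.2 h, Real.exp_pos P.re]

/-- A pointwise comparison with two arithmetic-geometric mean inequalities built in. -/
lemma norm_exp_sub_exp_le_of_majorant {P Q : ℂ} {k w ρ R q M V D : ℝ} (hk : 0 ≤ k) (hw : 0 < w)
    (hρ : 0 ≤ ρ) (hD : 0 ≤ D) (hM : 1 ≤ M) (hV : M ^ 2 ≤ V) (hq : 0 ≤ q)
    (hPQ : ‖P - Q‖ ≤ k * (R ^ 4 + q) + ρ) (hR : Real.exp P.re + Real.exp Q.re ≤ D * M) :
    ‖Complex.exp P - Complex.exp Q‖ ≤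
      D * (k * (w⁻¹ * R ^ 8 + (w + 1) * V + q ^ 2) + ρ * V) := by
  have h1 : R ^ 4 * M ≤ w⁻¹ * R ^ 8 + w * V := by
    have h2 : 0 ≤ w⁻¹ * (R ^ 4 - w * M) ^ 2 := by positivity
    have h3 : w⁻¹ * (R ^ 4 - w * M) ^ 2 = w⁻¹ * R ^ 8 - 2 * (R ^ 4 * M) + w * M ^ 2 := by
      field_simp; ring
    have h4 : w * M ^ 2 ≤ w * V := by gcongr
    have h5 : 0 ≤ w⁻¹ * R ^ 8 := by positivity
    have h6 : 0 ≤ w * M ^ 2 := by positivity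
    linarith
  have h2 : q * M ≤ V + q ^ 2 := by nlinarith [sq_nonneg (q - M)]
  have h3 : ρ * M ≤ ρ * V := by gcongr; nlinarith
  have hR4 : 0 ≤ R ^ 4 := by positivity
  calc ‖Complex.exp P - Complex.exp Q‖ ≤ ‖P - Q‖ * (Real.exp P.re + Real.exp Q.re) :=
        norm_exp_sub_exp_le P Q
    _ ≤ (k * (R ^ 4 + q) + ρ) * (D * M) := by gcongr
    _ = D * (k * (R ^ 4 * M + q * M) + ρ * M) := by ring
    _ ≤ D * (k * ((w⁻¹ * R ^ 8 + w * V) + (V + q ^ 2)) + ρ * V) := by gcongr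
    _ = _ := by ring

set_option maxHeartbeats 1000000 in
/-- The integral of `exp` of the cubic, quartic and remainder terms over a region `S`, compared
with its Gaussian prediction. -/
lemma exists_norm_setIntegral_sub_le : ∃ K : ℝ, 1 ≤ K ∧ ∀ (r m : ℕ), r ≠ 0 → m ≠ 0 →
    ∀ (a b s x ρ κ L : ℝ), |a| ≤ 1 / 24 → |b| ≤ 1 / 6 → 0 ≤ s → 0 ≤ x → 0 ≤ ρ → 0 ≤ κ →
      κ * L ^ 2 ≤ 1 / 8 →
    ∀ S : Set (Fin r × Fin m → ℝ), MeasurableSet S → ∀ g : (Fin r × Fin m → ℝ) → ℂ,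
      Continuous g → (∀ h ∈ S, (∀ p, |h p| ≤ L) ∧
        a * (x * ((∑ e, edgeSum r m (shrink h) e ^ 4) / (m : ℝ) ^ r)) ≤ κ * ∑ p, h p ^ 4 ∧
        ∃ z : ℂ, ‖z‖ ≤ ρ ∧ g h = Complex.exp (-Complex.I *
          ((b * (s * (m * ((∑ e, edgeSum r m (shrink h) e ^ 3) / (m : ℝ) ^ r))) : ℝ) : ℂ) +
          ((a * (x * ((∑ e, edgeSum r m (shrink h) e ^ 4) / (m : ℝ) ^ r)) : ℝ) : ℂ) + z)) →
      ‖(∫ h in S, g h ∂(stdGauss (Fin r × Fin m))) -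
          ((Real.exp (3 * (r : ℝ) ^ 2 * x * a - r * m * ((b * s) ^ 2 * (6 + 9 * r) / 2)) : ℝ)
            : ℂ)‖ ≤
        (Real.exp ρ + Real.exp (3 * (r : ℝ) ^ 2 * x * a)) * (Real.exp (K * (κ * (r * m))) * K *
          ((r : ℝ) ^ 4 * (s * r + x * (√(m : ℝ))⁻¹ * r ^ 2) + ρ)) +
        Real.exp (3 * (r : ℝ) ^ 2 * x * a) * ((stdGauss (Fin r × Fin m)).real Sᶜ +
          r * m * (K * (√(r : ℝ) * s) ^ 3 + (s ^ 2 * (6 + 9 * r)) ^ 2)) := by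
  obtain ⟨K1, hK1, H1⟩ := exists_moment_fluct
  obtain ⟨K2, hK2, H2⟩ := exists_moment_quartic
  obtain ⟨K3, hK3, H3⟩ := exists_integral_quarticMaj_le
  obtain ⟨K4, hK4, H4⟩ := exists_norm_charFun_cubic_sub_le
  refine ⟨6 * (K1 + K2 + 3) + K3 + K4, by linarith, ?_⟩
  intro r m hr hm a b s x ρ κ L ha hb hs hx hρ hκ hL S hS g hg hgS
  set μ := stdGauss (Fin r × Fin m) with hμ
  set q0 : ℝ := 3 * (r : ℝ) ^ 2 * x * a with hq0
  set K := 6 * (K1 + K2 + 3) + K3 + K4 with hK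
  have hr1 : (1 : ℝ) ≤ r := by exact_mod_cast Nat.one_le_iff_ne_zero.2 hr
  have hm1 : (1 : ℝ) ≤ m := by exact_mod_cast Nat.one_le_iff_ne_zero.2 hm
  set Ψ : (Fin r × Fin m → ℝ) → ℝ := fun h => ∑ p, (h p ^ 3 + (3 * √(r : ℝ) - 3) * h p) with hΨ
  set k : ℝ := 2 * s * r + 6 * x * (√(m : ℝ))⁻¹ * r ^ 2 with hk
  have hk0 : 0 ≤ k := by positivity
  have cΨ : Continuous Ψ := by fun_prop
  set g0 : (Fin r × Fin m → ℝ) → ℂ := fun h =>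
    Complex.exp ((((-(b * s)) * Ψ h : ℝ) : ℂ) * Complex.I + (q0 : ℂ)) with hg0
  have cg0 : Continuous g0 := by fun_prop
  have ng0 : ∀ h, ‖g0 h‖ = Real.exp q0 := fun h => by
    rw [hg0]; simp only [Complex.norm_exp]; simp
  set D := Real.exp ρ + Real.exp q0 with hD
  have hD0 : 0 ≤ D := by positivity
  set V := quarticMaj (ι := Fin r × Fin m) κ with hV
  set dom : (Fin r × Fin m → ℝ) → ℝ := fun h =>
    D * (k * (((r : ℝ) ^ 4)⁻¹ * fluct h ^ 8 + ((r : ℝ) ^ 4 + 1) * V h +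
      |linStat (fun x => x ^ 4 - 3) h| ^ 2) + ρ * V h) with hdom
  have point : ∀ h ∈ S, ‖g h - g0 h‖ ≤ dom h := by
    intro h hh
    obtain ⟨h1, h2, z, h3, h4⟩ := hgS h hh
    set S3 := (∑ e, edgeSum r m (shrink h) e ^ 3) / (m : ℝ) ^ r
    set S4 := (∑ e, edgeSum r m (shrink h) e ^ 4) / (m : ℝ) ^ r
    have hM : (1 : ℝ) ≤ Real.exp (κ * ∑ p, h p ^ 4) := Real.one_le_exp (by positivity)
    have a3 := abs_edge_cube_sub_le hr hm h
    have a4 := abs_edge_four_sub_le hr hm h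
    rw [h4]
    refine norm_exp_sub_exp_le_of_majorant hk0 (by positivity) hρ hD0 hM
      (exp_sum_four_sq_le hκ hL h1) (abs_nonneg _) ?_ ?_
    · have e : -Complex.I * ((b * (s * (m * S3)) : ℝ) : ℂ) + ((a * (x * S4) : ℝ) : ℂ) + z -
          ((((-(b * s)) * Ψ h : ℝ) : ℂ) * Complex.I + (q0 : ℂ)) =
          -Complex.I * ((b * (s * (m * S3 - Ψ h)) : ℝ) : ℂ) +
            ((a * (x * (S4 - 3 * (r : ℝ) ^ 2)) : ℝ) : ℂ) + z := by
        rw [hq0]; push_cast; ring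
      rw [e]
      have n1 : ‖-Complex.I * ((b * (s * (m * S3 - Ψ h)) : ℝ) : ℂ)‖ ≤
          1 / 6 * (s * (12 * r * fluct h ^ 4)) := by
        rw [norm_mul, norm_neg, Complex.norm_I, one_mul, Complex.norm_real, Real.norm_eq_abs]
        exact abs_mul_le_mul hb (abs_mul_le_mul (abs_of_nonneg hs).le a3)
      have n2 : ‖((a * (x * (S4 - 3 * (r : ℝ) ^ 2)) : ℝ) : ℂ)‖ ≤
          1 / 24 * (x * (130 * (√(m : ℝ))⁻¹ * (r : ℝ) ^ 2 *
            (fluct h ^ 4 + |linStat (fun x => x ^ 4 - 3) h|))) := by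
        rw [Complex.norm_real, Real.norm_eq_abs]
        exact abs_mul_le_mul ha (abs_mul_le_mul (abs_of_nonneg hx).le a4)
      have n3 := norm_add₃_le (a := -Complex.I * ((b * (s * (m * S3 - Ψ h)) : ℝ) : ℂ))
        (b := ((a * (x * (S4 - 3 * (r : ℝ) ^ 2)) : ℝ) : ℂ)) (c := z)
      refine n3.trans ?_
      have e1 : 0 ≤ x * (√(m : ℝ))⁻¹ * (r : ℝ) ^ 2 *
            (fluct h ^ 4 + |linStat (fun x => x ^ 4 - 3) h|) := by positivity
      have e2 : 0 ≤ s * r * |linStat (fun x => x ^ 4 - 3) h| := by positivity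
      rw [hk]
      linarith
    · have r1 : (-Complex.I * ((b * (s * (m * S3)) : ℝ) : ℂ) + ((a * (x * S4) : ℝ) : ℂ) + z).re =
          a * (x * S4) + z.re := by simp
      have r2 : ((((-(b * s)) * Ψ h : ℝ) : ℂ) * Complex.I + (q0 : ℂ)).re = q0 := by simp
      rw [r1, r2, hD, add_mul]
      refine add_le_add ?_ (le_mul_of_one_le_right (Real.exp_pos _).le hM)
      rw [← Real.exp_add]
      refine Real.exp_le_exp.2 ?_
      linarith [(Complex.re_le_norm z).trans h3]
  have hV0 : ∀ h, 0 ≤ V h := fun h => Finset.prod_nonneg fun p _ => by positivity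
  have hVI : 0 ≤ ∫ h, V h ∂μ := integral_nonneg hV0
  obtain ⟨I1, J1⟩ := H1 r m hr hm
  obtain ⟨I2, J2⟩ := H2 r m hr hm
  obtain ⟨I3, J3⟩ := H3 (Fin r × Fin m) κ hκ
  simp only [Fintype.card_prod, Fintype.card_fin, Nat.cast_mul] at J3
  have I2b : Integrable (fun h => |linStat (fun x => x ^ 4 - 3) h| ^ 2) μ := by
    simpa only [sq_abs] using I2
  have A1 : Integrable (fun h => ((r : ℝ) ^ 4)⁻¹ * fluct h ^ 8) μ := I1.const_mul _
  have A2 : Integrable (fun h => ((r : ℝ) ^ 4 + 1) * V h) μ := I3.const_mul _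
  have A12 : Integrable (fun h => ((r : ℝ) ^ 4)⁻¹ * fluct h ^ 8 + ((r : ℝ) ^ 4 + 1) * V h) μ :=
    A1.add A2
  have A3 : Integrable (fun h => ((r : ℝ) ^ 4)⁻¹ * fluct h ^ 8 + ((r : ℝ) ^ 4 + 1) * V h +
      |linStat (fun x => x ^ 4 - 3) h| ^ 2) μ := A12.add I2b
  have A4 : Integrable (fun h => k * (((r : ℝ) ^ 4)⁻¹ * fluct h ^ 8 + ((r : ℝ) ^ 4 + 1) * V h +
      |linStat (fun x => x ^ 4 - 3) h| ^ 2)) μ := A3.const_mul _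
  have A5 : Integrable (fun h => ρ * V h) μ := I3.const_mul _
  have A6 : Integrable (fun h => k * (((r : ℝ) ^ 4)⁻¹ * fluct h ^ 8 + ((r : ℝ) ^ 4 + 1) * V h +
      |linStat (fun x => x ^ 4 - 3) h| ^ 2) + ρ * V h) μ := A4.add A5
  have A7 : Integrable dom μ := A6.const_mul _
  set E := Real.exp (K3 * (κ * (r * m))) with hE
  have hE1 : 1 ≤ E := Real.one_le_exp (by positivity)
  have domI : ∫ h, dom h ∂μ ≤ D * (Real.exp (K * (κ * (r * m))) * K *
      ((r : ℝ) ^ 4 * (s * r + x * (√(m : ℝ))⁻¹ * r ^ 2) + ρ)) := by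
    have J2b : ∫ h, |linStat (fun x => x ^ 4 - 3) h| ^ 2 ∂μ ≤ K2 := by
      simpa only [sq_abs] using J2
    rw [hdom, integral_const_mul, integral_add A4 A5, integral_const_mul, integral_const_mul,
      integral_add A12 I2b, integral_add A1 A2, integral_const_mul, integral_const_mul]
    have r4 : 1 ≤ (r : ℝ) ^ 4 := one_le_pow₀ hr1
    have b1 : ((r : ℝ) ^ 4)⁻¹ * ∫ h, fluct h ^ 8 ∂μ ≤ K1 * r ^ 4 := by
      calc _ ≤ ((r : ℝ) ^ 4)⁻¹ * (K1 * r ^ 8) := by gcongr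
        _ = _ := by field_simp
    have b2 : ((r : ℝ) ^ 4)⁻¹ * ∫ h, fluct h ^ 8 ∂μ + ((r : ℝ) ^ 4 + 1) * ∫ h, V h ∂μ +
        ∫ h, |linStat (fun x => x ^ 4 - 3) h| ^ 2 ∂μ ≤ (K1 + K2 + 2) * (r ^ 4 * E) := by
      have c1 : K1 * (r : ℝ) ^ 4 * 1 ≤ K1 * r ^ 4 * E := by gcongr
      have c2 : ((r : ℝ) ^ 4 + 1) * ∫ h, V h ∂μ ≤ ((r : ℝ) ^ 4 + r ^ 4) * E := by gcongr
      have c3 : K2 * (1 * 1) ≤ K2 * ((r : ℝ) ^ 4 * E) := by gcongr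
      linarith
    have eK : E ≤ Real.exp (K * (κ * (r * m))) := by
      refine Real.exp_le_exp.2 ?_
      have : K3 ≤ K := by rw [hK]; linarith
      gcongr
    have hk6 : k ≤ 6 * (s * r + x * (√(m : ℝ))⁻¹ * r ^ 2) := by
      have : 0 ≤ s * r := by positivity
      rw [hk]; linarith
    have hKK : 6 * (K1 + K2 + 2) ≤ K := by rw [hK]; linarith
    have hK1' : 1 ≤ K := by rw [hK]; linarith
    refine mul_le_mul_of_nonneg_left ?_ hD0
    calc _ ≤ 6 * (s * r + x * (√(m : ℝ))⁻¹ * r ^ 2) * ((K1 + K2 + 2) * (r ^ 4 * E)) + ρ * E := by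
          gcongr
      _ = 6 * (K1 + K2 + 2) * (E * ((r : ℝ) ^ 4 * (s * r + x * (√(m : ℝ))⁻¹ * r ^ 2))) +
          1 * (E * ρ) := by ring
      _ ≤ K * (E * ((r : ℝ) ^ 4 * (s * r + x * (√(m : ℝ))⁻¹ * r ^ 2))) + K * (E * ρ) := by
          gcongr
      _ = E * (K * ((r : ℝ) ^ 4 * (s * r + x * (√(m : ℝ))⁻¹ * r ^ 2) + ρ)) := by ring
      _ ≤ Real.exp (K * (κ * (r * m))) * (K *
          ((r : ℝ) ^ 4 * (s * r + x * (√(m : ℝ))⁻¹ * r ^ 2) + ρ)) := by gcongr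
      _ = _ := by ring
  have ig0 : Integrable g0 μ := (integrable_const (Real.exp q0)).mono'
    cg0.aestronglyMeasurable (ae_of_all _ fun h => (ng0 h).le)
  have idiff : IntegrableOn (fun h => g h - g0 h) S μ :=
    A7.integrableOn.mono' (hg.sub cg0).aestronglyMeasurable
      ((ae_restrict_mem hS).mono point)
  have ig : IntegrableOn g S μ := by
    have := idiff.add ig0.integrableOn
    refine this.congr (ae_of_all _ fun h => ?_)
    simp
  have T1 : ‖(∫ h in S, g h ∂μ) - ∫ h in S, g0 h ∂μ‖ ≤ ∫ h, dom h ∂μ := by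
    rw [← integral_sub ig ig0.integrableOn]
    refine (norm_integral_le_of_norm_le A7.integrableOn
      ((ae_restrict_mem hS).mono point)).trans ?_
    refine setIntegral_le_integral A7 (ae_of_all _ fun h => ?_)
    have := hV0 h
    simp only [hdom, Pi.zero_apply]
    positivity
  have T2 : ‖(∫ h in S, g0 h ∂μ) - ∫ h, g0 h ∂μ‖ ≤ Real.exp q0 * μ.real Sᶜ := by
    rw [← integral_add_compl hS ig0, sub_add_cancel_left, norm_neg]
    exact norm_setIntegral_le_of_norm_le_const (measure_lt_top _ _) fun h _ => (ng0 h).le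
  have T3 : ‖(∫ h, g0 h ∂μ) - ((Real.exp (q0 - r * m * ((b * s) ^ 2 * (6 + 9 * r) / 2)) : ℝ)
      : ℂ)‖ ≤ Real.exp q0 *
        (r * m * (K * (√(r : ℝ) * s) ^ 3 + (s ^ 2 * (6 + 9 * r)) ^ 2)) := by
    have hq : 1 ≤ √(r : ℝ) := Real.one_le_sqrt.2 hr1
    have h := H4 (Fin r × Fin m) (√(r : ℝ)) (-(b * s)) hq
    simp only [Fintype.card_prod, Fintype.card_fin, Nat.cast_mul, neg_sq, abs_neg,
      Real.sq_sqrt (zero_le_one.trans hr1)] at h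
    have e1 : ∫ h, g0 h ∂μ = ((Real.exp q0 : ℝ) : ℂ) *
        ∫ h, Complex.exp (((-(b * s) * Ψ h : ℝ) : ℂ) * Complex.I) ∂μ := by
      rw [← integral_const_mul]
      refine integral_congr_ae (ae_of_all _ fun h => ?_)
      simp only [hg0]
      rw [Complex.exp_add, Complex.ofReal_exp, mul_comm]
    rw [e1, sub_eq_add_neg q0, Real.exp_add, Complex.ofReal_mul, ← mul_sub, norm_mul,
      Complex.norm_real, Real.norm_eq_abs, abs_of_pos (Real.exp_pos _)]
    refine mul_le_mul_of_nonneg_left (h.trans ?_) (Real.exp_pos _).le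
    have hbs : |b * s| ≤ s := by
      rw [abs_mul, abs_of_nonneg hs]
      nlinarith [abs_nonneg b]
    have hbs2 : (b * s) ^ 2 ≤ s ^ 2 := sq_le_sq' (abs_le.1 hbs).1 (abs_le.1 hbs).2
    have hK4 : K4 ≤ K := by rw [hK]; linarith
    have hh : (b * s) ^ 2 * (6 + 9 * (r : ℝ)) / 2 ≤ s ^ 2 * (6 + 9 * r) := by
      have : (b * s) ^ 2 * (6 + 9 * (r : ℝ)) ≤ s ^ 2 * (6 + 9 * r) := by gcongr
      have : 0 ≤ s ^ 2 * (6 + 9 * (r : ℝ)) := by positivity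
      linarith
    gcongr
  have T := (norm_sub_le_norm_sub_add_norm_sub (∫ h in S, g h ∂μ) (∫ h in S, g0 h ∂μ)
    ((Real.exp (q0 - r * m * ((b * s) ^ 2 * (6 + 9 * r) / 2)) : ℝ) : ℂ)).trans
    (add_le_add le_rfl (norm_sub_le_norm_sub_add_norm_sub _ (∫ h, g0 h ∂μ) _))
  exact T.trans ((add_le_add (T1.trans domI) (add_le_add T2 T3)).trans_eq (by ring))
end

/-- Powers of `log n` are absorbed by the gap between `n^(-1/2)` and `n^(-2/5)`. -/
lemma log_pow_div_sqrt_le {n : ℝ} (hn : 1 ≤ n) :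
    (√n)⁻¹ ≤ n ^ (-(2 : ℝ) / 5) ∧ n⁻¹ ≤ n ^ (-(2 : ℝ) / 5) ∧
      Real.log n * (√n)⁻¹ ≤ 50 * n ^ (-(2 : ℝ) / 5) ∧
      Real.log n ^ 2 * n⁻¹ ≤ 2500 * n ^ (-(2 : ℝ) / 5) ∧
      Real.log n ^ 5 * (√n)⁻¹ ≤ 312500000 * n ^ (-(2 : ℝ) / 5) := by
  have hn0 : 0 < n := by linarith
  have hl0 : 0 ≤ Real.log n := Real.log_nonneg hn
  have hl : Real.log n ≤ 50 * n ^ ((1 : ℝ) / 50) := by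
    have := Real.log_le_rpow_div hn0.le (by norm_num : (0 : ℝ) < 1 / 50)
    linarith
  have e1 : (√n)⁻¹ = n ^ (-(1 : ℝ) / 2) := by
    rw [Real.sqrt_eq_rpow, ← Real.rpow_neg hn0.le]; norm_num
  have e2 : n⁻¹ = n ^ (-(1 : ℝ)) := by rw [Real.rpow_neg_one]
  have mono : ∀ {p : ℝ}, p ≤ -(2 : ℝ) / 5 → n ^ p ≤ n ^ (-(2 : ℝ) / 5) :=
    fun hp => Real.rpow_le_rpow_of_exponent_le hn hp
  have pw : ∀ k : ℕ, Real.log n ^ k ≤ 50 ^ k * n ^ ((k : ℝ) / 50) := fun k => by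
    calc Real.log n ^ k ≤ (50 * n ^ ((1 : ℝ) / 50)) ^ k := pow_le_pow_left₀ hl0 hl k
      _ = _ := by
        rw [mul_pow, ← Real.rpow_natCast (n ^ ((1 : ℝ) / 50)), ← Real.rpow_mul hn0.le]
        ring_nf
  have key : ∀ (k : ℕ) (p : ℝ), (k : ℝ) / 50 + p ≤ -(2 : ℝ) / 5 →
      Real.log n ^ k * n ^ p ≤ 50 ^ k * n ^ (-(2 : ℝ) / 5) := fun k p hp => by
    calc Real.log n ^ k * n ^ p ≤ 50 ^ k * n ^ ((k : ℝ) / 50) * n ^ p := by gcongr; exact pw k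
      _ = 50 ^ k * n ^ ((k : ℝ) / 50 + p) := by rw [Real.rpow_add hn0]; ring
      _ ≤ _ := by gcongr
  rw [e1, e2]
  refine ⟨mono (by norm_num), mono (by norm_num), ?_, ?_, ?_⟩
  · simpa using key 1 (-(1 : ℝ) / 2) (by norm_num)
  · refine (key 2 (-1) (by norm_num)).trans_eq (by norm_num)
  · refine (key 5 (-(1 : ℝ) / 2) (by norm_num)).trans_eq (by norm_num)

/-- The size of the error terms once the scale `s` satisfies `s r^8 √m ≤ γ`. -/
lemma scale_error_bounds {R M s x γ : ℝ} (hR : 1 ≤ R) (hM : 1 ≤ M) (hs : 0 < s)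
    (hx : x = M * s ^ 2) (h : s * R ^ 8 * √M ≤ γ) :
    x * R ^ 16 ≤ γ ^ 2 ∧ s * R ^ 7 ≤ γ * (√(R * M))⁻¹ ∧
      R ^ 4 * (s * R + x * (√M)⁻¹ * R ^ 2) ≤ (γ + γ ^ 2) * (√(R * M))⁻¹ ∧
      x * s * R ^ 18 ≤ γ ^ 3 * (√(R * M))⁻¹ ∧
      R * M * (s ^ 2 * (6 + 9 * R)) ^ 2 ≤ 225 * γ ^ 4 * (√(R * M))⁻¹ ∧
      R * M * (√R * s) ^ 3 ≤ γ ^ 3 * (√(R * M))⁻¹ := by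
  have hM0 : 0 < M := by linarith
  have hR0 : 0 < R := by linarith
  have hx0 : 0 < x := by rw [hx]; positivity
  have hγ : 0 < γ := lt_of_lt_of_le (by positivity) h
  set w := (√(R * M))⁻¹ with hw
  have hw0 : 0 < w := by positivity
  have hw1 : w ≤ 1 := inv_le_one_of_one_le₀ (Real.one_le_sqrt.2 (by nlinarith))
  have hsR : √R ≤ R := by
    rw [Real.sqrt_le_left hR0.le]; nlinarith
  have hsR1 : 1 ≤ √R := Real.one_le_sqrt.2 hR
  have hv : (√M)⁻¹ ≤ R * w := by
    rw [hw, Real.sqrt_mul hR0.le, _root_.mul_inv_rev]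
    have : 1 ≤ R * (√R)⁻¹ := by
      rw [← div_eq_mul_inv, one_le_div (by positivity)]; exact hsR
    calc (√M)⁻¹ = (√M)⁻¹ * 1 := by ring
      _ ≤ (√M)⁻¹ * (R * (√R)⁻¹) := by gcongr
      _ = _ := by ring
  have h1 : x * R ^ 16 ≤ γ ^ 2 := by
    calc x * R ^ 16 = (s * R ^ 8 * √M) ^ 2 := by
          rw [hx, mul_pow, Real.sq_sqrt hM0.le]; ring
      _ ≤ γ ^ 2 := by gcongr
  have h2 : s * R ^ 7 ≤ γ * w := by
    have : s * R ^ 8 ≤ γ * (√M)⁻¹ := by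
      rw [← div_eq_mul_inv, le_div_iff₀ (by positivity)]; exact h
    have h3 : s * R ^ 7 * R ≤ γ * w * R := by
      calc s * R ^ 7 * R = s * R ^ 8 := by ring
        _ ≤ γ * (√M)⁻¹ := this
        _ ≤ γ * (R * w) := by gcongr
        _ = _ := by ring
    exact le_of_mul_le_mul_right h3 hR0
  have h18 : x * s * R ^ 18 ≤ γ ^ 3 * w := by
    calc x * s * R ^ 18 ≤ x * s * R ^ 23 := by gcongr; norm_num
      _ = (x * R ^ 16) * (s * R ^ 7) := by ring
      _ ≤ γ ^ 2 * (γ * w) := by gcongr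
      _ = _ := by ring
  refine ⟨h1, h2, ?_, h18, ?_, ?_⟩
  · have a1 : s * R ^ 5 ≤ γ * w := (by gcongr; norm_num : s * R ^ 5 ≤ s * R ^ 7).trans h2
    have a2 : x * (√M)⁻¹ * R ^ 6 ≤ γ ^ 2 * w := by
      calc x * (√M)⁻¹ * R ^ 6 ≤ x * (R * w) * R ^ 6 := by gcongr
        _ = x * R ^ 7 * w := by ring
        _ ≤ x * R ^ 16 * w := by gcongr; norm_num
        _ ≤ _ := by gcongr
    calc _ = s * R ^ 5 + x * (√M)⁻¹ * R ^ 6 := by ring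
      _ ≤ γ * w + γ ^ 2 * w := add_le_add a1 a2
      _ = _ := by ring
  · calc R * M * (s ^ 2 * (6 + 9 * R)) ^ 2 ≤ R * M * (s ^ 2 * (6 * R + 9 * R)) ^ 2 := by
          gcongr; linarith
      _ = 225 * (x * s ^ 2 * R ^ 3) := by rw [hx]; ring
      _ ≤ 225 * (x * s ^ 2 * R ^ 30) := by gcongr; norm_num
      _ = 225 * ((x * R ^ 16) * (s * R ^ 7) ^ 2) := by ring
      _ ≤ 225 * (γ ^ 2 * (γ * w) ^ 2) := by gcongr
      _ = 225 * γ ^ 4 * w * w := by ring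
      _ ≤ 225 * γ ^ 4 * w * 1 := by gcongr
      _ = _ := by ring
  · calc R * M * (√R * s) ^ 3 ≤ R * M * (R * s) ^ 3 := by gcongr
      _ = x * s * R ^ 4 := by rw [hx]; ring
      _ ≤ x * s * R ^ 18 := by gcongr; norm_num
      _ ≤ _ := h18

/-- The basic parameters: `0 < λ < 1`, and the scale `s = (Λ m^(r-1))^(-1/2)`. -/
lemma scale_facts {c : ℝ} (hc : 0 < c) {r m d : ℕ} (hr : 3 ≤ r) (hm : 1 ≤ m) (hd : 1 ≤ d)
    (hd2 : d ≤ m ^ (r - 1) - 1)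
    (h : c * (r : ℝ) ^ 16 * (m : ℝ) ^ ((2 : ℤ) - (r : ℤ)) ≤ Lam r m d) :
    0 ≤ lam r m d ∧ lam r m d ≤ 1 ∧ 0 < Lam r m d ∧ Lam r m d ≤ 1 / 4 ∧
      0 < (√(Lam r m d * (m : ℝ) ^ (r - 1)))⁻¹ ∧
      (√(Lam r m d * (m : ℝ) ^ (r - 1)))⁻¹ ^ 2 * (Lam r m d * (m : ℝ) ^ (r - 1)) = 1 ∧
      (√(Lam r m d * (m : ℝ) ^ (r - 1)))⁻¹ * (r : ℝ) ^ 8 * √(m : ℝ) ≤ (√c)⁻¹ ∧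
      c * (r : ℝ) ^ 16 ≤ Lam r m d * (m : ℝ) ^ (r - 2) := by
  have hm0 : (0 : ℝ) < m := by exact_mod_cast hm
  have hr0 : (0 : ℝ) < r := by exact_mod_cast (by omega : 0 < r)
  have hp : (0 : ℝ) < (m : ℝ) ^ (r - 1) := by positivity
  have hl0 : 0 ≤ lam r m d := by unfold lam; positivity
  have hl1 : lam r m d ≤ 1 := by
    unfold lam
    rw [div_le_one hp]
    exact_mod_cast hd2.trans (Nat.sub_le _ _)
  have hL : 0 < Lam r m d := lt_of_lt_of_le (by positivity) h
  have hL4 : Lam r m d ≤ 1 / 4 := by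
    unfold Lam; nlinarith [sq_nonneg (lam r m d - 1 / 2)]
  have hz : (m : ℝ) ^ ((2 : ℤ) - (r : ℤ)) = ((m : ℝ) ^ (r - 2))⁻¹ := by
    rw [← zpow_natCast, ← _root_.zpow_neg]
    congr 1
    omega
  have hk : c * (r : ℝ) ^ 16 ≤ Lam r m d * (m : ℝ) ^ (r - 2) := by
    rw [hz, ← div_eq_mul_inv, div_le_iff₀ (by positivity)] at h
    exact h
  have hpos : 0 < Lam r m d * (m : ℝ) ^ (r - 1) := by positivity
  refine ⟨hl0, hl1, hL, hL4, by positivity, ?_, ?_, hk⟩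
  · rw [inv_pow, Real.sq_sqrt hpos.le]
    exact inv_mul_cancel₀ hpos.ne'
  · have e : (m : ℝ) ^ (r - 1) = (m : ℝ) ^ (r - 2) * m := by
      rw [← pow_succ]; congr 1; omega
    rw [mul_assoc, inv_mul_le_iff₀ (by positivity), ← div_eq_mul_inv, le_div_iff₀ (by positivity)]
    refine Real.le_sqrt_of_sq_le ?_
    rw [mul_pow, mul_pow, Real.sq_sqrt hm0.le, Real.sq_sqrt hc.le, e]
    calc ((r : ℝ) ^ 8) ^ 2 * m * c = c * (r : ℝ) ^ 16 * m := by ring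
      _ ≤ Lam r m d * (m : ℝ) ^ (r - 2) * m := by gcongr
      _ = _ := by ring

/-- The quadratic correction `r² m^(2-r)` is negligible. -/
lemma sq_div_pow_le {c : ℝ} (hc : 0 < c) {r m : ℕ} (hr : 3 ≤ r) (hm : 1 ≤ m) {Λ : ℝ}
    (hΛ : Λ ≤ 1 / 4) (h : c * (r : ℝ) ^ 16 ≤ Λ * (m : ℝ) ^ (r - 2)) :
    (r : ℝ) ^ 2 * ((m : ℝ) ^ (r - 2))⁻¹ ≤ (27 + (√c)⁻¹) * ((r : ℝ) * m)⁻¹ := by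
  have hm1 : (1 : ℝ) ≤ m := by exact_mod_cast hm
  have hm0 : (0 : ℝ) < m := by linarith
  have hr1 : (1 : ℝ) ≤ r := by exact_mod_cast (by omega : 1 ≤ r)
  have hγ : 0 < (√c)⁻¹ := by positivity
  rcases hr.eq_or_lt with h3 | h4
  · subst h3
    norm_num
    have : (0 : ℝ) < (m : ℝ)⁻¹ := by positivity
    nlinarith
  · set P := (m : ℝ) ^ (r - 2) with hP
    have hP0 : 0 < P := by positivity
    have h1 : (m : ℝ) ^ 2 ≤ P := pow_le_pow_right₀ hm1 (by omega)
    have h2 : c * (r : ℝ) ^ 16 ≤ P := h.trans (by nlinarith)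
    have h5 : √c * (r : ℝ) ^ 8 * m ≤ P := by
      have e : (√c * (r : ℝ) ^ 8 * m) ^ 2 = (c * (r : ℝ) ^ 16) * (m : ℝ) ^ 2 := by
        rw [mul_pow, mul_pow, Real.sq_sqrt hc.le]; ring
      refine le_of_sq_le_sq ?_ hP0.le
      rw [e, sq P]
      gcongr
    have h6 : (r : ℝ) ^ 2 * P⁻¹ ≤ (√c)⁻¹ * ((r : ℝ) * m)⁻¹ := by
      rw [← div_eq_mul_inv, ← _root_.mul_inv_rev, ← one_div, div_le_div_iff₀ hP0 (by positivity)]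
      calc (r : ℝ) ^ 2 * (r * m * √c) = √c * (r : ℝ) ^ 3 * m := by ring
        _ ≤ √c * (r : ℝ) ^ 8 * m := by gcongr; norm_num
        _ ≤ 1 * P := by rw [one_mul]; exact h5
    refine h6.trans ?_
    gcongr
    linarith

lemma continuous_integrand (r m d : ℕ) :
    Continuous fun θ => Ffun r m d θ * Complex.exp (-((qW r m d θ : ℝ) : ℂ)) := by
  have h1 : Continuous (qW r m d) := by
    unfold qW mulVec dotProduct
    fun_prop
  have h2 : Continuous (Ffun r m d) := by
    unfold Ffun edgeSum
    fun_prop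
  fun_prop

lemma rho0_eq (r m d : ℕ) : rho0 r m d =
    √(r : ℝ) ^ 5 * Real.log ((r : ℝ) * m) * (√(Lam r m d * (m : ℝ) ^ (r - 1)))⁻¹ := by
  have : (r : ℝ) ^ ((5 : ℝ) / 2) = √(r : ℝ) ^ 5 := by
    rw [Real.sqrt_eq_rpow, ← Real.rpow_natCast, ← Real.rpow_mul (Nat.cast_nonneg r)]
    norm_num
  rw [rho0, this, div_eq_mul_inv]

lemma abs_edgeSum_le {r m : ℕ} {θ : Fin r × Fin m → ℝ} {B : ℝ} (h : ∀ p, |θ p| ≤ B)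
    (e : Fin r → Fin m) : |edgeSum r m θ e| ≤ r * B := by
  refine (Finset.abs_sum_le_sum_abs _ _).trans ?_
  refine (Finset.sum_le_sum fun t _ => h (t, e t)).trans ?_
  simp

lemma Lam_mul_sum_edge_pow {r m : ℕ} (hr : r ≠ 0) (hm : m ≠ 0) {Λ s : ℝ}
    (hs : s ^ 2 * (Λ * (m : ℝ) ^ (r - 1)) = 1) (θ : Fin r × Fin m → ℝ) (k : ℕ) :
    Λ * ∑ e, (s * edgeSum r m θ e) ^ (k + 2) =
      s ^ k * (m * ((∑ e, edgeSum r m θ e ^ (k + 2)) / (m : ℝ) ^ r)) := by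
  have hm0 : (m : ℝ) ≠ 0 := by exact_mod_cast hm
  have e : (m : ℝ) ^ r = (m : ℝ) ^ (r - 1) * m := by
    rw [← pow_succ]; congr 1; omega
  simp only [mul_pow, ← Finset.mul_sum]
  rw [e]
  field_simp
  rw [pow_add]
  linear_combination (s ^ k * ∑ e, edgeSum r m θ e ^ (k + 2)) * hs

/-- Extraction of the exponent from a multiplicative approximation. -/
lemma exists_exp_eq_of_norm_sub_le {I : ℂ} {u ε η : ℝ}
    (h : ‖I - ((Real.exp (u + ε) : ℝ) : ℂ)‖ ≤ η) (hε : |ε| ≤ 1)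
    (hs : η * Real.exp (-u) + 2 * |ε| ≤ 1 / 2) :
    ∃ δ : ℂ, ‖δ‖ ≤ 2 * (η * Real.exp (-u) + 2 * |ε|) ∧ I = Complex.exp ((u : ℂ) + δ) := by
  set z : ℂ := I * ((Real.exp (-u) : ℝ) : ℂ) - 1 with hz
  have hzn : ‖z‖ ≤ η * Real.exp (-u) + 2 * |ε| := by
    have e : z = (I - ((Real.exp (u + ε) : ℝ) : ℂ)) * ((Real.exp (-u) : ℝ) : ℂ) +
        ((Real.exp ε - 1 : ℝ) : ℂ) := by
      have e2 : Real.exp ε = Real.exp (u + ε) * Real.exp (-u) := by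
        rw [← Real.exp_add]; ring_nf
      rw [hz, e2]
      push_cast
      ring
    rw [e]
    refine (norm_add_le _ _).trans (add_le_add ?_ ?_)
    · rw [norm_mul, Complex.norm_real, Real.norm_eq_abs, abs_of_pos (Real.exp_pos _)]
      gcongr
    · rw [Complex.norm_real, Real.norm_eq_abs]
      exact Real.abs_exp_sub_one_le hε
  have hz2 : ‖z‖ ≤ 1 / 2 := hzn.trans hs
  refine ⟨Complex.log (1 + z), ?_, ?_⟩
  · have := Complex.norm_log_one_add_half_le_self hz2
    linarith [norm_nonneg z]
  · have hne : 1 + z ≠ 0 := by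
      intro h0
      have : z = -1 := by linear_combination h0
      rw [this] at hz2
      norm_num at hz2
    have e3 : ((Real.exp (-u) : ℝ) : ℂ) = Complex.exp (-(u : ℂ)) := by push_cast; rfl
    rw [Complex.exp_add, Complex.exp_log hne, hz, e3, add_sub_cancel, mul_left_comm,
      ← Complex.exp_add]
    simp

/-- The quadratic exponents combine to `-r x / 12`, up to a term of size `Λ x r²`. -/
lemma exponent_eq {r m : ℕ} {Λ l s x : ℝ} (hΛ : Λ = l * (1 - l)) (hx : x = m * s ^ 2) :
    3 * (r : ℝ) ^ 2 * x * ((1 - 6 * Λ) / 24) -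
      r * m * (((1 - 2 * l) / 6 * s) ^ 2 * (6 + 9 * r) / 2) =
    -(r * x / 12) + Λ * x * (r / 3 - (r : ℝ) ^ 2 / 4) := by
  rw [hx, hΛ]; ring

/-- Inside the box, the integrand is the exponential of its cubic and quartic terms up to a small
remainder, and the quartic term is dominated by `κ ∑ h⁴`. -/
lemma integrand_on_box {r m d : ℕ} (hr : 3 ≤ r) (hm : 1 ≤ m) (hl0 : 0 ≤ lam r m d)
    (hl1 : lam r m d ≤ 1) (hΛ : 0 < Lam r m d) {s x κ : ℝ} (hs0 : 0 < s)
    (hs : s ^ 2 * (Lam r m d * (m : ℝ) ^ (r - 1)) = 1) (hx : x = m * s ^ 2)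
    (hρ0 : rho0 r m d = √(r : ℝ) ^ 5 * Real.log ((r : ℝ) * m) * s)
    (hκ : x * (r : ℝ) ^ 3 / m ≤ κ) (hB : 4 * (Real.log ((r : ℝ) * m) * (s * (r : ℝ) ^ 7)) ≤ 1)
    {h : Fin r × Fin m → ℝ} (hh : s • shrink h ∈ Uball r m (4 * rho0 r m d)) :
    (∀ p, |h p| ≤ 4 * (r : ℝ) ^ 3 * Real.log ((r : ℝ) * m)) ∧
      (1 - 6 * Lam r m d) / 24 *
        (x * ((∑ e, edgeSum r m (shrink h) e ^ 4) / (m : ℝ) ^ r)) ≤ κ * ∑ p, h p ^ 4 ∧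
      ∃ z : ℂ, ‖z‖ ≤ 266240 * (x * s * (r : ℝ) ^ 18) * Real.log ((r : ℝ) * m) ^ 5 ∧
        Ffun r m d (s • shrink h) * Complex.exp (-((qW r m d (s • shrink h) : ℝ) : ℂ)) =
        ((Real.exp (-(∑ p, h p ^ 2) / 2) : ℝ) : ℂ) * Complex.exp (-Complex.I *
          (((1 - 2 * lam r m d) / 6 *
            (s * (m * ((∑ e, edgeSum r m (shrink h) e ^ 3) / (m : ℝ) ^ r))) : ℝ) : ℂ) +
          (((1 - 6 * Lam r m d) / 24 *
            (x * ((∑ e, edgeSum r m (shrink h) e ^ 4) / (m : ℝ) ^ r)) : ℝ) : ℂ) + z) := by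
  have hr0 : r ≠ 0 := by omega
  have hm0 : m ≠ 0 := by omega
  have hR : (1 : ℝ) ≤ r := by exact_mod_cast (by omega : 1 ≤ r)
  have hM : (1 : ℝ) ≤ m := by exact_mod_cast hm
  have hR0 : (0 : ℝ) < r := by linarith
  have hM0 : (0 : ℝ) < m := by linarith
  set ℓ := Real.log ((r : ℝ) * m) with hℓ
  have hℓ0 : 0 ≤ ℓ := Real.log_nonneg (by nlinarith)
  set q := √(r : ℝ) with hq
  have hq0 : 0 < q := Real.sqrt_pos.2 hR0
  have hqq : q ^ 2 = r := Real.sq_sqrt hR0.le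
  have hqr : q ≤ r := by rw [← hqq]; nlinarith [Real.one_le_sqrt.2 hR]
  have hx0 : 0 < x := by rw [hx]; positivity
  have bd : ∀ p, |shrink h p| ≤ 4 * q ^ 5 * ℓ := fun p => by
    have h1 : |s * shrink h p| ≤ 4 * rho0 r m d := hh p
    rw [hρ0, abs_mul, abs_of_pos hs0] at h1
    refine le_of_mul_le_mul_left (h1.trans_eq ?_) hs0
    ring
  have be : ∀ e, |s * edgeSum r m (shrink h) e| ≤ 4 * (s * r * q ^ 5) * ℓ := fun e => by
    rw [abs_mul, abs_of_pos hs0]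
    calc s * |edgeSum r m (shrink h) e| ≤ s * (r * (4 * q ^ 5 * ℓ)) := by
          gcongr; exact abs_edgeSum_le bd e
      _ = _ := by ring
  have be1 : ∀ e, |s * edgeSum r m (shrink h) e| ≤ 1 := fun e => by
    refine (be e).trans (le_trans ?_ hB)
    have : s * r * q ^ 5 ≤ s * (r : ℝ) ^ 7 := by
      calc s * r * q ^ 5 ≤ s * r * (r : ℝ) ^ 5 := by gcongr
        _ = s * (r : ℝ) ^ 6 := by ring
        _ ≤ s * (r : ℝ) ^ 7 := by gcongr; norm_num
    calc 4 * (s * r * q ^ 5) * ℓ ≤ 4 * (s * (r : ℝ) ^ 7) * ℓ := by gcongr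
      _ = _ := by ring
  refine ⟨fun p => ?_, ?_, ?_⟩
  · refine (abs_le_of_abs_shrink_le hr0 hm0 bd p).trans_eq ?_
    rw [← hq, ← hqq]; ring
  · set S4 := (∑ e, edgeSum r m (shrink h) e ^ 4) / (m : ℝ) ^ r with hS4
    have h0 : 0 ≤ S4 := by positivity
    have h1 : S4 ≤ (r : ℝ) ^ 3 / m * ∑ p, shrink h p ^ 4 := sum_edges_four_le hm0 (shrink h)
    have h2 := sum_shrink_four_le hr0 hm0 h
    have hH : 0 ≤ ∑ p, h p ^ 4 := by positivity
    calc (1 - 6 * Lam r m d) / 24 * (x * S4) ≤ 1 / 24 * (x * S4) := by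
          gcongr; linarith
      _ ≤ 1 / 24 * (x * ((r : ℝ) ^ 3 / m * (16 * ∑ p, h p ^ 4))) := by
          gcongr
          exact h1.trans (by gcongr)
      _ = 2 / 3 * ((x * (r : ℝ) ^ 3 / m) * ∑ p, h p ^ 4) := by ring
      _ ≤ 1 * (κ * ∑ p, h p ^ 4) := by
          gcongr
          norm_num
      _ = _ := one_mul _
  · obtain ⟨z, hz1, hz2⟩ := Ffun_mul_exp_shrink hr0 hm0 hl0 hl1 s hs h be1
    refine ⟨z, hz1.trans ?_, ?_⟩
    · have c1 : ∑ e, |s * edgeSum r m (shrink h) e| ^ 5 ≤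
          (m : ℝ) ^ r * (4 * (s * r * q ^ 5) * ℓ) ^ 5 := by
        refine (Finset.sum_le_sum fun e _ => pow_le_pow_left₀ (abs_nonneg _) (be e) 5).trans ?_
        simp
      have e1 : Lam r m d * (m : ℝ) ^ r * s ^ 2 = m := by
        have e : (m : ℝ) ^ r = (m : ℝ) ^ (r - 1) * m := by
          rw [← pow_succ]; congr 1; omega
        rw [e]; linear_combination (m : ℝ) * hs
      calc 260 * Lam r m d * ∑ e, |s * edgeSum r m (shrink h) e| ^ 5 ≤
            260 * Lam r m d * ((m : ℝ) ^ r * (4 * (s * r * q ^ 5) * ℓ) ^ 5) := by gcongr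
        _ = 266240 * ((Lam r m d * (m : ℝ) ^ r * s ^ 2) * s ^ 3 *
            (r : ℝ) ^ 5 * ((q ^ 2) ^ 12 * q)) * ℓ ^ 5 := by ring
        _ = 266240 * ((x * s) * (r : ℝ) ^ 17 * q) * ℓ ^ 5 := by
            rw [e1, hqq, hx]; ring
        _ ≤ 266240 * ((x * s) * (r : ℝ) ^ 17 * r) * ℓ ^ 5 := by gcongr
        _ = _ := by ring
    · rw [hz2, Lam_mul_sum_edge_pow hr0 hm0 hs (shrink h) 1,
        Lam_mul_sum_edge_pow hr0 hm0 hs (shrink h) 2, pow_one]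
      have : s ^ 2 * ((m : ℝ) * ((∑ e, edgeSum r m (shrink h) e ^ (2 + 2)) / (m : ℝ) ^ r)) =
          x * ((∑ e, edgeSum r m (shrink h) e ^ 4) / (m : ℝ) ^ r) := by rw [hx]; ring
      rw [this]

/-- The complement of the region has small Gaussian measure. -/
lemma exists_measureReal_compl_le : ∃ K : ℝ, 0 < K ∧ ∀ (r m d : ℕ), 3 ≤ r → 1 ≤ m →
    ∀ s : ℝ, 0 < s → rho0 r m d = √(r : ℝ) ^ 5 * Real.log ((r : ℝ) * m) * s →
    ∀ Ω : Set (Fin r × Fin m → ℝ), Uball r m (2 * rho0 r m d / (3 * r)) ⊆ Ω →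
      (stdGauss (Fin r × Fin m)).real {h | s • shrink h ∈ Ω}ᶜ ≤ K * ((r : ℝ) * m)⁻¹ := by
  obtain ⟨K, hK, H⟩ := exists_measureReal_shrink_le
  refine ⟨K, hK, fun r m d hr hm s hs hρ Ω hΩ => ?_⟩
  have hR : (3 : ℝ) ≤ r := by exact_mod_cast hr
  have hM : (1 : ℝ) ≤ m := by exact_mod_cast hm
  have hR0 : (0 : ℝ) < r := by linarith
  have hn : 0 < (r : ℝ) * m := by positivity
  set ℓ := Real.log ((r : ℝ) * m) with hℓ
  have hℓ0 : 0 ≤ ℓ := Real.log_nonneg (by nlinarith)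
  have hsub : {h | s • shrink h ∈ Ω}ᶜ ⊆
      {h : Fin r × Fin m → ℝ | ∃ p, 2 * ℓ < |shrink h p|} := by
    intro h hh
    by_contra hcon
    refine hh (hΩ fun p => ?_)
    have h1 : |shrink h p| ≤ 2 * ℓ := by
      by_contra h2
      exact hcon ⟨p, not_le.1 h2⟩
    have hq : 3 ≤ √(r : ℝ) ^ 3 := by
      have h17 : 1.7 ≤ √(r : ℝ) := Real.le_sqrt_of_sq_le (by norm_num; linarith)
      calc (3 : ℝ) ≤ 1.7 ^ 3 := by norm_num
        _ ≤ _ := by gcongr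
    have e : 2 * rho0 r m d / (3 * r) = s * (2 / 3 * √(r : ℝ) ^ 3 * ℓ) := by
      rw [hρ, div_eq_iff (by positivity)]
      nth_rewrite 3 [← Real.sq_sqrt hR0.le]
      ring
    rw [e]
    calc |(s • shrink h) p| = s * |shrink h p| := by
          rw [Pi.smul_apply, smul_eq_mul, abs_mul, abs_of_pos hs]
      _ ≤ s * (2 / 3 * √(r : ℝ) ^ 3 * ℓ) := by
          gcongr
          refine h1.trans ?_
          nlinarith
  refine (measureReal_mono hsub).trans ((H r m (by omega) (by omega) _).trans_eq ?_)
  have : Real.exp (-(2 * ℓ)) = ((r : ℝ) * m)⁻¹ * ((r : ℝ) * m)⁻¹ := by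
    rw [← Real.exp_log (inv_pos.2 hn), Real.log_inv, ← Real.exp_add, ← hℓ]
    ring_nf
  rw [this]
  field_simp

/-- Numerical consequences of the scale bounds when `n = R M` is large. -/
lemma region_parameter_bounds {R M s x γ C ν : ℝ} (hR : 1 ≤ R) (hM : 1 ≤ M) (hs0 : 0 < s)
    (hx : x = M * s ^ 2) (h : s * R ^ 8 * √M ≤ γ) (hν : ν = (R * M) ^ (-(2 : ℝ) / 5))
    (hC : 320000 * γ ^ 2 ≤ C ∧ 200 * γ ≤ C) (hsmall : C * ν ≤ 1) :
    R ^ 2 * x ≤ γ ^ 2 ∧ x * R ^ 3 / M ≤ γ ^ 2 / (R ^ 6 * (R * M)) ∧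
      4 * (Real.log (R * M) * (s * R ^ 7)) ≤ 1 ∧
      γ ^ 2 / (R ^ 6 * (R * M)) * (4 * R ^ 3 * Real.log (R * M)) ^ 2 ≤ 1 / 8 ∧
      266240 * (x * s * R ^ 18) * Real.log (R * M) ^ 5 ≤ 83200000000000 * γ ^ 3 * ν := by
  have hR0 : 0 < R := by linarith
  have hM0 : 0 < M := by linarith
  have hx0 : 0 < x := by rw [hx]; positivity
  have hγ0 : 0 < γ := lt_of_lt_of_le (by positivity) h
  obtain ⟨b1, b2, -, b4, -, -⟩ := scale_error_bounds hR hM hs0 hx h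
  have hn1 : 1 ≤ R * M := by nlinarith
  obtain ⟨-, -, l3, l4, l5⟩ := log_pow_div_sqrt_le hn1
  rw [← hν] at l3 l4 l5
  have hν0 : 0 < ν := by rw [hν]; positivity
  have hℓ0 : 0 ≤ Real.log (R * M) := Real.log_nonneg hn1
  refine ⟨?_, ?_, ?_, ?_, ?_⟩
  · refine le_trans ?_ b1
    rw [mul_comm]
    gcongr
    norm_num
  · rw [div_le_div_iff₀ hM0 (by positivity)]
    calc x * R ^ 3 * (R ^ 6 * (R * M)) = x * R ^ 10 * M := by ring
      _ ≤ x * R ^ 16 * M := by gcongr; norm_num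
      _ ≤ γ ^ 2 * M := by gcongr
  · calc 4 * (Real.log (R * M) * (s * R ^ 7)) ≤
          4 * (Real.log (R * M) * (γ * (√(R * M))⁻¹)) := by gcongr
      _ = 4 * γ * (Real.log (R * M) * (√(R * M))⁻¹) := by ring
      _ ≤ 4 * γ * (50 * ν) := by gcongr
      _ = 200 * γ * ν := by ring
      _ ≤ C * ν := by gcongr; exact hC.2
      _ ≤ 1 := hsmall
  · calc _ = 16 * γ ^ 2 * (Real.log (R * M) ^ 2 * (R * M)⁻¹) := by field_simp; ring
      _ ≤ 16 * γ ^ 2 * (2500 * ν) := by gcongr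
      _ = 320000 * γ ^ 2 * ν / 8 := by ring
      _ ≤ C * ν / 8 := by gcongr; exact hC.1
      _ ≤ 1 / 8 := by gcongr
  · calc 266240 * (x * s * R ^ 18) * Real.log (R * M) ^ 5 ≤
          266240 * (γ ^ 3 * (√(R * M))⁻¹) * Real.log (R * M) ^ 5 := by gcongr
      _ = 266240 * γ ^ 3 * (Real.log (R * M) ^ 5 * (√(R * M))⁻¹) := by ring
      _ ≤ 266240 * γ ^ 3 * (312500000 * ν) := by gcongr
      _ = _ := by ring

/-- Collecting the error terms of the region estimate. -/
lemma region_error_le {R M s x γ K K₅ κ ρ q₀ P ν A : ℝ} (hR : 1 ≤ R) (hM : 1 ≤ M) (hs0 : 0 < s)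
    (hx : x = M * s ^ 2) (h : s * R ^ 8 * √M ≤ γ) (hν : ν = (R * M) ^ (-(2 : ℝ) / 5))
    (hK : 1 ≤ K) (hK5 : 0 < K₅) (hκ : κ * (R * M) ≤ γ ^ 2) (hq : q₀ ≤ γ ^ 2)
    (hρ0 : 0 ≤ ρ) (hρ1 : ρ ≤ 1) (hρ : ρ ≤ A * ν) (hP0 : 0 ≤ P)
    (hP : P ≤ K₅ * (R * M)⁻¹) :
    (Real.exp ρ + Real.exp q₀) * (Real.exp (K * (κ * (R * M))) * K *
        (R ^ 4 * (s * R + x * (√M)⁻¹ * R ^ 2) + ρ)) +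
      Real.exp q₀ * (P + R * M * (K * (√R * s) ^ 3 + (s ^ 2 * (6 + 9 * R)) ^ 2)) ≤
    ((Real.exp 1 + Real.exp (γ ^ 2)) * (Real.exp (K * γ ^ 2) * K * ((γ + γ ^ 2) + A)) +
      Real.exp (γ ^ 2) * (K₅ + (K * γ ^ 3 + 225 * γ ^ 4))) * ν := by
  have hR0 : 0 < R := by linarith
  have hM0 : 0 < M := by linarith
  have hx0 : 0 < x := by rw [hx]; positivity
  have hγ0 : 0 < γ := lt_of_lt_of_le (by positivity) h
  obtain ⟨-, -, b3, -, b5, b6⟩ := scale_error_bounds hR hM hs0 hx h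
  have hn1 : 1 ≤ R * M := by nlinarith
  obtain ⟨l1, l2, -, -, -⟩ := log_pow_div_sqrt_le hn1
  rw [← hν] at l1 l2
  have hν0 : 0 < ν := by rw [hν]; positivity
  have e1 : R ^ 4 * (s * R + x * (√M)⁻¹ * R ^ 2) + ρ ≤ ((γ + γ ^ 2) + A) * ν := by
    rw [add_mul _ A]
    exact add_le_add (b3.trans (by gcongr)) hρ
  have e2 : P + R * M * (K * (√R * s) ^ 3 + (s ^ 2 * (6 + 9 * R)) ^ 2) ≤
      (K₅ + (K * γ ^ 3 + 225 * γ ^ 4)) * ν := by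
    calc P + R * M * (K * (√R * s) ^ 3 + (s ^ 2 * (6 + 9 * R)) ^ 2) =
          P + (K * (R * M * (√R * s) ^ 3) + R * M * (s ^ 2 * (6 + 9 * R)) ^ 2) := by ring
      _ ≤ K₅ * ν + (K * (γ ^ 3 * ν) + 225 * γ ^ 4 * ν) := by
          refine add_le_add (hP.trans (by gcongr)) (add_le_add ?_ (b5.trans (by gcongr)))
          exact mul_le_mul_of_nonneg_left (b6.trans (by gcongr)) (by linarith)
      _ = _ := by ring
  have e3 : 0 ≤ R ^ 4 * (s * R + x * (√M)⁻¹ * R ^ 2) + ρ := by positivity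
  have hA : 0 ≤ ((γ + γ ^ 2) + A) * ν := e3.trans e1
  calc _ ≤ (Real.exp 1 + Real.exp (γ ^ 2)) * (Real.exp (K * γ ^ 2) * K *
          (((γ + γ ^ 2) + A) * ν)) +
        Real.exp (γ ^ 2) * ((K₅ + (K * γ ^ 3 + 225 * γ ^ 4)) * ν) := by gcongr
    _ = _ := by ring

set_option maxHeartbeats 1000000 in
/-- The value of the integral over the region, relative to the Gaussian normalisation. -/
lemma exists_integral_region_bound {c : ℝ} (hc : 0 < c) : ∃ C : ℝ, 1 ≤ C ∧ ∀ r m d : ℕ, 3 ≤ r →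
    1 ≤ m → 1 ≤ d → d ≤ m ^ (r - 1) - 1 →
    c * (r : ℝ) ^ 16 * (m : ℝ) ^ ((2 : ℤ) - (r : ℤ)) ≤ Lam r m d →
    C * ((r : ℝ) * m) ^ (-(2 : ℝ) / 5) ≤ 1 →
    ∀ Ω : Set (Fin r × Fin m → ℝ), MeasurableSet Ω →
      Uball r m (2 * rho0 r m d / (3 * r)) ⊆ Ω → Ω ⊆ Uball r m (4 * rho0 r m d) →
      ∃ (I : ℂ) (ε : ℝ), |ε| ≤ C * ((r : ℝ) * m) ^ (-(2 : ℝ) / 5) ∧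
        -C ≤ -(r : ℝ) / (12 * Lam r m d * (m : ℝ) ^ (r - 2)) ∧
        ‖I - ((Real.exp (-(r : ℝ) / (12 * Lam r m d * (m : ℝ) ^ (r - 2)) + ε) : ℝ) : ℂ)‖ ≤
          C * ((r : ℝ) * m) ^ (-(2 : ℝ) / 5) ∧
        (∫ θ in Ω, Ffun r m d θ * Complex.exp (-((qW r m d θ : ℝ) : ℂ))) =
          ((Real.pi ^ (((r * m : ℕ) : ℝ) / 2) *
            ((Amat r m (Lam r m d) + (Wmat r m (Lam r m d))ᵀ *
              Wmat r m (Lam r m d)).det) ^ (-(1 : ℝ) / 2) : ℝ) : ℂ) * I := by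
  obtain ⟨K, hK, H⟩ := exists_norm_setIntegral_sub_le
  obtain ⟨K5, hK5, H5⟩ := exists_measureReal_compl_le
  obtain ⟨γ, hγ⟩ : ∃ γ : ℝ, γ = (√c)⁻¹ := ⟨_, rfl⟩
  have hγ0 : 0 < γ := by rw [hγ]; positivity
  obtain ⟨A, hA⟩ : ∃ A : ℝ, A = 83200000000000 * γ ^ 3 := ⟨_, rfl⟩
  obtain ⟨C1, hC1⟩ : ∃ C1 : ℝ, C1 =
    (Real.exp 1 + Real.exp (γ ^ 2)) * (Real.exp (K * γ ^ 2) * K * ((γ + γ ^ 2) + A)) +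
      Real.exp (γ ^ 2) * (K5 + (K * γ ^ 3 + 225 * γ ^ 4)) := ⟨_, rfl⟩
  have hA0 : 0 < A := by rw [hA]; positivity
  have hC10 : 0 < C1 := by rw [hC1]; positivity
  have hγ2 : 0 < γ ^ 2 := by positivity
  obtain ⟨C, hC⟩ : ∃ C : ℝ, C = 1 + (27 + γ) + C1 + A + 320000 * γ ^ 2 + 200 * γ := ⟨_, rfl⟩
  refine ⟨C, by linarith, ?_⟩
  intro r m d hr hm hd hd2 hΛc hsmall Ω hΩ hΩ1 hΩ2
  have hr0 : r ≠ 0 := by omega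
  have hm0 : m ≠ 0 := by omega
  obtain ⟨hl0, hl1, hΛ, hΛ4, hs0, hs, hsγ, hk⟩ := scale_facts hc hr hm hd hd2 hΛc
  have hρ0 := rho0_eq r m d
  have hsq := sq_div_pow_le hc hr hm hΛ4 hk
  rw [← hγ] at hsγ hsq
  generalize (√(Lam r m d * (m : ℝ) ^ (r - 1)))⁻¹ = s at *
  have hR : (1 : ℝ) ≤ r := by exact_mod_cast (by omega : 1 ≤ r)
  have hM : (1 : ℝ) ≤ m := by exact_mod_cast hm
  have hR0 : (0 : ℝ) < r := by linarith
  have hM0 : (0 : ℝ) < m := by linarith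
  obtain ⟨x, hx⟩ : ∃ x : ℝ, x = m * s ^ 2 := ⟨_, rfl⟩
  have hx0 : 0 < x := by rw [hx]; positivity
  have hn1 : 1 ≤ (r : ℝ) * m := by nlinarith
  have hxΛ : x * (Lam r m d * (m : ℝ) ^ (r - 2)) = 1 := by
    have e : (m : ℝ) ^ (r - 1) = (m : ℝ) ^ (r - 2) * m := by
      rw [← pow_succ]; congr 1; omega
    rw [e] at hs
    rw [hx]; linear_combination hs
  obtain ⟨ν, hν⟩ : ∃ ν : ℝ, ν = ((r : ℝ) * m) ^ (-(2 : ℝ) / 5) := ⟨_, rfl⟩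
  have hν0 : 0 < ν := by rw [hν]; positivity
  rw [← hν] at hsmall ⊢
  obtain ⟨p1, p2, p3, p4, p5⟩ := region_parameter_bounds (C := C) hR hM hs0 hx hsγ hν
    ⟨by linarith, by linarith⟩ hsmall
  rw [← hA] at p5
  have hρnn : 0 ≤ 266240 * (x * s * (r : ℝ) ^ 18) * Real.log ((r : ℝ) * m) ^ 5 := by
    have := Real.log_nonneg hn1
    positivity
  have hρ1 : 266240 * (x * s * (r : ℝ) ^ 18) * Real.log ((r : ℝ) * m) ^ 5 ≤ 1 := by
    refine p5.trans (le_trans ?_ hsmall)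
    gcongr
    linarith
  have hS : MeasurableSet {h : Fin r × Fin m → ℝ | s • shrink h ∈ Ω} :=
    (continuous_shrink.const_smul s).measurable hΩ
  have box := fun (h : Fin r × Fin m → ℝ) (hh : s • shrink h ∈ Ω) =>
    integrand_on_box hr hm hl0 hl1 hΛ hs0 hs hx hρ0 p2 p3 (hΩ2 hh)
  obtain ⟨g, hg⟩ : ∃ g : (Fin r × Fin m → ℝ) → ℂ, g = fun h =>
    ((Real.exp ((∑ p, h p ^ 2) / 2) : ℝ) : ℂ) * (Ffun r m d (s • shrink h) *
      Complex.exp (-((qW r m d (s • shrink h) : ℝ) : ℂ))) := ⟨_, rfl⟩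
  have gc : Continuous g := by
    rw [hg]
    refine Continuous.mul (by fun_prop) ?_
    exact (continuous_integrand r m d).comp (continuous_shrink.const_smul s)
  have gexp : ∀ h : Fin r × Fin m → ℝ, ∀ z : ℂ, ((Real.exp ((∑ p, h p ^ 2) / 2) : ℝ) : ℂ) *
      (((Real.exp (-(∑ p, h p ^ 2) / 2) : ℝ) : ℂ) * z) = z := fun h z => by
    rw [← mul_assoc, ← Complex.ofReal_mul, ← Real.exp_add]
    have : (∑ p, h p ^ 2) / 2 + -(∑ p, h p ^ 2) / 2 = 0 := by ring
    rw [this]; simp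
  have gexp2 : ∀ h : Fin r × Fin m → ℝ, ∀ z : ℂ, ((Real.exp (-(∑ p, h p ^ 2) / 2) : ℝ) : ℂ) *
      (((Real.exp ((∑ p, h p ^ 2) / 2) : ℝ) : ℂ) * z) = z := fun h z => by
    rw [mul_left_comm, gexp]
  have int := setIntegral_eq_stdGauss hΛ.le hr0 hm0 hs (continuous_integrand r m d) hΩ (g := g)
    (fun h _ => by rw [hg]; exact (gexp2 h _).symm)
  have main := H r m hr0 hm0 ((1 - 6 * Lam r m d) / 24) ((1 - 2 * lam r m d) / 6) s x
    _ (γ ^ 2 / ((r : ℝ) ^ 6 * (r * m))) (4 * (r : ℝ) ^ 3 * Real.log ((r : ℝ) * m))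
    (abs_le.2 ⟨by linarith, by linarith⟩) (abs_le.2 ⟨by linarith, by linarith⟩) hs0.le hx0.le
    hρnn (by positivity) p4 _ hS g gc (fun h hh => by
      obtain ⟨c1, c2, z, c3, c4⟩ := box h hh
      exact ⟨c1, c2, z, c3, by rw [hg]; simp only [c4, gexp]⟩)
  rw [exponent_eq (show Lam r m d = lam r m d * (1 - lam r m d) from rfl) hx] at main
  have hu : -(r : ℝ) / (12 * Lam r m d * (m : ℝ) ^ (r - 2)) = -(r * x / 12) := by
    rw [div_eq_iff (by positivity)]
    linear_combination (r : ℝ) * hxΛ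
  have hΛx : Lam r m d * x = ((m : ℝ) ^ (r - 2))⁻¹ := by
    rw [← one_div, eq_div_iff (by positivity)]
    linear_combination hxΛ
  have hrr : (r : ℝ) ≤ (r : ℝ) ^ 2 := by nlinarith
  refine ⟨_, Lam r m d * x * (r / 3 - (r : ℝ) ^ 2 / 4), ?_, ?_, ?_, int⟩
  · have h1 : |(r : ℝ) / 3 - (r : ℝ) ^ 2 / 4| ≤ (r : ℝ) ^ 2 :=
      abs_le.2 ⟨by nlinarith, by nlinarith⟩
    rw [hΛx, abs_mul, abs_of_pos (by positivity)]
    obtain ⟨-, l2, -, -, -⟩ := log_pow_div_sqrt_le hn1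
    rw [← hν] at l2
    calc _ ≤ ((m : ℝ) ^ (r - 2))⁻¹ * (r : ℝ) ^ 2 := by gcongr
      _ = (r : ℝ) ^ 2 * ((m : ℝ) ^ (r - 2))⁻¹ := mul_comm _ _
      _ ≤ (27 + γ) * ((r : ℝ) * m)⁻¹ := hsq
      _ ≤ (27 + γ) * ν := by gcongr
      _ ≤ C * ν := by gcongr; linarith
  · have : (r : ℝ) * x ≤ (r : ℝ) ^ 2 * x := by gcongr
    rw [hu]; linarith
  · rw [hu]
    refine main.trans ((region_error_le (P := _) (A := A) hR hM hs0 hx hsγ hν hK hK5 ?_ ?_ hρnn hρ1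
      p5 measureReal_nonneg (H5 r m d hr hm s hs0 hρ0 Ω hΩ1)).trans ?_)
    · have h6 : 1 ≤ (r : ℝ) ^ 6 := one_le_pow₀ hR
      rw [div_mul_eq_mul_div, div_le_iff₀ (by positivity)]
      exact mul_le_mul_of_nonneg_left (le_mul_of_one_le_left (by positivity) h6) hγ2.le
    · have h7 : 0 < (r : ℝ) ^ 2 * x := by positivity
      have h8 : 0 < (r : ℝ) ^ 2 * x * Lam r m d := by positivity
      linarith
    · rw [← hC1]
      gcongr
      linarith

/-- for every `c > 0` there are `C > 0` and `N` such that whenever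
`n = rm ≥ N`, `r ≥ 3`, `1 ≤ d ≤ m^{r−1} − 1`, `Λ ≥ c·r^16·m^{2−r}`, and `Ω̄` is a
measurable set with `U_n(2ρ₀/(3r)) ⊆ Ω̄ ⊆ U_n(4ρ₀)`, one has
`∫_{Ω̄} F(θ) e^{−θᵗWᵗWθ} dθ = π^{n/2} det(A + WᵗW)^{−1/2}
  exp(−r/(12Λm^{r−2}) + δ)` with `|δ| ≤ C n^{−2/5}`. -/
theorem integral_inside_main_region (c : ℝ) (hc : 0 < c) :
    ∃ C : ℝ, 0 < C ∧ ∃ N : ℕ, ∀ r m d : ℕ, 3 ≤ r → 1 ≤ m → N ≤ r * m →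
      1 ≤ d → d ≤ m ^ (r - 1) - 1 →
      c * (r : ℝ) ^ 16 * (m : ℝ) ^ ((2 : ℤ) - (r : ℤ)) ≤ Lam r m d →
      ∀ Ω : Set (Fin r × Fin m → ℝ), MeasurableSet Ω →
        Uball r m (2 * rho0 r m d / (3 * r)) ⊆ Ω → Ω ⊆ Uball r m (4 * rho0 r m d) →
        ∃ δ : ℂ, ‖δ‖ ≤ C * ((r * m : ℕ) : ℝ) ^ (-(2 : ℝ) / 5) ∧
          (∫ θ in Ω, Ffun r m d θ * Complex.exp (-((qW r m d θ : ℝ) : ℂ))) =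
            ((Real.pi ^ (((r * m : ℕ) : ℝ) / 2) *
              ((Amat r m (Lam r m d) + (Wmat r m (Lam r m d))ᵀ *
                Wmat r m (Lam r m d)).det) ^ (-(1 : ℝ) / 2) : ℝ) : ℂ) *
            Complex.exp
              (((-(r : ℝ) / (12 * Lam r m d * (m : ℝ) ^ (r - 2)) : ℝ) : ℂ) + δ) := by
  obtain ⟨C, hC, H⟩ := exists_integral_region_bound hc
  have hE : 1 ≤ Real.exp C := Real.one_le_exp (by linarith)
  have hC2 : 0 < C * (Real.exp C + 2) := by positivity
  have hlim : Tendsto (fun n : ℕ => (2 * (C * (Real.exp C + 2))) * (n : ℝ) ^ (-(2 : ℝ) / 5))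
      atTop (nhds 0) := by
    have h1 := (tendsto_rpow_neg_atTop (by norm_num : (0 : ℝ) < 2 / 5)).comp
      (tendsto_natCast_atTop_atTop (R := ℝ))
    have h2 := h1.const_mul (2 * (C * (Real.exp C + 2)))
    rw [mul_zero] at h2
    refine h2.congr fun n => ?_
    simp only [Function.comp_apply]
    norm_num
  obtain ⟨N, hN⟩ := eventually_atTop.1 (hlim.eventually_le_const zero_lt_one)
  refine ⟨2 * (C * (Real.exp C + 2)), by positivity, N, ?_⟩
  intro r m d hr hm hNn hd hd2 hΛ Ω hΩ hΩ1 hΩ2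
  have hsmall := hN (r * m) hNn
  have hcast : ((r * m : ℕ) : ℝ) = (r : ℝ) * m := by push_cast; rfl
  have hν : 0 ≤ ((r * m : ℕ) : ℝ) ^ (-(2 : ℝ) / 5) := by positivity
  have hC1 : C * ((r * m : ℕ) : ℝ) ^ (-(2 : ℝ) / 5) ≤ 1 := by
    refine le_trans ?_ hsmall
    gcongr
    nlinarith
  obtain ⟨I, ε, hε, hu, hI, hint⟩ := H r m d hr hm hd hd2 hΛ (by rwa [← hcast]) Ω hΩ hΩ1 hΩ2
  rw [← hcast] at hε hI
  set ν := ((r * m : ℕ) : ℝ) ^ (-(2 : ℝ) / 5)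
  set u := -(r : ℝ) / (12 * Lam r m d * (m : ℝ) ^ (r - 2))
  have hb : C * ν * Real.exp (-u) + 2 * |ε| ≤ C * (Real.exp C + 2) * ν := by
    have h1 : Real.exp (-u) ≤ Real.exp C := Real.exp_le_exp.2 (by linarith)
    have h2 : C * ν * Real.exp (-u) ≤ C * ν * Real.exp C := by gcongr
    linarith
  obtain ⟨δ, hδ, hIδ⟩ := exists_exp_eq_of_norm_sub_le hI (hε.trans hC1) (by linarith)
  refine ⟨δ, ?_, ?_⟩
  · linarith
  · rw [hint, hIδ]
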